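/- arXiv:1607.01031 — 2 statements merged into one kernel-verified Lean document; each statement's English description precedes it below -/
import Mathlib

section
/- Let Z be a set of exactly 9 points in the complex projective plane ℙ², not contained in a conic, with radical homogeneous ideal I, and assume α̂(I) < 5/2. Then the nine points form the following configuration: there is a line ℓ containing exactly six of the points, among them three points Q₁, Q₂, C; a point P not on ℓ; a point A on the line PQ₁ with A ∉ {P, Q₁} and A ∉ ℓ; a point B on the line PQ₂ with B ∉ {P, Q₂} and B ∉ ℓ; the points A, B, C are collinear; and the only triples of collinear points among the nine are those contained in ℓ, in the line through P, Q₁, A, in the line through P, Q₂, B, and in the line through A, B, C. -/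
open scoped LinearAlgebra.Projectivization

/-- A polynomial `F` vanishes to order at least `m` at the (affine representative) point
`v`: all iterated partial derivatives of order `≤ m - 1` (i.e. of order `< m`) vanish at `v`. -/
def VanishesToOrder (m : ℕ) (F : MvPolynomial (Fin 3) ℂ) (v : Fin 3 → ℂ) : Prop :=
  ∀ k : ℕ, k < m → ∀ d : Fin k → Fin 3,
    MvPolynomial.eval v ((List.ofFn d).foldl (fun p i => MvPolynomial.pderiv i p) F) = 0

/-- The `m`-th symbolic power of the (radical) ideal of a set `Z` of points of `ℙ²`:
all polynomials vanishing to order at least `m` at every point of `Z`. -/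
def symbolicPower (Z : Set (ℙ ℂ (Fin 3 → ℂ))) (m : ℕ) : Set (MvPolynomial (Fin 3) ℂ) :=
  {F | ∀ P ∈ Z, ∀ (v : Fin 3 → ℂ) (hv : v ≠ 0),
    Projectivization.mk ℂ v hv = P → VanishesToOrder m F v}

/-- The initial degree `α` of a set of polynomials: the least `t` such that the set contains
a nonzero homogeneous polynomial of degree `t`. -/
noncomputable def initialDegree (S : Set (MvPolynomial (Fin 3) ℂ)) : ℕ :=
  sInf {t | ∃ F ∈ S, F ≠ 0 ∧ F.IsHomogeneous t}

/-- The Waldschmidt constant `α̂(I) = inf_{m ≥ 1} α(I^(m))/m` of the radical ideal of `Z`. -/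
noncomputable def waldschmidt (Z : Set (ℙ ℂ (Fin 3 → ℂ))) : ℝ :=
  ⨅ m : ℕ+, (initialDegree (symbolicPower Z (m : ℕ)) : ℝ) / ((m : ℕ) : ℝ)

/-- A (homogeneous equation of a) line in `ℙ²`: a nonzero homogeneous polynomial of degree 1. -/
def IsLine (L : MvPolynomial (Fin 3) ℂ) : Prop := L ≠ 0 ∧ L.IsHomogeneous 1

/-- The point `x ∈ ℙ²` lies on the line (or curve) with equation `L`. -/
def MemLine (L : MvPolynomial (Fin 3) ℂ) (x : ℙ ℂ (Fin 3 → ℂ)) : Prop :=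
  ∀ (v : Fin 3 → ℂ) (hv : v ≠ 0), Projectivization.mk ℂ v hv = x → MvPolynomial.eval v L = 0

/-- Three points of `ℙ²` are collinear if some line contains all of them. -/
def Collin (x y z : ℙ ℂ (Fin 3 → ℂ)) : Prop :=
  ∃ M, IsLine M ∧ MemLine M x ∧ MemLine M y ∧ MemLine M z

/-- `Z` is contained in a conic: the zero set of a nonzero homogeneous polynomial of degree 2
(possibly degenerate). -/
def ContainedInConic (Z : Set (ℙ ℂ (Fin 3 → ℂ))) : Prop :=
  ∃ F : MvPolynomial (Fin 3) ℂ, F ≠ 0 ∧ F.IsHomogeneous 2 ∧ ∀ x ∈ Z, MemLine F x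

/-- The configuration of points consisting of: a line `L` containing exactly `t` points of `Z`,
among them three points `Q₁, Q₂, C`; a point `P ∈ Z` not on `L`; a point `A ∈ Z` on the line
`L₁` through `P` and `Q₁`, with `A ∉ {P, Q₁}` and `A` off `L`; a point `B ∈ Z` on the line `L₂`
through `P` and `Q₂`, with `B ∉ {P, Q₂}` and `B` off `L`; the points `A, B, C` collinear (on a
line `L₃`); and the only triples of collinear points of `Z` are those contained in one of the
lines `L`, `L₁`, `L₂`, `L₃`. -/
def StandardConfig (t : ℕ) (Z : Set (ℙ ℂ (Fin 3 → ℂ))) : Prop :=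
  ∃ L L₁ L₂ L₃ : MvPolynomial (Fin 3) ℂ, ∃ Q₁ Q₂ C P A B : ℙ ℂ (Fin 3 → ℂ),
    IsLine L ∧ IsLine L₁ ∧ IsLine L₂ ∧ IsLine L₃ ∧
    Q₁ ∈ Z ∧ Q₂ ∈ Z ∧ C ∈ Z ∧ P ∈ Z ∧ A ∈ Z ∧ B ∈ Z ∧
    Q₁ ≠ Q₂ ∧ Q₁ ≠ C ∧ Q₂ ≠ C ∧
    MemLine L Q₁ ∧ MemLine L Q₂ ∧ MemLine L C ∧
    (Z ∩ {x | MemLine L x}).ncard = t ∧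
    ¬ MemLine L P ∧
    MemLine L₁ P ∧ MemLine L₁ Q₁ ∧ MemLine L₁ A ∧ A ≠ P ∧ A ≠ Q₁ ∧ ¬ MemLine L A ∧
    MemLine L₂ P ∧ MemLine L₂ Q₂ ∧ MemLine L₂ B ∧ B ≠ P ∧ B ≠ Q₂ ∧ ¬ MemLine L B ∧
    MemLine L₃ A ∧ MemLine L₃ B ∧ MemLine L₃ C ∧
    (∀ X Y W, X ∈ Z → Y ∈ Z → W ∈ Z → X ≠ Y → X ≠ W → Y ≠ W → Collin X Y W →
      ((MemLine L X ∧ MemLine L Y ∧ MemLine L W) ∨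
       (MemLine L₁ X ∧ MemLine L₁ Y ∧ MemLine L₁ W) ∨
       (MemLine L₂ X ∧ MemLine L₂ Y ∧ MemLine L₂ W) ∨
       (MemLine L₃ X ∧ MemLine L₃ Y ∧ MemLine L₃ W)))

open MvPolynomial

/-- The Taylor expansion `F(v + tX)` of a ternary polynomial, as a polynomial in `t`. -/
noncomputable def taylorAt (v : Fin 3 → ℂ) :
    MvPolynomial (Fin 3) ℂ →ₐ[ℂ] Polynomial (MvPolynomial (Fin 3) ℂ) :=
  aeval fun i => Polynomial.C (C (v i)) + Polynomial.X * Polynomial.C (X i)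

/-- The order of vanishing of a nonzero polynomial at a vector (and `0` for the zero polynomial). -/
noncomputable def ordAt (v : Fin 3 → ℂ) (F : MvPolynomial (Fin 3) ℂ) : ℕ :=
  (taylorAt v F).natTrailingDegree

lemma taylorAt_ne_zero (v : Fin 3 → ℂ) {F : MvPolynomial (Fin 3) ℂ} (hF : F ≠ 0) :
    taylorAt v F ≠ 0 := by
  intro h
  apply hF
  let ψ : Polynomial (MvPolynomial (Fin 3) ℂ) →+* MvPolynomial (Fin 3) ℂ :=
    Polynomial.eval₂RingHom (aeval fun i => X i - C (v i)).toRingHom 1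
  have key : ψ.comp (taylorAt v).toRingHom = RingHom.id _ := by
    apply MvPolynomial.ringHom_ext
    · intro r
      simp [ψ, taylorAt]
    · intro i
      simp [ψ, taylorAt]
  have := congrArg (fun f => f F) key
  simpa [h] using this.symm

lemma ordAt_mul (v : Fin 3 → ℂ) {F G : MvPolynomial (Fin 3) ℂ} (hF : F ≠ 0) (hG : G ≠ 0) :
    ordAt v (F * G) = ordAt v F + ordAt v G := by
  rw [ordAt, map_mul,
    Polynomial.natTrailingDegree_mul (taylorAt_ne_zero v hF) (taylorAt_ne_zero v hG)]
  rfl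

lemma X_pow_ordAt_dvd (v : Fin 3 → ℂ) (F : MvPolynomial (Fin 3) ℂ) :
    Polynomial.X ^ ordAt v F ∣ taylorAt v F :=
  Polynomial.X_pow_dvd_iff.2 fun _ h => Polynomial.coeff_eq_zero_of_lt_natTrailingDegree h

lemma le_ordAt {v : Fin 3 → ℂ} {F : MvPolynomial (Fin 3) ℂ} (hF : F ≠ 0) {m : ℕ}
    (h : Polynomial.X ^ m ∣ taylorAt v F) : m ≤ ordAt v F :=
  Polynomial.le_natTrailingDegree (taylorAt_ne_zero v hF) (Polynomial.X_pow_dvd_iff.1 h)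

lemma coeff_zero_taylorAt (v : Fin 3 → ℂ) (F : MvPolynomial (Fin 3) ℂ) :
    (taylorAt v F).coeff 0 = C (eval v F) := by
  have key : (Polynomial.constantCoeff).comp (taylorAt v).toRingHom =
      (C : ℂ →+* MvPolynomial (Fin 3) ℂ).comp (eval v) := by
    apply MvPolynomial.ringHom_ext
    · intro r
      simp [taylorAt]
    · intro i
      simp [taylorAt]
  exact congrArg (fun f => f F) key

lemma ordAt_eq_zero {v : Fin 3 → ℂ} {F : MvPolynomial (Fin 3) ℂ} (h : eval v F ≠ 0) :
    ordAt v F = 0 := by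
  apply Polynomial.natTrailingDegree_eq_zero.2
  right
  rw [coeff_zero_taylorAt]
  simpa using h

lemma one_le_ordAt {v : Fin 3 → ℂ} {F : MvPolynomial (Fin 3) ℂ} (hF : F ≠ 0)
    (h : eval v F = 0) : 1 ≤ ordAt v F := by
  apply le_ordAt hF
  rw [pow_one, Polynomial.X_dvd_iff, coeff_zero_taylorAt, h, map_zero]

lemma derivative_taylorAt (v : Fin 3 → ℂ) (F : MvPolynomial (Fin 3) ℂ) :
    Polynomial.derivative (taylorAt v F) =
      ∑ i, Polynomial.C (X i) * taylorAt v (pderiv i F) := by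
  induction F using MvPolynomial.induction_on with
  | C a =>
    have : taylorAt v (C a) = Polynomial.C (C a) := by simp [taylorAt]
    simp [this]
  | add p q hp hq => simp [hp, hq, mul_add, Finset.sum_add_distrib]
  | mul_X p j hp =>
    have hX : taylorAt v (X j) = Polynomial.C (C (v j)) + Polynomial.X * Polynomial.C (X j) := by
      simp [taylorAt]
    simp only [map_mul, Polynomial.derivative_mul, hp, Derivation.leibniz, pderiv_X, smul_eq_mul,
      map_add, mul_add, Finset.sum_add_distrib]
    rw [add_comm]
    congr 1
    · rw [hX]
      simp only [Polynomial.derivative_add, Polynomial.derivative_C, Polynomial.derivative_mul,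
        Polynomial.derivative_X, zero_add, one_mul, mul_zero, add_zero, Pi.single_apply]
      simp [Finset.sum_ite_eq, mul_comm]
    · rw [Finset.sum_mul]
      exact Finset.sum_congr rfl fun i _ => by ring

lemma X_pow_dvd_taylorAt {m : ℕ} {F : MvPolynomial (Fin 3) ℂ} {v : Fin 3 → ℂ}
    (h : VanishesToOrder m F v) : Polynomial.X ^ m ∣ taylorAt v F := by
  induction m generalizing F with
  | zero => simp
  | succ m ih =>
    have h0 : eval v F = 0 := by simpa using h 0 (Nat.succ_pos m) Fin.elim0
    have hd : ∀ i, Polynomial.X ^ m ∣ taylorAt v (pderiv i F) := fun i => ih fun k hk d => by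
      simpa [List.ofFn_succ] using h (k + 1) (by lia) (Fin.cons i d)
    have hder : Polynomial.X ^ m ∣ Polynomial.derivative (taylorAt v F) := by
      rw [derivative_taylorAt]
      exact Finset.dvd_sum fun i _ => (hd i).mul_left _
    rw [Polynomial.X_pow_dvd_iff] at hder ⊢
    intro j hj
    rcases j with _ | j
    · rw [coeff_zero_taylorAt, h0, map_zero]
    · have := hder j (by lia)
      rw [Polynomial.coeff_derivative] at this
      rcases mul_eq_zero.1 this with h | h
      · exact h
      · exact absurd h (by exact_mod_cast Nat.succ_ne_zero j)

lemma vanishesToOrder_of_pow_dvd {L : MvPolynomial (Fin 3) ℂ} {v : Fin 3 → ℂ}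
    (hL : eval v L = 0) {m : ℕ} {F : MvPolynomial (Fin 3) ℂ} (h : L ^ m ∣ F) :
    VanishesToOrder m F v := by
  intro k
  induction k generalizing m F with
  | zero =>
    intro hk d
    obtain ⟨G, rfl⟩ := h
    simp [hL, hk.ne']
  | succ k ih =>
    intro hk d
    obtain ⟨m, rfl⟩ : ∃ n, m = n + 1 := ⟨m - 1, by lia⟩
    rw [List.ofFn_succ, List.foldl_cons]
    refine ih (m := m) ?_ (by lia) _
    obtain ⟨G, rfl⟩ := h
    rw [Derivation.leibniz, Derivation.leibniz_pow]
    simp only [smul_eq_mul, Nat.add_sub_cancel, nsmul_eq_mul]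
    exact dvd_add ((pow_dvd_pow _ (Nat.le_succ m)).mul_right _)
      (((dvd_mul_right _ _).mul_left _).mul_left _)

lemma aeval_mul_of_isHomogeneous {A : Type*} [CommRing A] [Algebra ℂ A] {d : ℕ}
    {F : MvPolynomial (Fin 3) ℂ} (hF : F.IsHomogeneous d) (a : A) (g : Fin 3 → A) :
    aeval (fun i => a * g i) F = a ^ d * aeval g F := by
  rw [aeval_def, aeval_def, eval₂_eq', eval₂_eq', Finset.mul_sum]
  refine Finset.sum_congr rfl fun s hs => ?_
  have hd : ∑ i, s i = d := by
    rw [hF.degree_eq_sum_deg_support hs]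
    exact (Finset.sum_subset (Finset.subset_univ _) (by simp)).symm
  rw [Finset.prod_congr rfl fun i _ => mul_pow a (g i) (s i), Finset.prod_mul_distrib,
    Finset.prod_pow_eq_pow_sum, hd]
  ring

lemma eval_smul_of_isHomogeneous {d : ℕ} {F : MvPolynomial (Fin 3) ℂ} (hF : F.IsHomogeneous d)
    (a : ℂ) (v : Fin 3 → ℂ) : eval (a • v) F = a ^ d * eval v F := by
  have := aeval_mul_of_isHomogeneous hF a v
  rwa [aeval_eq_eval, aeval_eq_eval] at this

lemma pow_ordAt_dvd_aeval {d : ℕ} {F : MvPolynomial (Fin 3) ℂ} (hF : F.IsHomogeneous d)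
    {v : Fin 3 → ℂ} (φ : Fin 3 → Polynomial ℂ) (t c : ℂ) (hc : c ≠ 0)
    (h : ∀ i, (φ i).eval t = c * v i) :
    (Polynomial.X - Polynomial.C t) ^ ordAt v F ∣ aeval φ F := by
  have hdiv : ∀ i, ∃ ψ : Polynomial ℂ,
      φ i = Polynomial.C c * (Polynomial.C (v i) + (Polynomial.X - Polynomial.C t) * ψ) := by
    intro i
    obtain ⟨ψ, hψ⟩ := Polynomial.X_sub_C_dvd_sub_C_eval (a := t) (p := φ i)
    refine ⟨Polynomial.C c⁻¹ * ψ, ?_⟩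
    have hcc : Polynomial.C c * Polynomial.C c⁻¹ = 1 := by
      rw [← Polynomial.C_mul, mul_inv_cancel₀ hc, Polynomial.C_1]
    rw [h i, Polynomial.C_mul] at hψ
    linear_combination hψ - (Polynomial.X - Polynomial.C t) * ψ * hcc
  choose ψ hψ using hdiv
  rw [funext hψ, aeval_mul_of_isHomogeneous hF]
  apply Dvd.dvd.mul_left
  let θ : Polynomial (MvPolynomial (Fin 3) ℂ) →+* Polynomial ℂ :=
    Polynomial.eval₂RingHom (aeval ψ).toRingHom (Polynomial.X - Polynomial.C t)
  have key : θ.comp (taylorAt v).toRingHom =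
      (aeval fun i => Polynomial.C (v i) + (Polynomial.X - Polynomial.C t) * ψ i).toRingHom := by
    apply MvPolynomial.ringHom_ext
    · intro r
      simp [θ, taylorAt]
    · intro i
      simp [θ, taylorAt]
      ring
  have hk : θ (taylorAt v F) =
      aeval (fun i => Polynomial.C (v i) + (Polynomial.X - Polynomial.C t) * ψ i) F :=
    congrArg (fun f => f F) key
  rw [← hk]
  have := map_dvd θ (X_pow_ordAt_dvd v F)
  simpa [θ] using this

lemma eq_of_smul_rep_eq {p q : ℙ ℂ (Fin 3 → ℂ)} {a b : ℂ} (ha : a ≠ 0)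
    (h : a • p.rep = b • q.rep) : p = q := by
  rw [← p.mk_rep, ← q.mk_rep, Projectivization.mk_eq_mk_iff']
  exact ⟨a⁻¹ * b, by rw [mul_smul, ← h, smul_smul, inv_mul_cancel₀ ha, one_smul]⟩

/-- Bounded vanishing along a parametrized curve: `Φ` is a homogeneous map of degree `n`,
invariant under translation by `p₀`, which reaches each point of `S`. -/
lemma sum_ordAt_le_of_parametrization {n d : ℕ} (hn : 0 < n) {p₀ : Fin 3 → ℂ} (hp₀ : p₀ ≠ 0)
    (Φ : Fin 3 → MvPolynomial (Fin 3) ℂ) (hΦ : ∀ i, (Φ i).IsHomogeneous n)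
    (hinv : ∀ x (c : ℂ) i, eval (x + c • p₀) (Φ i) = eval x (Φ i))
    (S : Finset (ℙ ℂ (Fin 3 → ℂ)))
    (hS : ∀ p ∈ S, ∃ (x : Fin 3 → ℂ) (c : ℂ), x ∉ Submodule.span ℂ {p₀} ∧ c ≠ 0 ∧
      ∀ i, eval x (Φ i) = c * p.rep i)
    {F : MvPolynomial (Fin 3) ℂ} (hF : F.IsHomogeneous d) (h0 : aeval Φ F ≠ 0) :
    ∑ p ∈ S, ordAt p.rep F ≤ d * n := by
  classical
  have hF0 : F ≠ 0 := by rintro rfl; simp at h0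
  rcases Nat.eq_zero_or_pos d with rfl | hd
  · rw [Finset.sum_eq_zero, zero_mul]
    intro p _
    apply ordAt_eq_zero
    rw [← totalDegree_zero_iff_isHomogeneous, totalDegree_eq_zero_iff_eq_C] at hF
    rw [hF] at hF0 ⊢
    simpa using hF0
  have hcomp : ∀ x, eval x (aeval Φ F) = eval (fun i => eval x (Φ i)) F := fun x => by
    rw [← aeval_eq_eval, ← aeval_eq_eval, ← AlgHom.comp_apply, comp_aeval]
  have hhom : (aeval Φ F).IsHomogeneous (n * d) := hF.aeval Φ hΦ
  obtain ⟨a, ha⟩ : ∃ a, eval a (aeval Φ F) ≠ 0 := by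
    by_contra! h
    exact h0 (MvPolynomial.funext fun x => by simpa using h x)
  have ha' : a ∉ Submodule.span ℂ {p₀} := by
    intro h
    obtain ⟨c, rfl⟩ := Submodule.mem_span_singleton.1 h
    apply ha
    have h1 : ∀ i, eval (c • p₀) (Φ i) = eval 0 (Φ i) := fun i => by simpa using hinv 0 c i
    rw [hcomp, _root_.funext h1, ← hcomp]
    have := eval_smul_of_isHomogeneous hhom 0 0
    simpa [hd.ne', hn.ne'] using this
  choose! x c hx hc hxc using hS
  obtain ⟨e, he⟩ := Submodule.exists_forall_notMem_of_forall_ne_top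
    (fun q : Option S => Submodule.span ℂ {p₀, q.elim a fun p => x p}) (by
      intro q h
      have := finrank_span_le_card (R := ℂ) ({p₀, q.elim a fun p => x p} : Set (Fin 3 → ℂ))
      rw [h, finrank_top, Module.finrank_fin_fun] at this
      have h2 := (Set.toFinset_card ({p₀, q.elim a fun p => x p} : Set (Fin 3 → ℂ)))
      have := Finset.card_le_two (a := p₀) (b := q.elim a fun p => x p)
      simp at *
      lia)
  have hspan : ∀ y : Fin 3 → ℂ, ∃ α β γ : ℂ, y = α • a + β • e + γ • p₀ := by
    have hli : LinearIndependent ℂ ![e, a, p₀] := by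
      have h1 := he none
      have h2 : Set.range ![a, p₀] = {p₀, a} := by simp [Set.pair_comm]
      refine linearIndependent_finCons.2 ⟨linearIndependent_finCons.2
        ⟨by simpa [linearIndependent_unique_iff] using hp₀, by simpa using ha'⟩, ?_⟩
      change e ∉ Submodule.span ℂ (Set.range ![a, p₀])
      rw [h2]
      simpa using h1
    intro y
    have htop := hli.span_eq_top_of_card_eq_finrank' (by simp)
    have hy : y ∈ Submodule.span ℂ (Set.range ![e, a, p₀]) := htop ▸ Submodule.mem_top
    have hr : Set.range ![e, a, p₀] = {e, a, p₀} := by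
      ext y
      simp [eq_comm]
      tauto
    rw [hr, Submodule.mem_span_triple] at hy
    obtain ⟨β, α, γ, rfl⟩ := hy
    exact ⟨α, β, γ, by abel⟩
  let φ : Fin 3 → Polynomial ℂ := fun i =>
    aeval (fun j => Polynomial.C (a j) + Polynomial.X * Polynomial.C (e j)) (Φ i)
  have hφ : ∀ t i, (φ i).eval t = eval (a + t • e) (Φ i) := fun t i => by
    rw [← aeval_eq_eval, ← Polynomial.coe_aeval_eq_eval, ← AlgHom.comp_apply, comp_aeval]
    congr 2
    ext j
    simp
    ring
  have hτ : ∀ p ∈ S, ∃ t k : ℂ, k ≠ 0 ∧ ∀ i, (φ i).eval t = k * p.rep i := by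
    intro p hp
    obtain ⟨α, β, γ, hy⟩ := hspan (x p)
    have hα : α ≠ 0 := by
      rintro rfl
      apply he (some ⟨p, hp⟩)
      have hβ : β ≠ 0 := by
        rintro rfl
        apply hx p hp
        rw [hy]
        simpa using Submodule.smul_mem _ γ (Submodule.mem_span_singleton_self p₀)
      rw [Submodule.mem_span_pair]
      refine ⟨-(β⁻¹ * γ), β⁻¹, ?_⟩
      simp only [Option.elim_some, hy, smul_add, smul_smul, inv_mul_cancel₀ hβ]
      module
    refine ⟨α⁻¹ * β, (α⁻¹) ^ n * c p, mul_ne_zero (pow_ne_zero _ (inv_ne_zero hα)) (hc p hp),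
      fun i => ?_⟩
    rw [mul_assoc, ← hxc p hp i, hφ, ← eval_smul_of_isHomogeneous (hΦ i), hy, smul_add,
      smul_smul _ γ, hinv, smul_add, smul_smul, smul_smul, inv_mul_cancel₀ hα, one_smul]
  choose! τ k hk hτ using hτ
  have hfne : aeval φ F ≠ 0 := by
    intro h
    apply ha
    have h1 : Polynomial.eval 0 (aeval φ F) = eval (fun i => (φ i).eval 0) F := by
      rw [← aeval_eq_eval, ← Polynomial.coe_aeval_eq_eval, ← AlgHom.comp_apply, comp_aeval]
    rw [h] at h1
    simp only [hφ, zero_smul, add_zero, Polynomial.eval_zero] at h1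
    rw [hcomp, ← h1]
  have hdeg : (aeval φ F).natDegree ≤ d * n := by
    refine aeval_natDegree_le F hF.totalDegree_le φ fun i => ?_
    refine (aeval_natDegree_le (Φ i) (hΦ i).totalDegree_le _ (n := 1) fun j => ?_).trans
      (mul_one n).le
    compute_degree
  have hdvd : ∏ p ∈ S, (Polynomial.X - Polynomial.C (τ p)) ^ ordAt p.rep F ∣ aeval φ F := by
    refine Finset.prod_dvd_of_coprime (fun p hp q hq hpq => ?_) fun p hp =>
      pow_ordAt_dvd_aeval hF φ (τ p) (k p) (hk p hp) (hτ p hp)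
    refine (Polynomial.isCoprime_X_sub_C_of_isUnit_sub (IsUnit.mk0 _ (sub_ne_zero.2 ?_))).pow
    intro h
    refine hpq (eq_of_smul_rep_eq (hk p hp) (b := k q) ?_)
    ext i
    simp only [Pi.smul_apply, smul_eq_mul]
    rw [← hτ p hp, ← hτ q hq, h]
  have := (Polynomial.natDegree_le_of_dvd hdvd hfne).trans hdeg
  rwa [Polynomial.natDegree_prod_of_monic _ _ fun p _ =>
    (Polynomial.monic_X_sub_C _).pow _, Finset.sum_congr rfl fun p _ => by
      rw [Polynomial.natDegree_pow, Polynomial.natDegree_X_sub_C, mul_one]] at this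

/-- The complex projective plane. -/
abbrev Plane := ℙ ℂ (Fin 3 → ℂ)

/-- Polynomials in three variables over `ℂ`. -/
abbrev TernaryPoly := MvPolynomial (Fin 3) ℂ

lemma memLine_iff {d : ℕ} {G : TernaryPoly} (hG : G.IsHomogeneous d) (p : Plane) :
    MemLine G p ↔ eval p.rep G = 0 := by
  refine ⟨fun h => h p.rep p.rep_nonzero p.mk_rep, fun h v hv hp => ?_⟩
  rw [← p.mk_rep, Projectivization.mk_eq_mk_iff'] at hp
  obtain ⟨a, rfl⟩ := hp
  rw [eval_smul_of_isHomogeneous hG, h, mul_zero]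

lemma dvd_aeval_sub_aeval {Q : TernaryPoly} {Φ Ψ : Fin 3 → TernaryPoly}
    (h : ∀ i, Q ∣ Φ i - Ψ i) (F : TernaryPoly) : Q ∣ aeval Φ F - aeval Ψ F := by
  induction F using MvPolynomial.induction_on with
  | C a => simp
  | add p q hp hq =>
    rw [map_add, map_add, add_sub_add_comm]
    exact dvd_add hp hq
  | mul_X p j hp =>
    rw [map_mul, map_mul, aeval_X, aeval_X]
    have : aeval Φ p * Φ j - aeval Ψ p * Ψ j =
      (aeval Φ p - aeval Ψ p) * Φ j + aeval Ψ p * (Φ j - Ψ j) := by ring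
    rw [this]
    exact dvd_add (hp.mul_right _) ((h j).mul_left _)

/-- The linear form with given coefficients. -/
noncomputable def linForm (c : Fin 3 → ℂ) : TernaryPoly := ∑ i, C (c i) * X i

lemma isHomogeneous_linForm (c : Fin 3 → ℂ) : (linForm c).IsHomogeneous 1 :=
  IsHomogeneous.sum _ _ _ fun _ _ => isHomogeneous_C_mul_X _ _

lemma eval_linForm (c x : Fin 3 → ℂ) :
    eval x (linForm c) = c 0 * x 0 + c 1 * x 1 + c 2 * x 2 := by
  simp [linForm, Fin.sum_univ_three]

lemma exists_eq_linForm {L : TernaryPoly} (hL : L.IsHomogeneous 1) : ∃ c, L = linForm c := by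
  rw [← mem_homogeneousSubmodule, homogeneousSubmodule_one_eq_span_X,
    Submodule.mem_span_range_iff_exists_fun] at hL
  obtain ⟨c, rfl⟩ := hL
  exact ⟨c, by simp [linForm, smul_eq_C_mul]⟩

lemma linForm_ne_zero {c : Fin 3 → ℂ} (hc : c ≠ 0) : linForm c ≠ 0 := by
  intro h
  apply hc
  ext i
  have := eval_linForm c (Pi.single i 1)
  rw [h, map_zero] at this
  fin_cases i <;> simpa using this.symm

lemma exists_eval_ne_zero {F : TernaryPoly} (hF : F ≠ 0) : ∃ x, eval x F ≠ 0 := by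
  by_contra! h
  exact hF (MvPolynomial.funext fun x => by simpa using h x)

lemma IsLine.eval_add {L : TernaryPoly} (hL : IsLine L) (x y : Fin 3 → ℂ) :
    eval (x + y) L = eval x L + eval y L := by
  obtain ⟨c, rfl⟩ := exists_eq_linForm hL.2
  simp only [eval_linForm, Pi.add_apply]
  ring

lemma IsLine.eval_smul {L : TernaryPoly} (hL : IsLine L) (a : ℂ) (x : Fin 3 → ℂ) :
    eval (a • x) L = a * eval x L := by
  rw [eval_smul_of_isHomogeneous hL.2, pow_one]

lemma IsLine.prime {L : TernaryPoly} (hL : IsLine L) : Prime L := by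
  rw [← irreducible_iff_prime]
  refine irreducible_of_totalDegree_eq_one (hL.2.totalDegree hL.1) fun x hx => ?_
  rw [isUnit_iff_ne_zero]
  rintro rfl
  exact hL.1 (by ext i; simpa using hx i)

/-- The order of vanishing along a line not contained in a curve is at most the degree. -/
lemma IsLine.sum_ordAt_le {L : TernaryPoly} (hL : IsLine L) (S : Finset Plane)
    (hS : ∀ p ∈ S, eval p.rep L = 0) {d : ℕ} {F : TernaryPoly} (hF : F.IsHomogeneous d)
    (hLF : ¬ L ∣ F) : ∑ p ∈ S, ordAt p.rep F ≤ d := by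
  obtain ⟨p₀, hp₀⟩ := exists_eval_ne_zero hL.1
  have hp₀0 : p₀ ≠ 0 := by
    rintro rfl
    apply hp₀
    simpa using hL.eval_smul 0 0
  let Φ : Fin 3 → TernaryPoly := fun i => C (eval p₀ L) * X i - L * C (p₀ i)
  have h := sum_ordAt_le_of_parametrization one_pos hp₀0 Φ (fun i => ?_) (fun x c i => ?_) S
    (fun p hp => ⟨p.rep, eval p₀ L, fun hmem => ?_, hp₀, fun i => ?_⟩) hF (fun h0 => hLF ?_)
  · simpa using h
  · exact (isHomogeneous_C_mul_X _ _).sub (by simpa using hL.2.mul (isHomogeneous_C _ (p₀ i)))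
  · simp [Φ, hL.eval_add, hL.eval_smul]
    ring
  · obtain ⟨a, ha⟩ := Submodule.mem_span_singleton.1 hmem
    have h1 := hS p hp
    rw [← ha, hL.eval_smul] at h1
    rcases mul_eq_zero.1 h1 with rfl | h1
    · exact p.rep_nonzero (by simpa using ha.symm)
    · exact hp₀ h1
  · simp [Φ, hS p hp]
  · have h1 : L ∣ aeval Φ F - aeval (fun i => C (eval p₀ L) * X i) F :=
      dvd_aeval_sub_aeval (fun i => ⟨- C (p₀ i), by simp [Φ]⟩) F
    rw [h0, zero_sub, dvd_neg, aeval_mul_of_isHomogeneous hF, aeval_X_left_apply, ← map_pow] at h1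
    refine (hL.prime.dvd_or_dvd h1).resolve_left fun h2 => hL.prime.not_isUnit ?_
    exact isUnit_of_dvd_unit h2 ((isUnit_iff_ne_zero.2 (pow_ne_zero _ hp₀)).map C)

lemma isHomogeneous_of_mul_left {G H : TernaryPoly} {e d : ℕ} (hG : G.IsHomogeneous e)
    (hGH : (G * H).IsHomogeneous d) (h0 : G * H ≠ 0) :
    e ≤ d ∧ H.IsHomogeneous (d - e) := by
  have hG0 := left_ne_zero_of_mul h0
  have hH0 := right_ne_zero_of_mul h0
  have hle : e ≤ d := by
    rw [← hGH.totalDegree h0, totalDegree_mul_of_isDomain hG0 hH0, hG.totalDegree hG0]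
    exact Nat.le_add_right _ _
  refine ⟨hle, ?_⟩
  let _ := MvPolynomial.gradedAlgebra (σ := Fin 3) (R := ℂ)
  have h := DirectSum.coe_decompose_mul_of_left_mem_of_le (homogeneousSubmodule (Fin 3) ℂ)
    (b := H) hG hle
  rw [DirectSum.decompose_of_mem_same _ hGH] at h
  rw [mul_left_cancel₀ hG0 h]
  exact (DirectSum.decompose (homogeneousSubmodule (Fin 3) ℂ) H (d - e)).2

/-- The curve `G = 0` passes through the point `p`. -/
def On (G : TernaryPoly) (p : Plane) : Prop := eval p.rep G = 0

lemma memLine_iff_on {d : ℕ} {G : TernaryPoly} (hG : G.IsHomogeneous d) (p : Plane) :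
    MemLine G p ↔ On G p := memLine_iff hG p

lemma on_mk {d : ℕ} {G : TernaryPoly} (hG : G.IsHomogeneous d) {v : Fin 3 → ℂ} (hv : v ≠ 0)
    (h : eval v G = 0) : On G (Projectivization.mk ℂ v hv) := by
  obtain ⟨a, ha⟩ := Projectivization.exists_smul_eq_mk_rep ℂ v hv
  rw [On, ← ha, Units.smul_def, eval_smul_of_isHomogeneous hG, h, mul_zero]

lemma On.one_le_ordAt {G : TernaryPoly} {p : Plane} (h : On G p) (hG : G ≠ 0) :
    1 ≤ ordAt p.rep G := _root_.one_le_ordAt hG h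

/-- Two linearly independent vectors lie on a line. -/
lemma exists_isLine_eval_eq_zero {u v : Fin 3 → ℂ} (h : LinearIndependent ℂ ![u, v]) :
    ∃ L, IsLine L ∧ eval u L = 0 ∧ eval v L = 0 := by
  refine ⟨linForm (crossProduct u v), ⟨linForm_ne_zero ?_, isHomogeneous_linForm _⟩, ?_, ?_⟩
  · rwa [crossProduct_ne_zero_iff_linearIndependent]
  · rw [eval_linForm, cross_apply]
    simp
    ring
  · rw [eval_linForm, cross_apply]
    simp
    ring

lemma linearIndependent_rep {p q : Plane} (h : p ≠ q) :
    LinearIndependent ℂ ![p.rep, q.rep] := by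
  rw [LinearIndependent.pair_iff]
  intro s t hst
  have hs : s = 0 := by
    by_contra hs
    exact h (eq_of_smul_rep_eq hs (b := -t) (by
      rw [neg_smul]
      exact eq_neg_of_add_eq_zero_left hst))
  subst hs
  simpa [q.rep_nonzero] using hst

/-- The line through two points. -/
lemma exists_isLine_on {p q : Plane} (h : p ≠ q) : ∃ L, IsLine L ∧ On L p ∧ On L q :=
  exists_isLine_eval_eq_zero (linearIndependent_rep h)

/-- The quadratic form with given coefficients. -/
noncomputable def quadForm (c : Fin 6 → ℂ) : TernaryPoly :=
  C (c 0) * X 0 ^ 2 + C (c 1) * X 1 ^ 2 + C (c 2) * X 2 ^ 2 + C (c 3) * (X 0 * X 1) +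
    C (c 4) * (X 0 * X 2) + C (c 5) * (X 1 * X 2)

/-- The polar line of `p` with respect to a quadratic form. -/
noncomputable def polarForm (c : Fin 6 → ℂ) (p : Fin 3 → ℂ) : TernaryPoly :=
  linForm ![2 * c 0 * p 0 + c 3 * p 1 + c 4 * p 2, 2 * c 1 * p 1 + c 3 * p 0 + c 5 * p 2,
    2 * c 2 * p 2 + c 4 * p 0 + c 5 * p 1]

lemma isHomogeneous_quadForm (c : Fin 6 → ℂ) : (quadForm c).IsHomogeneous 2 := by
  have h (i j : Fin 3) (a : ℂ) : (C a * (X i * X j) : TernaryPoly).IsHomogeneous 2 :=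
    ((isHomogeneous_X ℂ i).mul (isHomogeneous_X ℂ j)).C_mul a
  simp only [quadForm, pow_two]
  exact (((((h _ _ _).add (h _ _ _)).add (h _ _ _)).add (h _ _ _)).add (h _ _ _)).add (h _ _ _)

lemma eval_quadForm (c : Fin 6 → ℂ) (x : Fin 3 → ℂ) :
    eval x (quadForm c) = c 0 * x 0 ^ 2 + c 1 * x 1 ^ 2 + c 2 * x 2 ^ 2 + c 3 * (x 0 * x 1) +
      c 4 * (x 0 * x 2) + c 5 * (x 1 * x 2) := by
  simp [quadForm]

lemma eval_polarForm (c : Fin 6 → ℂ) (p x : Fin 3 → ℂ) :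
    eval x (polarForm c p) = (2 * c 0 * p 0 + c 3 * p 1 + c 4 * p 2) * x 0 +
      (2 * c 1 * p 1 + c 3 * p 0 + c 5 * p 2) * x 1 +
      (2 * c 2 * p 2 + c 4 * p 0 + c 5 * p 1) * x 2 := by
  simp [polarForm, eval_linForm]

lemma eval_polarForm_self (c : Fin 6 → ℂ) (p : Fin 3 → ℂ) :
    eval p (polarForm c p) = 2 * eval p (quadForm c) := by
  rw [eval_polarForm, eval_quadForm]
  ring

lemma eval_add_smul_quadForm (c : Fin 6 → ℂ) (x p : Fin 3 → ℂ) (a : ℂ) :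
    eval (x + a • p) (quadForm c) =
      eval x (quadForm c) + a * eval x (polarForm c p) + a ^ 2 * eval p (quadForm c) := by
  simp only [eval_polarForm, eval_quadForm, Pi.add_apply, Pi.smul_apply, smul_eq_mul]
  ring

lemma quadForm_ne_zero {c : Fin 6 → ℂ} (hc : c ≠ 0) : quadForm c ≠ 0 := by
  intro h
  apply hc
  have key := fun x => eval_quadForm c x
  simp only [h, map_zero] at key
  have h0 := key ![1, 0, 0]
  have h1 := key ![0, 1, 0]
  have h2 := key ![0, 0, 1]
  have h3 := key ![1, 1, 0]
  have h4 := key ![1, 0, 1]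
  have h5 := key ![0, 1, 1]
  simp only [Matrix.cons_val] at h0 h1 h2 h3 h4 h5
  ext i
  fin_cases i <;> simp only [Pi.zero_apply, Fin.reduceFinMk, Fin.zero_eta, Fin.mk_one]
  · linear_combination -h0
  · linear_combination -h1
  · linear_combination -h2
  · linear_combination h0 + h1 - h3
  · linear_combination h0 + h2 - h4
  · linear_combination h1 + h2 - h5

/-- A conic without line components, through at least two points. -/
structure IsSmoothConic (Q : TernaryPoly) : Prop where
  exists_eq : ∃ c, Q = quadForm c
  not_dvd : ∀ L, IsLine L → ¬ L ∣ Q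
  exists_on : ∃ p q, p ≠ q ∧ On Q p ∧ On Q q

lemma IsSmoothConic.isHomogeneous {Q : TernaryPoly} (hQ : IsSmoothConic Q) :
    Q.IsHomogeneous 2 := by
  obtain ⟨c, rfl⟩ := hQ.exists_eq
  exact isHomogeneous_quadForm c

lemma IsSmoothConic.ne_zero {Q : TernaryPoly} (hQ : IsSmoothConic Q) : Q ≠ 0 := by
  rintro rfl
  obtain ⟨p, q, hpq, -⟩ := hQ.exists_on
  obtain ⟨L, hL, -⟩ := exists_isLine_on hpq
  exact hQ.not_dvd L hL (dvd_zero L)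

lemma eval_polarForm_ne_zero {c : Fin 6 → ℂ} (hQ : IsSmoothConic (quadForm c))
    {u v : Fin 3 → ℂ} (h : LinearIndependent ℂ ![u, v]) (hu : eval u (quadForm c) = 0)
    (hv : eval v (quadForm c) = 0) : eval u (polarForm c v) ≠ 0 := by
  classical
  intro huv
  obtain ⟨L, hL, hLu, hLv⟩ := exists_isLine_eval_eq_zero h
  have hli := LinearIndependent.pair_iff.1 h
  have hu0 : u ≠ 0 := by
    rintro rfl
    simpa using hli 1 0 (by simp)
  have hv0 : v ≠ 0 := by
    rintro rfl
    simpa using hli 0 1 (by simp)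
  have hw0 : u + v ≠ 0 := fun h0 => by simpa using hli 1 1 (by simpa using h0)
  have hw : eval (u + v) (quadForm c) = 0 := by
    have := eval_add_smul_quadForm c u v 1
    rw [one_smul, hu, hv, huv] at this
    simpa using this
  have h1 : Projectivization.mk ℂ u hu0 ≠ Projectivization.mk ℂ v hv0 := by
    rw [Ne, Projectivization.mk_eq_mk_iff']
    rintro ⟨a, rfl⟩
    simpa using hli 1 (-a) (by simp)
  have h2 : Projectivization.mk ℂ u hu0 ≠ Projectivization.mk ℂ (u + v) hw0 := by
    rw [Ne, Projectivization.mk_eq_mk_iff']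
    rintro ⟨a, ha⟩
    obtain ⟨e1, e2⟩ := hli (a - 1) a (by linear_combination (norm := module) ha)
    simp [e2] at e1
  have h3 : Projectivization.mk ℂ v hv0 ≠ Projectivization.mk ℂ (u + v) hw0 := by
    rw [Ne, Projectivization.mk_eq_mk_iff']
    rintro ⟨a, ha⟩
    obtain ⟨e1, e2⟩ := hli a (a - 1) (by linear_combination (norm := module) ha)
    simp [e1] at e2
  have hQh := isHomogeneous_quadForm c
  have hLw : eval (u + v) L = 0 := by rw [hL.eval_add, hLu, hLv, add_zero]
  have := hL.sum_ordAt_le {Projectivization.mk ℂ u hu0, Projectivization.mk ℂ v hv0,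
    Projectivization.mk ℂ (u + v) hw0} (by
      simp only [Finset.mem_insert, Finset.mem_singleton, forall_eq_or_imp, forall_eq]
      exact ⟨on_mk hL.2 _ hLu, on_mk hL.2 _ hLv, on_mk hL.2 _ hLw⟩) hQh (hQ.not_dvd L hL)
  rw [Finset.sum_insert (by simp [h1, h2]), Finset.sum_insert (by simp [h3]),
    Finset.sum_singleton] at this
  have a1 := (on_mk hQh hu0 hu).one_le_ordAt hQ.ne_zero
  have a2 := (on_mk hQh hv0 hv).one_le_ordAt hQ.ne_zero
  have a3 := (on_mk hQh hw0 hw).one_le_ordAt hQ.ne_zero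
  lia

lemma exists_linForm_eq_zero_notMem_span (c p : Fin 3 → ℂ) :
    ∃ x, eval x (linForm c) = 0 ∧ x ∉ Submodule.span ℂ {p} := by
  by_contra! h
  let f : (Fin 3 → ℂ) →ₗ[ℂ] ℂ := c 0 • LinearMap.proj 0 + c 1 • LinearMap.proj 1 +
    c 2 • LinearMap.proj 2
  have hle : LinearMap.ker f ≤ Submodule.span ℂ {p} := fun x hx => h x (by
    rw [eval_linForm]
    simpa [f] using hx)
  have h1 := (Submodule.finrank_mono hle).trans (finrank_span_le_card ({p} : Set (Fin 3 → ℂ)))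
  have h2 := LinearMap.finrank_range_add_finrank_ker f
  have h3 := (LinearMap.range f).finrank_le
  rw [Module.finrank_fin_fun] at h2
  rw [Module.finrank_self] at h3
  simp at h1
  lia

/-- The order of vanishing along a smooth conic not contained in a curve is at most twice the
degree. -/
lemma IsSmoothConic.sum_ordAt_le {Q : TernaryPoly} (hQ : IsSmoothConic Q) (S : Finset Plane)
    (hS : ∀ p ∈ S, On Q p) {d : ℕ} {F : TernaryPoly} (hF : F.IsHomogeneous d)
    (hQF : ¬ Q ∣ F) : ∑ p ∈ S, ordAt p.rep F ≤ d * 2 := by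
  obtain ⟨P, P', hPP', hP, hP'⟩ := hQ.exists_on
  have hQ0 := hQ.ne_zero
  have hQh := hQ.isHomogeneous
  obtain ⟨c, rfl⟩ := hQ.exists_eq
  set l := polarForm c P.rep with hl
  have hlh : l.IsHomogeneous 1 := isHomogeneous_linForm _
  have hlP : ∀ q, P ≠ q → On (quadForm c) q → eval q.rep l ≠ 0 := fun q hq hqQ =>
    eval_polarForm_ne_zero hQ (linearIndependent_rep hq.symm) hqQ hP
  have hline : IsLine l := ⟨fun h => hlP P' hPP' hP' (by simp [h]), hlh⟩
  have hlself : eval P.rep l = 0 := by rw [hl, eval_polarForm_self, hP, mul_zero]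
  let Φ : Fin 3 → TernaryPoly := fun i => l * X i - quadForm c * C (P.rep i)
  refine sum_ordAt_le_of_parametrization two_pos P.rep_nonzero Φ (fun i => ?_) (fun x a i => ?_) S
    (fun p hp => ?_) hF (fun h0 => hQF ?_)
  · exact (hlh.mul (isHomogeneous_X ℂ i)).sub (by simpa using hQh.mul (isHomogeneous_C _ (P.rep i)))
  · have hP0 : eval P.rep (quadForm c) = 0 := hP
    simp only [Φ, map_sub, map_mul, eval_X, eval_C, hline.eval_add, hline.eval_smul, hlself,
      eval_add_smul_quadForm, hP0, ← hl, Pi.add_apply, Pi.smul_apply, smul_eq_mul]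
    ring
  · by_cases hpP : P = p
    · subst hpP
      obtain ⟨x, hx, hxs⟩ := exists_linForm_eq_zero_notMem_span
        ![2 * c 0 * P.rep 0 + c 3 * P.rep 1 + c 4 * P.rep 2,
          2 * c 1 * P.rep 1 + c 3 * P.rep 0 + c 5 * P.rep 2,
          2 * c 2 * P.rep 2 + c 4 * P.rep 0 + c 5 * P.rep 1] P.rep
      change eval x l = 0 at hx
      have hli : LinearIndependent ℂ ![x, P.rep] := by
        refine linearIndependent_finCons.2 ⟨?_, ?_⟩
        · simpa [linearIndependent_unique_iff] using P.rep_nonzero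
        · simpa using hxs
      refine ⟨x, -eval x (quadForm c), hxs, neg_ne_zero.2 fun h => ?_, fun i => by simp [Φ, hx]⟩
      exact eval_polarForm_ne_zero hQ hli h hP hx
    · have hpQ : eval p.rep (quadForm c) = 0 := hS p hp
      refine ⟨p.rep, eval p.rep l, fun hmem => ?_, hlP p hpP hpQ, fun i => by simp [Φ, hpQ]⟩
      obtain ⟨a, ha⟩ := Submodule.mem_span_singleton.1 hmem
      exact hpP (eq_of_smul_rep_eq (a := a) (b := 1) (by
        rintro rfl
        exact p.rep_nonzero (by simpa using ha.symm)) (by simpa using ha))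
  · have h1 : quadForm c ∣ aeval Φ F - aeval (fun i => l * X i) F :=
      dvd_aeval_sub_aeval (fun i => ⟨- C (P.rep i), by simp [Φ]⟩) F
    rw [h0, zero_sub, dvd_neg, aeval_mul_of_isHomogeneous hF, aeval_X_left_apply] at h1
    have hrel : IsRelPrime l (quadForm c) :=
      hline.prime.irreducible.isRelPrime_iff_not_dvd.2 (hQ.not_dvd l hline)
    exact hrel.symm.pow_right.dvd_of_dvd_mul_left h1

lemma ordAt_eq_zero_of_not_on {G : TernaryPoly} {p : Plane} (h : ¬ On G p) : ordAt p.rep G = 0 :=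
  ordAt_eq_zero h

/-- The order of vanishing is at most the degree. -/
lemma ordAt_rep_le {F : TernaryPoly} {d : ℕ} (hF0 : F ≠ 0) (hF : F.IsHomogeneous d) (p : Plane) :
    ordAt p.rep F ≤ d := by
  obtain ⟨x, hx⟩ := exists_eval_ne_zero hF0
  by_cases hpx : LinearIndependent ℂ ![p.rep, x]
  · obtain ⟨L, hL, hLp, hLx⟩ := exists_isLine_eval_eq_zero hpx
    have := hL.sum_ordAt_le {p} (by simpa using hLp) hF (by
      rintro ⟨K, rfl⟩
      simp [hLx] at hx)
    simpa using this
  · rw [ordAt_eq_zero]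
    · exact Nat.zero_le d
    · rw [LinearIndependent.pair_iff' p.rep_nonzero] at hpx
      push Not at hpx
      obtain ⟨a, rfl⟩ := hpx
      rw [eval_smul_of_isHomogeneous hF] at hx
      exact right_ne_zero_of_mul hx

/-- The total order of vanishing of `F` at a list of points. -/
noncomputable def weight (l : List Plane) (F : TernaryPoly) : ℕ :=
  (l.map fun p => ordAt p.rep F).sum

lemma weight_mul (l : List Plane) {F G : TernaryPoly} (hF : F ≠ 0) (hG : G ≠ 0) :
    weight l (F * G) = weight l F + weight l G := by
  simp [weight, ordAt_mul _ hF hG, List.sum_map_add]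

lemma weight_eq_sum [DecidableEq Plane] {l : List Plane} (hl : l.Nodup) (F : TernaryPoly) :
    weight l F = ∑ p ∈ l.toFinset, ordAt p.rep F :=
  (List.sum_toFinset _ hl).symm

/-- A plane curve of degree `e` without multiple points which satisfies Bézout's inequality. -/
structure IsCurve (G : TernaryPoly) (e : ℕ) : Prop where
  pos : 0 < e
  ne_zero : G ≠ 0
  isHomogeneous : G.IsHomogeneous e
  ordAt_le_one : ∀ p : Plane, ordAt p.rep G ≤ 1
  weight_le : ∀ {l : List Plane}, l.Nodup → (∀ p ∈ l, On G p) → ∀ {F : TernaryPoly} {d : ℕ},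
    F.IsHomogeneous d → ¬ G ∣ F → weight l F ≤ e * d

lemma IsLine.isCurve {L : TernaryPoly} (hL : IsLine L) : IsCurve L 1 where
  pos := one_pos
  ne_zero := hL.1
  isHomogeneous := hL.2
  ordAt_le_one := ordAt_rep_le hL.1 hL.2
  weight_le hl h F d hF hLF := by
    classical
    rw [weight_eq_sum hl, one_mul]
    exact hL.sum_ordAt_le _ (fun p hp => h p (List.mem_toFinset.1 hp)) hF hLF

lemma IsSmoothConic.isCurve {Q : TernaryPoly} (hQ : IsSmoothConic Q) : IsCurve Q 2 where
  pos := two_pos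
  ne_zero := hQ.ne_zero
  isHomogeneous := hQ.isHomogeneous
  ordAt_le_one p := by
    classical
    by_cases hp : On Q p
    · obtain ⟨q, hpq, hq⟩ : ∃ q, p ≠ q ∧ On Q q := by
        obtain ⟨a, b, hab, ha, hb⟩ := hQ.exists_on
        by_cases h : p = a
        · exact ⟨b, h ▸ hab, hb⟩
        · exact ⟨a, h, ha⟩
      obtain ⟨L, hL, hLp, hLq⟩ := exists_isLine_on hpq
      have := hL.sum_ordAt_le {p, q} (by simpa using ⟨hLp, hLq⟩) hQ.isHomogeneous
        (hQ.not_dvd L hL)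
      rw [Finset.sum_pair hpq] at this
      have := hq.one_le_ordAt hQ.ne_zero
      lia
    · rw [ordAt_eq_zero_of_not_on hp]
      exact Nat.zero_le 1
  weight_le hl h F d hF hLF := by
    classical
    rw [weight_eq_sum hl, mul_comm]
    exact hQ.sum_ordAt_le _ (fun p hp => h p (List.mem_toFinset.1 hp)) hF hLF

open Classical in
/-- The number of entries of a list of points which lie on a curve. -/
noncomputable def countOn (G : TernaryPoly) (l : List Plane) : ℕ := l.countP fun p => On G p

@[simp] lemma countOn_nil (G : TernaryPoly) : countOn G [] = 0 := by simp [countOn]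

open Classical in
lemma countOn_cons (G : TernaryPoly) (p : Plane) (l : List Plane) :
    countOn G (p :: l) = countOn G l + if On G p then 1 else 0 := by
  simp [countOn, List.countP_cons]

lemma countOn_cons_of_on {G : TernaryPoly} {p : Plane} (h : On G p) (l : List Plane) :
    countOn G (p :: l) = countOn G l + 1 := by
  simp [countOn_cons, h]

lemma countOn_cons_of_not_on {G : TernaryPoly} {p : Plane} (h : ¬ On G p) (l : List Plane) :
    countOn G (p :: l) = countOn G l := by
  simp [countOn_cons, h]

lemma countOn_le_length (G : TernaryPoly) (l : List Plane) : countOn G l ≤ l.length :=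
  List.countP_le_length

lemma countOn_eq_length {G : TernaryPoly} {l : List Plane} (h : ∀ p ∈ l, On G p) :
    countOn G l = l.length := by
  classical
  exact List.countP_eq_length.2 (by simpa using h)

lemma countOn_eq_zero {G : TernaryPoly} {l : List Plane} (h : ∀ p ∈ l, ¬ On G p) :
    countOn G l = 0 := by
  classical
  exact List.countP_eq_zero.2 (by simpa using h)

lemma IsCurve.weight_eq_countOn {G : TernaryPoly} {e : ℕ} (hG : IsCurve G e) (l : List Plane) :
    weight l G = countOn G l := by
  induction l with
  | nil => simp [weight]
  | cons p l ih =>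
    have hcons : weight (p :: l) G = ordAt p.rep G + weight l G := by simp [weight]
    rw [hcons, ih]
    by_cases hp : On G p
    · rw [countOn_cons_of_on hp]
      have := hp.one_le_ordAt hG.ne_zero
      have := hG.ordAt_le_one p
      lia
    · rw [countOn_cons_of_not_on hp, ordAt_eq_zero_of_not_on hp, zero_add]

/-- A set of points for which `5/2` is not a lower bound of the Waldschmidt constant. -/
def IsSmall (Z : Set Plane) : Prop :=
  ∃ (F : TernaryPoly) (d m : ℕ), F ≠ 0 ∧ F.IsHomogeneous d ∧ 2 * d < 5 * m ∧
    ∀ p ∈ Z, m ≤ ordAt p.rep F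

/-- A nef divisor on the blowup, given as a sum of curves and points on them, bounds the
Waldschmidt constant from below. -/
lemma IsSmall.false_of_nef {Z : Set Plane} (hZ : IsSmall Z)
    (D : List (TernaryPoly × ℕ × List Plane))
    (hD : ∀ x ∈ D, IsCurve x.1 x.2.1 ∧ x.2.2.Nodup ∧ ∀ p ∈ x.2.2, On x.1 p ∧ p ∈ Z)
    (hnef : ∀ x ∈ D, (D.map fun y => countOn x.1 y.2.2).sum ≤ (D.map fun y => y.2.1).sum * x.2.1)
    (hlen : 5 * (D.map fun y => y.2.1).sum ≤ 2 * (D.map fun y => y.2.2.length).sum)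
    (hne : D ≠ []) : False := by
  set E := (D.map fun y => y.2.1).sum with hE
  have key : ∀ (d : ℕ) (F : TernaryPoly), F ≠ 0 → F.IsHomogeneous d →
      (D.map fun y => weight y.2.2 F).sum ≤ E * d := by
    intro d
    induction d using Nat.strong_induction_on with
    | _ d ih =>
      intro F hF0 hF
      by_cases hdvd : ∃ x ∈ D, x.1 ∣ F
      · obtain ⟨x, hx, K, rfl⟩ := hdvd
        obtain ⟨hle, hK⟩ := isHomogeneous_of_mul_left (hD x hx).1.isHomogeneous hF hF0
        have hpos := (hD x hx).1.pos
        have h1 := ih (d - x.2.1) (by lia) K (right_ne_zero_of_mul hF0) hK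
        have h2 := hnef x hx
        simp only [weight_mul _ (left_ne_zero_of_mul hF0) (right_ne_zero_of_mul hF0),
          List.sum_map_add, (hD x hx).1.weight_eq_countOn]
        calc _ ≤ E * x.2.1 + E * (d - x.2.1) := add_le_add h2 h1
          _ = E * d := by rw [← mul_add, Nat.add_sub_cancel' hle]
      · push Not at hdvd
        rw [hE, ← List.sum_map_mul_right]
        exact List.sum_le_sum fun x hx => (hD x hx).1.weight_le (hD x hx).2.1
          (fun p hp => ((hD x hx).2.2 p hp).1) hF (hdvd x hx)
  obtain ⟨F, d, m, hF0, hF, hdm, hm⟩ := hZ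
  have hlow : (D.map fun y => y.2.2.length).sum * m ≤ (D.map fun y => weight y.2.2 F).sum := by
    rw [← List.sum_map_mul_right]
    refine List.sum_le_sum fun x hx => ?_
    have := List.card_nsmul_le_sum (x.2.2.map fun p => ordAt p.rep F) m (by
      simpa using fun p hp => hm p ((hD x hx).2.2 p hp).2)
    simpa [weight] using this
  have hEpos : 0 < E := by
    obtain ⟨x, hx⟩ := List.exists_mem_of_ne_nil D hne
    exact (hD x hx).1.pos.trans_le (List.single_le_sum (by simp) _ (List.mem_map_of_mem hx))
  have := key d F hF0 hF
  nlinarith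

lemma isSmall_of_waldschmidt_lt {Z : Set Plane} (hfin : Z.Finite) (h : waldschmidt Z < 5 / 2) :
    IsSmall Z := by
  obtain ⟨m, hm⟩ := exists_lt_of_ciInf_lt h
  have hline : ∀ p : Plane, ∃ L, IsLine L ∧ On L p := fun p => by
    obtain ⟨x, -, hx⟩ := exists_linForm_eq_zero_notMem_span 0 p.rep
    obtain ⟨L, hL, hLp, -⟩ := exists_isLine_eval_eq_zero (u := p.rep) (v := x) (by
      rw [LinearIndependent.pair_iff' p.rep_nonzero]
      exact fun a ha => hx (Submodule.mem_span_singleton.2 ⟨a, ha⟩))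
    exact ⟨L, hL, hLp⟩
  choose L hL hLp using hline
  have hne : {t | ∃ F ∈ symbolicPower Z (m : ℕ), F ≠ 0 ∧ F.IsHomogeneous t}.Nonempty := by
    refine ⟨_, ∏ p ∈ hfin.toFinset, L p ^ (m : ℕ), fun p hp v hv hvp => ?_,
      Finset.prod_ne_zero_iff.2 fun p _ => pow_ne_zero _ (hL p).1,
      IsHomogeneous.prod _ _ (fun _ => 1 * (m : ℕ)) fun p _ => (hL p).2.pow _⟩
    exact vanishesToOrder_of_pow_dvd ((memLine_iff_on (hL p).2 p).2 (hLp p) v hv hvp)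
      (Finset.dvd_prod_of_mem (fun p => L p ^ (m : ℕ)) (hfin.mem_toFinset.2 hp))
  obtain ⟨F, hF, hF0, hFh⟩ := Nat.sInf_mem hne
  refine ⟨F, _, m, hF0, hFh, ?_, fun p hp =>
    le_ordAt hF0 (X_pow_dvd_taylorAt (hF p hp p.rep p.rep_nonzero p.mk_rep))⟩
  rw [div_lt_div_iff₀ (by exact_mod_cast m.pos) two_pos] at hm
  have h2 : ((initialDegree (symbolicPower Z m) * 2 : ℕ) : ℝ) < ((5 * (m : ℕ) : ℕ) : ℝ) := by
    push_cast
    exact hm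
  have h3 := Nat.cast_lt.1 h2
  change 2 * initialDegree (symbolicPower Z m) < 5 * (m : ℕ)
  lia

lemma on_of_dvd_of_isHomogeneous {G H : TernaryPoly} {e : ℕ} (hG : G.IsHomogeneous e)
    (hH : H.IsHomogeneous e) (hH0 : H ≠ 0) (h : G ∣ H) {p : Plane} (hp : On H p) : On G p := by
  obtain ⟨K, rfl⟩ := h
  have hK := (isHomogeneous_of_mul_left hG hH hH0).2
  rw [Nat.sub_self, ← totalDegree_zero_iff_isHomogeneous, totalDegree_eq_zero_iff_eq_C] at hK
  have hc : coeff 0 K ≠ 0 := by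
    intro h0
    rw [h0, map_zero] at hK
    simp [hK] at hH0
  rw [On, hK, map_mul, eval_C] at hp
  exact (mul_eq_zero.1 hp).resolve_right hc

/-- Bézout's inequality for two curves of the same degree. -/
lemma IsCurve.countOn_le_of_eq {G H : TernaryPoly} {e : ℕ} (hG : IsCurve G e) (hH : IsCurve H e)
    {l : List Plane} (hl : l.Nodup) (h : ∀ p ∈ l, On G p) {q : Plane} (hq : On H q)
    (hq' : ¬ On G q) : countOn H l ≤ e * e := by
  rw [← hH.weight_eq_countOn]
  exact hG.weight_le hl h hH.isHomogeneous fun hd =>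
    hq' (on_of_dvd_of_isHomogeneous hG.isHomogeneous hH.isHomogeneous hH.ne_zero hd hq)

lemma IsLine.countOn_le_one {L M : TernaryPoly} (hL : IsLine L) (hM : IsLine M)
    {l : List Plane} (hl : l.Nodup) (h : ∀ p ∈ l, On L p) {q : Plane} (hq : On M q)
    (hq' : ¬ On L q) : countOn M l ≤ 1 :=
  hL.isCurve.countOn_le_of_eq hM.isCurve hl h hq hq'

/-- Two distinct points determine a line. -/
lemma IsLine.on_of_two {L M : TernaryPoly} (hL : IsLine L) (hM : IsLine M) {p q : Plane}
    (hpq : p ≠ q) (hLp : On L p) (hLq : On L q) (hMp : On M p) (hMq : On M q) {r : Plane}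
    (hr : On M r) : On L r := by
  by_contra h
  have := hL.countOn_le_one hM (l := [p, q]) (by simpa using hpq) (by simp [hLp, hLq]) hr h
  rw [countOn_eq_length (by simp [hMp, hMq])] at this
  simp at this

lemma IsSmoothConic.countOn_line_le {Q N : TernaryPoly} (hQ : IsSmoothConic Q) (hN : IsLine N)
    {l : List Plane} (hl : l.Nodup) (h : ∀ p ∈ l, On Q p) : countOn N l ≤ 2 := by
  rw [← hN.isCurve.weight_eq_countOn]
  refine hQ.isCurve.weight_le hl h hN.2 ?_
  rintro ⟨K, rfl⟩
  have := (isHomogeneous_of_mul_left hQ.isHomogeneous hN.2 hN.1).1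
  lia

lemma IsSmoothConic.false_of_three {Q N : TernaryPoly} (hQ : IsSmoothConic Q) (hN : IsLine N)
    {p q r : Plane} (hpq : p ≠ q) (hpr : p ≠ r) (hqr : q ≠ r) (hp : On N p) (hq : On N q)
    (hr : On N r) (hQp : On Q p) (hQq : On Q q) (hQr : On Q r) : False := by
  have := hQ.countOn_line_le hN (l := [p, q, r]) (by simp [hpq, hpr, hqr]) (by simp [hQp, hQq, hQr])
  rw [countOn_eq_length (by simp [hp, hq, hr])] at this
  simp at this

/-- Five points, no three of them collinear, lie on a smooth conic. -/
lemma exists_isSmoothConic {l : List Plane} (hl : l.Nodup) (hlen : l.length = 5)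
    (h : ∀ N, IsLine N → countOn N l ≤ 2) : ∃ Q, IsSmoothConic Q ∧ ∀ p ∈ l, On Q p := by
  let f : (Fin 6 → ℂ) →ₗ[ℂ] (Fin l.length → ℂ) :=
    { toFun := fun c j => eval (l.get j).rep (quadForm c)
      map_add' := fun c c' => by
        ext j
        simp only [eval_quadForm, Pi.add_apply]
        ring
      map_smul' := fun a c => by
        ext j
        simp only [eval_quadForm, Pi.smul_apply, smul_eq_mul, RingHom.id_apply]
        ring }
  obtain ⟨c, hc, hc0⟩ := (Submodule.ne_bot_iff _).1
    (LinearMap.ker_ne_bot_of_finrank_lt (f := f) (by simp [hlen]))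
  have hon : ∀ p ∈ l, On (quadForm c) p := fun p hp => by
    obtain ⟨j, rfl⟩ := List.mem_iff_get.1 hp
    exact congrFun (LinearMap.mem_ker.1 hc) j
  refine ⟨quadForm c, ⟨⟨c, rfl⟩, ?_, l.get ⟨0, by lia⟩, l.get ⟨1, by lia⟩, ?_,
    hon _ (List.get_mem _ _), hon _ (List.get_mem _ _)⟩, hon⟩
  · rintro N hN ⟨K, hK⟩
    have hQ0 := quadForm_ne_zero hc0
    have hQh := isHomogeneous_quadForm c
    rw [hK] at hQ0 hQh
    have hKline : IsLine K := ⟨right_ne_zero_of_mul hQ0, (isHomogeneous_of_mul_left hN.2 hQh hQ0).2⟩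
    have h1 := h N hN
    have h2 := h K hKline
    have h3 : l.length ≤ countOn N l + countOn K l := by
      have hor : ∀ p ∈ l, On N p ∨ On K p := fun p hp => by
        have := hon p hp
        rwa [On, hK, map_mul, mul_eq_zero] at this
      clear * - hor
      induction l with
      | nil => simp
      | cons p l ih =>
        have := ih fun q hq => hor q (List.mem_cons_of_mem _ hq)
        have := hor p List.mem_cons_self
        classical
        rw [countOn_cons, countOn_cons, List.length_cons]
        split_ifs <;> simp_all <;> lia
    lia
  · intro h01
    simpa using (List.Nodup.get_inj_iff hl).1 h01

lemma IsSmall.false_of_two_conics {Z : Set Plane} (hZ : IsSmall Z)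
    {Q₁ Q₂ : TernaryPoly} (h₁ : IsSmoothConic Q₁)
    (h₂ : IsSmoothConic Q₂) {T₁ T₂ : List Plane} (hn₁ : T₁.Nodup) (hn₂ : T₂.Nodup)
    (hl₁ : T₁.length = 5) (hl₂ : T₂.length = 5) (ho₁ : ∀ p ∈ T₁, On Q₁ p)
    (ho₂ : ∀ p ∈ T₂, On Q₂ p) (hT₁ : ∀ p ∈ T₁, p ∈ Z) (hT₂ : ∀ p ∈ T₂, p ∈ Z)
    (h₁₂ : countOn Q₁ T₂ ≤ 3) (h₂₁ : countOn Q₂ T₁ ≤ 3) : False := by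
  have := countOn_le_length Q₁ T₁
  have := countOn_le_length Q₂ T₂
  refine hZ.false_of_nef [(Q₁, 2, T₁), (Q₂, 2, T₂)] ?_ ?_ ?_ ?_
  · simp only [List.mem_cons, List.not_mem_nil, or_false, forall_eq_or_imp, forall_eq]
    exact ⟨⟨h₁.isCurve, hn₁, fun p hp => ⟨ho₁ p hp, hT₁ p hp⟩⟩,
      h₂.isCurve, hn₂, fun p hp => ⟨ho₂ p hp, hT₂ p hp⟩⟩
  · simp
    lia
  · simp
    lia
  · simp

lemma IsSmall.false_of_line_four {Z : Set Plane} (hZ : IsSmall Z)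
    {L N₁ N₂ : TernaryPoly} (hL : IsLine L) (h₁ : IsLine N₁)
    (h₂ : IsLine N₂) {T : List Plane} (hn : T.Nodup) (hl : T.length = 4) (ho : ∀ p ∈ T, On L p)
    (hT : ∀ p ∈ T, p ∈ Z) {a b c d : Plane} (ha : a ∈ Z) (hb : b ∈ Z) (hc : c ∈ Z) (hd : d ∈ Z)
    (hab : a ≠ b) (hcd : c ≠ d) (hLa : ¬ On L a) (hLb : ¬ On L b) (hLc : ¬ On L c)
    (hLd : ¬ On L d) (h₁a : On N₁ a) (h₁b : On N₁ b) (h₁c : ¬ On N₁ c) (h₁d : ¬ On N₁ d)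
    (h₂a : ¬ On N₂ a) (h₂b : ¬ On N₂ b) (h₂c : On N₂ c) (h₂d : On N₂ d) : False := by
  have := countOn_le_length L T
  have := hL.countOn_le_one h₁ hn ho h₁a hLa
  have := hL.countOn_le_one h₂ hn ho h₂c hLc
  refine hZ.false_of_nef [(L, 1, T), (L, 1, T), (N₁, 1, [a, b]), (N₁, 1, [a, b]),
    (N₁, 1, [a, b]), (N₂, 1, [c, d]), (N₂, 1, [c, d]), (N₂, 1, [c, d])] ?_ ?_ ?_ ?_
  · simp only [List.mem_cons, List.not_mem_nil, or_false, forall_eq_or_imp, forall_eq]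
    simp [hL.isCurve, h₁.isCurve, h₂.isCurve, *]
    exact fun p hp => ⟨ho p hp, hT p hp⟩
  · simp [countOn_cons, *]
    lia
  · simp
    lia
  · simp

lemma IsSmall.false_of_two_triples {Z : Set Plane} (hZ : IsSmall Z)
    {M M' N : TernaryPoly} (hM : IsLine M) (hM' : IsLine M')
    (hN : IsLine N) {T T' : List Plane} (hn : T.Nodup) (hn' : T'.Nodup) (hl : T.length = 3)
    (hl' : T'.length = 3) (ho : ∀ p ∈ T, On M p) (ho' : ∀ p ∈ T', On M' p)
    (hT : ∀ p ∈ T, p ∈ Z) (hT' : ∀ p ∈ T', p ∈ Z) (hMT' : countOn M T' ≤ 1)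
    (hM'T : countOn M' T ≤ 1) {e f : Plane} (he : e ∈ Z) (hf : f ∈ Z) (hef : e ≠ f)
    (hNe : On N e) (hNf : On N f) (hMe : ¬ On M e) (hMf : ¬ On M f) (hM'e : ¬ On M' e)
    (hM'f : ¬ On M' f) (hNT : ∀ p ∈ T, ¬ On N p) (hNT' : ∀ p ∈ T', ¬ On N p) : False := by
  have := countOn_le_length M T
  have := countOn_le_length M' T'
  have := countOn_eq_zero hNT
  have := countOn_eq_zero hNT'
  refine hZ.false_of_nef [(M, 1, T), (M', 1, T'), (N, 1, [e, f]), (N, 1, [e, f])] ?_ ?_ ?_ ?_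
  · simp only [List.mem_cons, List.not_mem_nil, or_false, forall_eq_or_imp, forall_eq]
    exact ⟨⟨hM.isCurve, hn, fun p hp => ⟨ho p hp, hT p hp⟩⟩,
      ⟨hM'.isCurve, hn', fun p hp => ⟨ho' p hp, hT' p hp⟩⟩, by simp [hN.isCurve, *],
      by simp [hN.isCurve, *]⟩
  · simp [countOn_cons, *]
    lia
  · simp
    lia
  · simp

lemma IsSmall.false_of_two_triples_two_pairs {Z : Set Plane} (hZ : IsSmall Z)
    {M M' N₁ N₂ : TernaryPoly} (hM : IsLine M)
    (hM' : IsLine M') (h₁ : IsLine N₁) (h₂ : IsLine N₂) {T T' : List Plane} (hn : T.Nodup)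
    (hn' : T'.Nodup) (hl : T.length = 3) (hl' : T'.length = 3) (ho : ∀ p ∈ T, On M p)
    (ho' : ∀ p ∈ T', On M' p) (hT : ∀ p ∈ T, p ∈ Z) (hT' : ∀ p ∈ T', p ∈ Z)
    (hMT' : countOn M T' ≤ 1) (hM'T : countOn M' T ≤ 1) {e f g h : Plane} (he : e ∈ Z)
    (hf : f ∈ Z) (hg : g ∈ Z) (hh : h ∈ Z) (hef : e ≠ f) (hgh : g ≠ h)
    (hMe : ¬ On M e) (hMf : ¬ On M f) (hMg : ¬ On M g) (hMh : ¬ On M h)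
    (hM'e : ¬ On M' e) (hM'f : ¬ On M' f) (hM'g : ¬ On M' g) (hM'h : ¬ On M' h)
    (h₁e : On N₁ e) (h₁f : On N₁ f) (h₁g : ¬ On N₁ g) (h₁h : ¬ On N₁ h)
    (h₂e : ¬ On N₂ e) (h₂f : ¬ On N₂ f) (h₂g : On N₂ g) (h₂h : On N₂ h) : False := by
  have := countOn_le_length M T
  have := countOn_le_length M' T'
  have := hM.countOn_le_one h₁ hn ho h₁e hMe
  have := hM.countOn_le_one h₂ hn ho h₂g hMg
  have := hM'.countOn_le_one h₁ hn' ho' h₁e hM'e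
  have := hM'.countOn_le_one h₂ hn' ho' h₂g hM'g
  refine hZ.false_of_nef [(M, 1, T), (M', 1, T'), (N₁, 1, [e, f]), (N₂, 1, [g, h])] ?_ ?_ ?_ ?_
  · simp only [List.mem_cons, List.not_mem_nil, or_false, forall_eq_or_imp, forall_eq]
    exact ⟨⟨hM.isCurve, hn, fun p hp => ⟨ho p hp, hT p hp⟩⟩,
      ⟨hM'.isCurve, hn', fun p hp => ⟨ho' p hp, hT' p hp⟩⟩, by simp [h₁.isCurve, *],
      by simp [h₂.isCurve, *]⟩
  · simp [countOn_cons, *]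
    lia
  · simp
    lia
  · simp

lemma IsSmall.false_of_conic_eight {Z : Set Plane} (hZ : IsSmall Z)
    {Q N : TernaryPoly} (hQ : IsSmoothConic Q) (hN : IsLine N)
    {T : List Plane} (hn : T.Nodup) (hl : T.length = 8) (ho : ∀ p ∈ T, On Q p)
    (hT : ∀ p ∈ T, p ∈ Z) {t : Plane} (ht : t ∈ Z) (hQt : ¬ On Q t) (hNt : On N t) : False := by
  have := countOn_le_length Q T
  have := hQ.countOn_line_le hN hn ho
  refine hZ.false_of_nef [(Q, 2, T), (N, 1, [t]), (N, 1, [t])] ?_ ?_ ?_ ?_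
  · simp only [List.mem_cons, List.not_mem_nil, or_false, forall_eq_or_imp, forall_eq]
    exact ⟨⟨hQ.isCurve, hn, fun p hp => ⟨ho p hp, hT p hp⟩⟩, by simp [hN.isCurve, *],
      by simp [hN.isCurve, *]⟩
  · simp [countOn_cons, *]
    lia
  · simp
    lia
  · simp

lemma IsSmall.false_of_conic_seven {Z : Set Plane} (hZ : IsSmall Z)
    {Q N₁ N₂ N₃ : TernaryPoly} (hQ : IsSmoothConic Q)
    (h₁ : IsLine N₁) (h₂ : IsLine N₂) (h₃ : IsLine N₃) {T : List Plane} (hn : T.Nodup)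
    (hl : T.length = 7) (ho : ∀ p ∈ T, On Q p) (hT : ∀ p ∈ T, p ∈ Z) {t x₁ x₂ x₃ : Plane}
    (ht : t ∈ Z) (hQt : ¬ On Q t) (h₁t : On N₁ t) (h₂t : On N₂ t) (h₃t : On N₃ t)
    (hx₁ : x₁ ∈ T) (hx₂ : x₂ ∈ T) (hx₃ : x₃ ∈ T) (hc₁ : countOn N₁ T ≤ 1)
    (hc₂ : countOn N₂ T ≤ 1) (hc₃ : countOn N₃ T ≤ 1) (h₁₁ : On N₁ x₁) (h₁₂ : ¬ On N₁ x₂)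
    (h₁₃ : ¬ On N₁ x₃) (h₂₁ : ¬ On N₂ x₁) (h₂₂ : On N₂ x₂) (h₂₃ : ¬ On N₂ x₃)
    (h₃₁ : ¬ On N₃ x₁) (h₃₂ : ¬ On N₃ x₂) (h₃₃ : On N₃ x₃) : False := by
  have := countOn_le_length Q T
  have d₁ : t ≠ x₁ := fun h => hQt (h ▸ ho _ hx₁)
  have d₂ : t ≠ x₂ := fun h => hQt (h ▸ ho _ hx₂)
  have d₃ : t ≠ x₃ := fun h => hQt (h ▸ ho _ hx₃)
  have hTx₁ := hT _ hx₁
  have hTx₂ := hT _ hx₂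
  have hTx₃ := hT _ hx₃
  have hox₁ := ho _ hx₁
  have hox₂ := ho _ hx₂
  have hox₃ := ho _ hx₃
  refine hZ.false_of_nef [(Q, 2, T), (N₁, 1, [t, x₁]), (N₂, 1, [t, x₂]), (N₃, 1, [t, x₃])]
    ?_ ?_ ?_ ?_
  · simp only [List.mem_cons, List.not_mem_nil, or_false, forall_eq_or_imp, forall_eq]
    exact ⟨⟨hQ.isCurve, hn, fun p hp => ⟨ho p hp, hT p hp⟩⟩, by simp [h₁.isCurve, *],
      by simp [h₂.isCurve, *], by simp [h₃.isCurve, *]⟩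
  · simp [countOn_cons, *]
    lia
  · simp
    lia
  · simp

lemma IsSmall.false_of_conic_six {Z : Set Plane} (hZ : IsSmall Z)
    {Q Q₁ Q₂ : TernaryPoly} (hQ : IsSmoothConic Q)
    (h₁ : IsSmoothConic Q₁) (h₂ : IsSmoothConic Q₂) {T₁ T₂ : List Plane}
    (hn : (T₁ ++ T₂).Nodup) (hl₁ : T₁.length = 3) (hl₂ : T₂.length = 3)
    (ho : ∀ p ∈ T₁ ++ T₂, On Q p) (hT : ∀ p ∈ T₁ ++ T₂, p ∈ Z) {t u : Plane} (ht : t ∈ Z)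
    (hu : u ∈ Z) (htu : t ≠ u) (hQt : ¬ On Q t) (hQu : ¬ On Q u) (h₁t : On Q₁ t) (h₁u : On Q₁ u)
    (h₂t : On Q₂ t) (h₂u : On Q₂ u) (ho₁ : ∀ p ∈ T₁, On Q₁ p) (ho₂ : ∀ p ∈ T₂, On Q₂ p) :
    False := by
  have happ : ∀ G, countOn G (T₁ ++ T₂) = countOn G T₁ + countOn G T₂ := fun G => by
    classical
    exact List.countP_append
  have a₁ := hQ.isCurve.countOn_le_of_eq h₁.isCurve hn ho h₁t hQt
  have a₂ := hQ.isCurve.countOn_le_of_eq h₂.isCurve hn ho h₂t hQt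
  rw [happ] at a₁ a₂
  have b₁ := countOn_eq_length ho₁
  have b₂ := countOn_eq_length ho₂
  have c := countOn_le_length Q T₁
  have c' := countOn_le_length Q T₂
  have hd : ∀ p ∈ T₁ ++ T₂, t ≠ p ∧ u ≠ p := fun p hp =>
    ⟨fun h => hQt (h ▸ ho p hp), fun h => hQu (h ▸ ho p hp)⟩
  refine hZ.false_of_nef [(Q, 2, T₁ ++ T₂), (Q₁, 2, t :: u :: T₁), (Q₂, 2, t :: u :: T₂)]
    ?_ ?_ ?_ ?_
  · simp only [List.mem_cons, List.not_mem_nil, or_false, forall_eq_or_imp, forall_eq]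
    refine ⟨⟨hQ.isCurve, hn, fun p hp => ⟨ho p hp, hT p hp⟩⟩, ⟨h₁.isCurve, ?_, ⟨h₁t, ht⟩,
      ⟨h₁u, hu⟩, fun p hp => ⟨ho₁ p hp, hT p (List.mem_append_left _ hp)⟩⟩,
      ⟨h₂.isCurve, ?_, ⟨h₂t, ht⟩, ⟨h₂u, hu⟩, fun p hp => ⟨ho₂ p hp,
      hT p (List.mem_append_right _ hp)⟩⟩⟩
    · simp only [List.nodup_cons, List.mem_cons, not_or]
      exact ⟨⟨htu, fun h => (hd t (List.mem_append_left _ h)).1 rfl⟩,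
        fun h => (hd u (List.mem_append_left _ h)).2 rfl, hn.of_append_left⟩
    · simp only [List.nodup_cons, List.mem_cons, not_or]
      exact ⟨⟨htu, fun h => (hd t (List.mem_append_right _ h)).1 rfl⟩,
        fun h => (hd u (List.mem_append_right _ h)).2 rfl, hn.of_append_right⟩
  · simp [countOn_cons, *]
    lia
  · simp
    lia
  · simp

open Classical in
/-- The points of a finite set which lie on a curve. -/
noncomputable def ptsOn (Z : Finset Plane) (G : TernaryPoly) : Finset Plane := {p ∈ Z | On G p}

open Classical in
/-- The points of a finite set which do not lie on a curve. -/
noncomputable def ptsOff (Z : Finset Plane) (G : TernaryPoly) : Finset Plane := {p ∈ Z | ¬ On G p}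

lemma mem_ptsOn {Z : Finset Plane} {G : TernaryPoly} {p : Plane} :
    p ∈ ptsOn Z G ↔ p ∈ Z ∧ On G p := by simp [ptsOn]

lemma mem_ptsOff {Z : Finset Plane} {G : TernaryPoly} {p : Plane} :
    p ∈ ptsOff Z G ↔ p ∈ Z ∧ ¬ On G p := by simp [ptsOff]

lemma card_ptsOn_add_card_ptsOff (Z : Finset Plane) (G : TernaryPoly) :
    (ptsOn Z G).card + (ptsOff Z G).card = Z.card := by
  classical
  exact Finset.card_filter_add_card_filter_not _

lemma card_ptsOn_le_one {S : Finset Plane} {L N : TernaryPoly} (hL : IsLine L) (hN : IsLine N)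
    (hS : ∀ p ∈ S, On L p) {q : Plane} (hq : On N q) (hq' : ¬ On L q) :
    (ptsOn S N).card ≤ 1 := by
  refine Finset.card_le_one.2 fun a ha b hb => ?_
  rw [mem_ptsOn] at ha hb
  by_contra hab
  exact hq' (hL.on_of_two hN hab (hS a ha.1) (hS b hb.1) ha.2 hb.2 hq)

/-- Three points lie on a common line. -/
def OnLine (x y z : Plane) : Prop := ∃ N, IsLine N ∧ On N x ∧ On N y ∧ On N z

lemma exists_four_le {S : Finset Plane} (h : 4 ≤ S.card) : ∃ a b c d, a ∈ S ∧ b ∈ S ∧ c ∈ S ∧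
    d ∈ S ∧ a ≠ b ∧ a ≠ c ∧ a ≠ d ∧ b ≠ c ∧ b ≠ d ∧ c ≠ d := by
  classical
  obtain ⟨a, ha⟩ := Finset.card_pos.1 (by lia : 0 < S.card)
  have h1 := Finset.card_erase_of_mem ha
  obtain ⟨b, hb, c, hc, d, hd, hbc, hbd, hcd⟩ :=
    Finset.two_lt_card.1 (by lia : 2 < (S.erase a).card)
  rw [Finset.mem_erase] at hb hc hd
  exact ⟨a, b, c, d, ha, hb.2, hc.2, hd.2, hb.1.symm, hc.1.symm, hd.1.symm, hbc, hbd, hcd⟩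

lemma exists_conic_of_triangle {L N₁ N₂ N₃ : TernaryPoly} (hL : IsLine L) (h₁ : IsLine N₁)
    (h₂ : IsLine N₂) (h₃ : IsLine N₃) {p a b r s : Plane} (hpa : p ≠ a) (hpb : p ≠ b)
    (hab : a ≠ b) (hrs : r ≠ s) (hLp : ¬ On L p) (hLa : ¬ On L a) (hLb : ¬ On L b)
    (hLr : On L r) (hLs : On L s) (h₁p : On N₁ p) (h₁a : On N₁ a) (h₁b : ¬ On N₁ b)
    (h₂p : On N₂ p) (h₂b : On N₂ b) (h₃a : On N₃ a) (h₃b : On N₃ b)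
    (h₁r : ¬ On N₁ r) (h₁s : ¬ On N₁ s) (h₂r : ¬ On N₂ r) (h₂s : ¬ On N₂ s)
    (h₃r : ¬ On N₃ r) (h₃s : ¬ On N₃ s) :
    [p, a, b, r, s].Nodup ∧ ∃ Q, IsSmoothConic Q ∧ ∀ x ∈ [p, a, b, r, s], On Q x := by
  have hn : [p, a, b, r, s].Nodup := by
    have e1 : p ≠ r := fun h => hLp (h ▸ hLr)
    have e2 : p ≠ s := fun h => hLp (h ▸ hLs)
    have e3 : a ≠ r := fun h => hLa (h ▸ hLr)
    have e4 : a ≠ s := fun h => hLa (h ▸ hLs)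
    have e5 : b ≠ r := fun h => hLb (h ▸ hLr)
    have e6 : b ≠ s := fun h => hLb (h ▸ hLs)
    simp [*]
  refine ⟨hn, exists_isSmoothConic hn rfl fun N hN => ?_⟩
  have u₁ := fun x => h₁.on_of_two hN (r := x) hpa h₁p h₁a
  have u₂ := fun x => h₂.on_of_two hN (r := x) hpb h₂p h₂b
  have u₃ := fun x => h₃.on_of_two hN (r := x) hab h₃a h₃b
  have u₄ := fun x => hL.on_of_two hN (r := x) hrs hLr hLs
  classical
  simp only [countOn_cons, countOn_nil]
  by_cases hp : On N p <;> by_cases ha : On N a <;> by_cases hb : On N b <;>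
    by_cases hr : On N r <;> by_cases hs : On N s <;> simp_all

/-- Three points on one line, four on another one, and one point off both. -/
lemma IsSmall.false_of_three_four_one {Z : Finset Plane} (hZ : IsSmall (Z : Set Plane))
    {L M : TernaryPoly} (hL : IsLine L) (hM : IsLine M) {e a b c : Plane} (he : e ∈ Z)
    (ha : a ∈ Z) (hb : b ∈ Z) (hc : c ∈ Z) (hab : a ≠ b) (hac : a ≠ c) (hbc : b ≠ c)
    (hMa : On M a) (hMb : On M b) (hMc : On M c) (hLa : ¬ On L a) (hLb : ¬ On L b)
    (hLc : ¬ On L c) (hLe : ¬ On L e) (hMe : ¬ On M e) {S : Finset Plane} (hS : 4 ≤ S.card)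
    (hSZ : S ⊆ Z) (hSL : ∀ p ∈ S, On L p) (hSM : ∀ p ∈ S, ¬ On M p) : False := by
  classical
  have hea : e ≠ a := fun h => hMe (h ▸ hMa)
  have heb : e ≠ b := fun h => hMe (h ▸ hMb)
  have hec : e ≠ c := fun h => hMe (h ▸ hMc)
  obtain ⟨A, hA, hAe, hAa⟩ := exists_isLine_on hea
  obtain ⟨B, hB, hBe, hBb⟩ := exists_isLine_on heb
  obtain ⟨C, hC, hCe, hCc⟩ := exists_isLine_on hec
  have hAS := card_ptsOn_le_one hL hA hSL hAe hLe
  have hBS := card_ptsOn_le_one hL hB hSL hBe hLe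
  have hCS := card_ptsOn_le_one hL hC hSL hCe hLe
  have hAb : ¬ On A b := fun h => hMe (hM.on_of_two hA hab hMa hMb hAa h hAe)
  have hBa : ¬ On B a := fun h => hMe (hM.on_of_two hB hab hMa hMb h hBb hBe)
  have hBc : ¬ On B c := fun h => hMe (hM.on_of_two hB hbc hMb hMc hBb h hBe)
  have hAc : ¬ On A c := fun h => hMe (hM.on_of_two hA hac hMa hMc hAa h hAe)
  have hAC : ∀ p ∈ S, On A p → ¬ On C p := fun p hp h1 h2 => by
    have hep : e ≠ p := fun h => hLe (h ▸ hSL p hp)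
    exact hAc (hA.on_of_two hC hep hAe h1 hCe h2 hCc)
  obtain ⟨q, hq, hAq, hBq, hCq⟩ : ∃ q ∈ S, ¬ On A q ∧ ¬ On B q ∧ ¬ On C q := by
    by_contra! h
    have hsub : S ⊆ ptsOn S A ∪ ptsOn S B ∪ ptsOn S C := fun p hp => by
      simp only [Finset.mem_union, mem_ptsOn]
      by_contra! hp'
      exact hp'.2 hp (h p hp (hp'.1.1 hp) (hp'.1.2 hp))
    have h1 := Finset.card_le_card hsub
    have h2 := Finset.card_union_le (ptsOn S A ∪ ptsOn S B) (ptsOn S C)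
    have h3 := Finset.card_union_le (ptsOn S A) (ptsOn S B)
    lia
  obtain ⟨s, hs, t, ht, hst⟩ : ∃ s ∈ (ptsOff S B).erase q, ∃ t ∈ (ptsOff S B).erase q, s ≠ t := by
    refine Finset.one_lt_card.1 ?_
    have h1 := card_ptsOn_add_card_ptsOff S B
    have h2 := Finset.card_erase_of_mem (mem_ptsOff.2 ⟨hq, hBq⟩)
    lia
  rw [Finset.mem_erase, mem_ptsOff] at hs ht
  obtain ⟨u, v, hu, hv, huq, hvq, hBu, hBv, huv, hAu, hCv⟩ : ∃ u v, u ∈ S ∧ v ∈ S ∧ u ≠ q ∧ v ≠ q ∧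
      ¬ On B u ∧ ¬ On B v ∧ u ≠ v ∧ ¬ On A u ∧ ¬ On C v := by
    by_cases h : ¬ On A s ∧ ¬ On C t
    · exact ⟨s, t, hs.2.1, ht.2.1, hs.1, ht.1, hs.2.2, ht.2.2, hst, h.1, h.2⟩
    · refine ⟨t, s, ht.2.1, hs.2.1, ht.1, hs.1, ht.2.2, hs.2.2, hst.symm, fun hAt => ?_,
        fun hCs => ?_⟩
      · by_cases hAs : On A s
        · exact hst (Finset.card_le_one.1 hAS _ (mem_ptsOn.2 ⟨hs.2.1, hAs⟩) _
            (mem_ptsOn.2 ⟨ht.2.1, hAt⟩))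
        · exact hAC t ht.2.1 hAt (by_contra fun hCt => h ⟨hAs, hCt⟩)
      · by_cases hCt : On C t
        · exact hst (Finset.card_le_one.1 hCS _ (mem_ptsOn.2 ⟨hs.2.1, hCs⟩) _
            (mem_ptsOn.2 ⟨ht.2.1, hCt⟩))
        · exact hAC s hs.2.1 (by_contra fun hAs => h ⟨hAs, hCt⟩) hCs
  obtain ⟨hn₁, Q₁, hQ₁, ho₁⟩ := exists_conic_of_triangle hL hB hA hM heb hea hab.symm huq.symm hLe
    hLb hLa (hSL q hq) (hSL u hu) hBe hBb hBa hAe hAa hMb hMa hBq hBu hAq hAu (hSM q hq) (hSM u hu)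
  obtain ⟨hn₂, Q₂, hQ₂, ho₂⟩ := exists_conic_of_triangle hL hB hC hM heb hec hbc hvq.symm hLe
    hLb hLc (hSL q hq) (hSL v hv) hBe hBb hBc hCe hCc hMb hMc hBq hBv hCq hCv (hSM q hq) (hSM v hv)
  have ho₁' := ho₁
  have ho₂' := ho₂
  simp only [List.mem_cons, List.not_mem_nil, or_false, forall_eq_or_imp, forall_eq] at ho₁' ho₂'
  obtain ⟨h1e, h1b, h1a, h1q, h1u⟩ := ho₁'
  obtain ⟨h2e, h2b, h2c, h2q, h2v⟩ := ho₂'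
  have n1 : ¬ On Q₁ c := hQ₁.false_of_three hM hab hac hbc hMa hMb hMc h1a h1b
  have n2 : ¬ On Q₁ v := hQ₁.false_of_three hL huq.symm hvq.symm huv (hSL q hq) (hSL u hu)
    (hSL v hv) h1q h1u
  have n3 : ¬ On Q₂ a := fun h => hQ₂.false_of_three hM hab hac hbc hMa hMb hMc h h2b h2c
  have n4 : ¬ On Q₂ u := fun h => hQ₂.false_of_three hL huq.symm hvq.symm huv (hSL q hq) (hSL u hu)
    (hSL v hv) h2q h h2v
  have hqZ := hSZ hq
  have huZ := hSZ hu
  have hvZ := hSZ hv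
  refine hZ.false_of_two_conics hQ₁ hQ₂ hn₁ hn₂ rfl rfl ho₁ ho₂ (by simp [*]) (by simp [*]) ?_ ?_
  · simp [countOn_cons, *]
  · simp [countOn_cons, *]

/-- Four points on a line, and four points off it with no three collinear. -/
lemma IsSmall.false_of_quadrangle {Z : Finset Plane} (hZ : IsSmall (Z : Set Plane))
    {L : TernaryPoly} (hL : IsLine L) (hcard : 4 ≤ (ptsOn Z L).card) {a b c d : Plane}
    (ha : a ∈ ptsOff Z L) (hb : b ∈ ptsOff Z L) (hc : c ∈ ptsOff Z L) (hd : d ∈ ptsOff Z L)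
    (hab : a ≠ b) (hcd : c ≠ d) (habc : ¬ OnLine a b c) (habd : ¬ OnLine a b d)
    (hacd : ¬ OnLine a c d) (hbcd : ¬ OnLine b c d) : False := by
  obtain ⟨p, q, r, s, hp, hq, hr, hs, h⟩ := exists_four_le hcard
  obtain ⟨N₁, h₁, h₁a, h₁b⟩ := exists_isLine_on hab
  obtain ⟨N₂, h₂, h₂c, h₂d⟩ := exists_isLine_on hcd
  rw [mem_ptsOn] at hp hq hr hs
  rw [mem_ptsOff] at ha hb hc hd
  exact hZ.false_of_line_four hL h₁ h₂ (T := [p, q, r, s]) (by simp [h]) rfl (by simp [*])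
    (by simp [*]) ha.1 hb.1 hc.1 hd.1 hab hcd ha.2 hb.2 hc.2 hd.2 h₁a h₁b
    (fun h => habc ⟨N₁, h₁, h₁a, h₁b, h⟩) (fun h => habd ⟨N₁, h₁, h₁a, h₁b, h⟩)
    (fun h => hacd ⟨N₂, h₂, h, h₂c, h₂d⟩) (fun h => hbcd ⟨N₂, h₂, h, h₂c, h₂d⟩) h₂c h₂d

/-- Five points such that any four of them contain a collinear triple: four are collinear. -/
lemma exists_line_four_of_card_five {W : Finset Plane} (hW : W.card = 5)
    (h : ∀ a ∈ W, ∀ b ∈ W, ∀ c ∈ W, ∀ d ∈ W, a ≠ b → a ≠ c → a ≠ d → b ≠ c → b ≠ d → c ≠ d →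
      OnLine a b c ∨ OnLine a b d ∨ OnLine a c d ∨ OnLine b c d) :
    ∃ M, IsLine M ∧ 4 ≤ (ptsOn W M).card := by
  classical
  by_contra! hM
  obtain ⟨a, b, c, haW, hbW, hcW, hab, hac, hbc, M, hMl, ha, hb, hc⟩ : ∃ a b c, a ∈ W ∧ b ∈ W ∧
      c ∈ W ∧ a ≠ b ∧ a ≠ c ∧ b ≠ c ∧ OnLine a b c := by
    obtain ⟨a, b, c, d, ha, hb, hc, hd, hab, hac, had, hbc, hbd, hcd⟩ :=
      exists_four_le (S := W) (by lia)
    rcases h a ha b hb c hc d hd hab hac had hbc hbd hcd with h | h | h | h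
    · exact ⟨a, b, c, ha, hb, hc, hab, hac, hbc, h⟩
    · exact ⟨a, b, d, ha, hb, hd, hab, had, hbd, h⟩
    · exact ⟨a, c, d, ha, hc, hd, hac, had, hcd, h⟩
    · exact ⟨b, c, d, hb, hc, hd, hbc, hbd, hcd, h⟩
  obtain ⟨d, hd, f, hf, hdf⟩ : ∃ d ∈ ptsOff W M, ∃ f ∈ ptsOff W M, d ≠ f := by
    refine Finset.one_lt_card.1 ?_
    have h1 := card_ptsOn_add_card_ptsOff W M
    have h2 := hM M hMl
    lia
  rw [mem_ptsOff] at hd hf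
  obtain ⟨hdW, hMd⟩ := hd
  obtain ⟨hfW, hMf⟩ := hf
  obtain ⟨N, hN, hNd, hNf⟩ := exists_isLine_on hdf
  have ne : ∀ {x y}, On M x → ¬ On M y → x ≠ y := fun hx hy hxy => hy (hxy ▸ hx)
  have hit : ∀ x ∈ W, ∀ y ∈ W, On M x → On M y → x ≠ y → On N x ∨ On N y := by
    intro x hx y hy hMx hMy hxy
    rcases h x hx y hy d hdW f hfW hxy (ne hMx hMd) (ne hMx hMf) (ne hMy hMd) (ne hMy hMf) hdf with
      ⟨K, hK, k1, k2, k3⟩ | ⟨K, hK, k1, k2, k3⟩ | ⟨K, hK, k1, k2, k3⟩ | ⟨K, hK, k1, k2, k3⟩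
    · exact absurd (hMl.on_of_two hK hxy hMx hMy k1 k2 k3) hMd
    · exact absurd (hMl.on_of_two hK hxy hMx hMy k1 k2 k3) hMf
    · exact Or.inl (hN.on_of_two hK hdf hNd hNf k2 k3 k1)
    · exact Or.inr (hN.on_of_two hK hdf hNd hNf k2 k3 k1)
  have two : ∀ {x y}, On M x → On M y → x ≠ y → On N x → ¬ On N y := fun hx hy hxy h1 h2 =>
    hMd (hMl.on_of_two hN hxy hx hy h1 h2 hNd)
  have h1 := hit a haW b hbW ha hb hab
  have h2 := hit a haW c hcW ha hc hac
  have h3 := hit b hbW c hcW hb hc hbc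
  have h4 := two ha hb hab
  have h5 := two ha hc hac
  have h6 := two hb hc hbc
  clear * - h1 h2 h3 h4 h5 h6
  tauto

/-- A line containing six of the points. -/
lemma IsSmall.standardConfig {Z : Finset Plane} (hZ : IsSmall (Z : Set Plane))
    (hcard : Z.card = 9)
    (hlines : ∀ L M, IsLine L → IsLine M → ∃ p ∈ Z, ¬ On L p ∧ ¬ On M p)
    {L : TernaryPoly} (hL : IsLine L) (h6 : (ptsOn Z L).card = 6) :
    StandardConfig 6 (Z : Set Plane) := by
  classical
  have hW : (ptsOff Z L).card = 3 := by
    have := card_ptsOn_add_card_ptsOff Z L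
    lia
  obtain ⟨p, a, b, hpa, hpb, hab, hWeq⟩ := Finset.card_eq_three.1 hW
  have hmem : ∀ x, x ∈ Z → ¬ On L x → x = p ∨ x = a ∨ x = b := fun x hx hLx => by
    have : x ∈ ptsOff Z L := mem_ptsOff.2 ⟨hx, hLx⟩
    simpa [hWeq] using this
  obtain ⟨hp, hLp⟩ := mem_ptsOff.1 (show p ∈ ptsOff Z L by simp [hWeq])
  obtain ⟨ha, hLa⟩ := mem_ptsOff.1 (show a ∈ ptsOff Z L by simp [hWeq])
  obtain ⟨hb, hLb⟩ := mem_ptsOff.1 (show b ∈ ptsOff Z L by simp [hWeq])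
  obtain ⟨N₁, h₁, h₁p, h₁a⟩ := exists_isLine_on hpa
  obtain ⟨N₂, h₂, h₂p, h₂b⟩ := exists_isLine_on hpb
  obtain ⟨N₃, h₃, h₃a, h₃b⟩ := exists_isLine_on hab
  have h₁b : ¬ On N₁ b := fun h => by
    obtain ⟨x, hx, hLx, hNx⟩ := hlines L N₁ hL h₁
    rcases hmem x hx hLx with rfl | rfl | rfl <;> contradiction
  have hS : ∀ x ∈ ptsOn Z L, On L x := fun x hx => (mem_ptsOn.1 hx).2
  have c₁ := card_ptsOn_le_one hL h₁ hS h₁p hLp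
  have c₂ := card_ptsOn_le_one hL h₂ hS h₂p hLp
  have c₃ := card_ptsOn_le_one hL h₃ hS h₃a hLa
  by_cases hall : (∃ x, x ∈ ptsOn (ptsOn Z L) N₁) ∧ (∃ x, x ∈ ptsOn (ptsOn Z L) N₂) ∧
      ∃ x, x ∈ ptsOn (ptsOn Z L) N₃
  · obtain ⟨⟨q₁, hq₁⟩, ⟨q₂, hq₂⟩, c, hc⟩ := hall
    simp only [mem_ptsOn] at hq₁ hq₂ hc
    obtain ⟨⟨hq₁, hLq₁⟩, h₁q₁⟩ := hq₁
    obtain ⟨⟨hq₂, hLq₂⟩, h₂q₂⟩ := hq₂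
    obtain ⟨⟨hc, hLc⟩, h₃c⟩ := hc
    have ne : ∀ {x y}, On L x → ¬ On L y → y ≠ x := fun hx hy hxy => hy (hxy ▸ hx)
    have m := fun {x : Plane} => memLine_iff_on hL.2 x
    have m₁ := fun {x : Plane} => memLine_iff_on h₁.2 x
    have m₂ := fun {x : Plane} => memLine_iff_on h₂.2 x
    have m₃ := fun {x : Plane} => memLine_iff_on h₃.2 x
    refine ⟨L, N₁, N₂, N₃, q₁, q₂, c, p, a, b, hL, h₁, h₂, h₃, hq₁, hq₂, hc, hp, ha, hb, ?_, ?_, ?_,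
      m.2 hLq₁, m.2 hLq₂, m.2 hLc, ?_, m.not.2 hLp, m₁.2 h₁p, m₁.2 h₁q₁, m₁.2 h₁a, hpa.symm,
      ne hLq₁ hLa, m.not.2 hLa, m₂.2 h₂p, m₂.2 h₂q₂, m₂.2 h₂b, hpb.symm, ne hLq₂ hLb, m.not.2 hLb,
      m₃.2 h₃a, m₃.2 h₃b, m₃.2 h₃c, ?_⟩
    · rintro rfl
      exact h₁b (h₁.on_of_two h₂ (ne hLq₁ hLp) h₁p h₁q₁ h₂p h₂q₂ h₂b)
    · rintro rfl
      exact h₁b (h₁.on_of_two h₃ (ne hLq₁ hLa) h₁a h₁q₁ h₃a h₃c h₃b)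
    · rintro rfl
      exact h₁b (h₁.on_of_two h₃ hpa h₁p h₁a
        (h₃.on_of_two h₂ (ne hLq₂ hLb) h₃b h₃c h₂b h₂q₂ h₂p) h₃a h₃b)
    · rw [← h6, ← Set.ncard_coe_finset]
      congr 1
      ext x
      simp [mem_ptsOn, m]
    · rintro x y w hx hy hw hxy hxw hyw ⟨N, hN, hNx, hNy, hNw⟩
      rw [memLine_iff_on hN.2] at hNx hNy hNw
      simp only [m, m₁, m₂, m₃]
      have e := fun {u v w : Plane} (huv : u ≠ v) (hu : On L u) (hv : On L v) (hNu : On N u)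
        (hNv : On N v) (hNw : On N w) => hL.on_of_two hN huv hu hv hNu hNv hNw
      have e₁ := fun {x : Plane} (hNp : On N p) (hNa : On N a) (hNx : On N x) =>
        h₁.on_of_two hN hpa h₁p h₁a hNp hNa hNx
      have e₂ := fun {x : Plane} (hNp : On N p) (hNb : On N b) (hNx : On N x) =>
        h₂.on_of_two hN hpb h₂p h₂b hNp hNb hNx
      have e₃ := fun {x : Plane} (hNa : On N a) (hNb : On N b) (hNx : On N x) =>
        h₃.on_of_two hN hab h₃a h₃b hNa hNb hNx
      have hx' := hmem x hx
      have hy' := hmem y hy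
      have hw' := hmem w hw
      by_cases k1 : On L x <;> by_cases k2 : On L y <;> by_cases k3 : On L w
      · exact Or.inl ⟨k1, k2, k3⟩
      · exact absurd (e hxy k1 k2 hNx hNy hNw) k3
      · exact absurd (e hxw k1 k3 hNx hNw hNy) k2
      · rcases hy' k2 with rfl | rfl | rfl <;> rcases hw' k3 with rfl | rfl | rfl <;> grind
      · exact absurd (e hyw k2 k3 hNy hNw hNx) k1
      · rcases hx' k1 with rfl | rfl | rfl <;> rcases hw' k3 with rfl | rfl | rfl <;> grind
      · rcases hx' k1 with rfl | rfl | rfl <;> rcases hy' k2 with rfl | rfl | rfl <;> grind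
      · rcases hx' k1 with rfl | rfl | rfl <;> rcases hy' k2 with rfl | rfl | rfl <;> grind
  · exfalso
    have hT : 4 ≤ (ptsOff (ptsOff (ptsOff (ptsOn Z L) N₁) N₂) N₃).card := by
      have k₁ := card_ptsOn_add_card_ptsOff (ptsOn Z L) N₁
      have k₂ := card_ptsOn_add_card_ptsOff (ptsOff (ptsOn Z L) N₁) N₂
      have k₃ := card_ptsOn_add_card_ptsOff (ptsOff (ptsOff (ptsOn Z L) N₁) N₂) N₃
      have s₂ : ptsOn (ptsOff (ptsOn Z L) N₁) N₂ ⊆ ptsOn (ptsOn Z L) N₂ := fun x => by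
        simp only [mem_ptsOn, mem_ptsOff]
        tauto
      have s₃ : ptsOn (ptsOff (ptsOff (ptsOn Z L) N₁) N₂) N₃ ⊆ ptsOn (ptsOn Z L) N₃ := fun x => by
        simp only [mem_ptsOn, mem_ptsOff]
        tauto
      have l₂ := Finset.card_le_card s₂
      have l₃ := Finset.card_le_card s₃
      have : (ptsOn (ptsOn Z L) N₁).card = 0 ∨ (ptsOn (ptsOn Z L) N₂).card = 0 ∨
          (ptsOn (ptsOn Z L) N₃).card = 0 := by
        simp only [← Finset.card_pos, ← Finset.Nonempty.eq_1] at hall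
        lia
      lia
    obtain ⟨r, s, t, u, hr, hs, ht, hu, hrs, hrt, hru, hst, hsu, htu⟩ := exists_four_le hT
    simp only [mem_ptsOff, mem_ptsOn] at hr hs ht hu
    obtain ⟨⟨⟨⟨hr, hLr⟩, h₁r⟩, h₂r⟩, h₃r⟩ := hr
    obtain ⟨⟨⟨⟨hs, hLs⟩, h₁s⟩, h₂s⟩, h₃s⟩ := hs
    obtain ⟨⟨⟨⟨ht, hLt⟩, h₁t⟩, h₂t⟩, h₃t⟩ := ht
    obtain ⟨⟨⟨⟨hu, hLu⟩, h₁u⟩, h₂u⟩, h₃u⟩ := hu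
    obtain ⟨hn₁, Q₁, hQ₁, ho₁⟩ := exists_conic_of_triangle hL h₁ h₂ h₃ hpa hpb hab hrs hLp hLa hLb
      hLr hLs h₁p h₁a h₁b h₂p h₂b h₃a h₃b h₁r h₁s h₂r h₂s h₃r h₃s
    obtain ⟨hn₂, Q₂, hQ₂, ho₂⟩ := exists_conic_of_triangle hL h₁ h₂ h₃ hpa hpb hab htu hLp hLa hLb
      hLt hLu h₁p h₁a h₁b h₂p h₂b h₃a h₃b h₁t h₁u h₂t h₂u h₃t h₃u
    have ho₁' := ho₁
    have ho₂' := ho₂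
    simp only [List.mem_cons, List.not_mem_nil, or_false, forall_eq_or_imp, forall_eq] at ho₁' ho₂'
    obtain ⟨-, -, -, h1r, h1s⟩ := ho₁'
    obtain ⟨-, -, -, h2t, h2u⟩ := ho₂'
    have n1 : ¬ On Q₁ t := hQ₁.false_of_three hL hrs hrt hst hLr hLs hLt h1r h1s
    have n2 : ¬ On Q₁ u := hQ₁.false_of_three hL hrs hru hsu hLr hLs hLu h1r h1s
    have n3 : ¬ On Q₂ r := fun h => hQ₂.false_of_three hL hrt hru htu hLr hLt hLu h h2t h2u
    have n4 : ¬ On Q₂ s := fun h => hQ₂.false_of_three hL hst hsu htu hLs hLt hLu h h2t h2u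
    have l1 := countOn_le_length Q₁ [p, a, b]
    have l2 := countOn_le_length Q₂ [p, a, b]
    refine hZ.false_of_two_conics hQ₁ hQ₂ hn₁ hn₂ rfl rfl ho₁ ho₂ (by simp [*]) (by simp [*]) ?_ ?_
    · simpa [countOn_cons, n1, n2] using l1
    · simpa [countOn_cons, n3, n4] using l2

/-- A line containing at least four of the points. -/
lemma IsSmall.standardConfig_of_line_four {Z : Finset Plane} (hZ : IsSmall (Z : Set Plane))
    (hcard : Z.card = 9)
    (hlines : ∀ L M, IsLine L → IsLine M → ∃ p ∈ Z, ¬ On L p ∧ ¬ On M p)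
    {L : TernaryPoly} (hL : IsLine L) (h4 : 4 ≤ (ptsOn Z L).card) :
    StandardConfig 6 (Z : Set Plane) := by
  classical
  have hadd := card_ptsOn_add_card_ptsOff Z L
  have hon : ∀ p ∈ ptsOn Z L, On L p := fun p hp => (mem_ptsOn.1 hp).2
  by_cases h7 : 7 ≤ (ptsOn Z L).card
  · exfalso
    obtain ⟨S, hWS, -, hS⟩ := Finset.exists_subsuperset_card_eq (n := 2)
      (show ptsOff Z L ⊆ Z from fun p hp => (mem_ptsOff.1 hp).1) (by lia) (by lia)
    obtain ⟨p, q, hpq, rfl⟩ := Finset.card_eq_two.1 hS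
    obtain ⟨M, hM, hMp, hMq⟩ := exists_isLine_on hpq
    obtain ⟨x, hx, hLx, hMx⟩ := hlines L M hL hM
    have := hWS (mem_ptsOff.2 ⟨hx, hLx⟩)
    simp only [Finset.mem_insert, Finset.mem_singleton] at this
    rcases this with rfl | rfl <;> contradiction
  by_cases h6 : (ptsOn Z L).card = 6
  · exact hZ.standardConfig hcard hlines hL h6
  exfalso
  have hquad : ∀ a ∈ ptsOff Z L, ∀ b ∈ ptsOff Z L, ∀ c ∈ ptsOff Z L, ∀ d ∈ ptsOff Z L, a ≠ b →
      a ≠ c → a ≠ d → b ≠ c → b ≠ d → c ≠ d →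
      OnLine a b c ∨ OnLine a b d ∨ OnLine a c d ∨ OnLine b c d := by
    intro a ha b hb c hc d hd hab _ _ _ _ hcd
    by_contra! h
    exact hZ.false_of_quadrangle hL h4 ha hb hc hd hab hcd h.1 h.2.1 h.2.2.1 h.2.2.2
  by_cases h5 : (ptsOn Z L).card = 5
  · have key : ∀ a ∈ ptsOff Z L, ∀ b ∈ ptsOff Z L, ∀ c ∈ ptsOff Z L, a ≠ b → a ≠ c → b ≠ c →
        ¬ OnLine a b c := by
      rintro a ha b hb c hc hab hac hbc ⟨M, hM, hMa, hMb, hMc⟩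
      rw [mem_ptsOff] at ha hb hc
      obtain ⟨e, he, hLe, hMe⟩ := hlines L M hL hM
      have h1 := card_ptsOn_le_one hL hM hon hMa ha.2
      have h2 := card_ptsOn_add_card_ptsOff (ptsOn Z L) M
      exact hZ.false_of_three_four_one hL hM he ha.1 hb.1 hc.1 hab hac hbc hMa hMb hMc ha.2 hb.2
        hc.2 hLe hMe (S := ptsOff (ptsOn Z L) M) (by lia)
        (fun p hp => (mem_ptsOn.1 (mem_ptsOff.1 hp).1).1) (fun p hp => hon p (mem_ptsOff.1 hp).1)
        fun p hp => (mem_ptsOff.1 hp).2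
    obtain ⟨a, b, c, d, ha, hb, hc, hd, hab, hac, had, hbc, hbd, hcd⟩ :=
      exists_four_le (S := ptsOff Z L) (by lia)
    rcases hquad a ha b hb c hc d hd hab hac had hbc hbd hcd with h | h | h | h
    · exact key a ha b hb c hc hab hac hbc h
    · exact key a ha b hb d hd hab had hbd h
    · exact key a ha c hc d hd hac had hcd h
    · exact key b hb c hc d hd hbc hbd hcd h
  · obtain ⟨M, hM, hM4⟩ := exists_line_four_of_card_five (by lia) hquad
    obtain ⟨e, he, hLe, hMe⟩ := hlines L M hL hM
    obtain ⟨x, hx⟩ := Finset.card_pos.1 (by lia : 0 < (ptsOn (ptsOff Z L) M).card)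
    rw [mem_ptsOn, mem_ptsOff] at hx
    have h1 := card_ptsOn_le_one hL hM hon hx.2 hx.1.2
    have h2 := card_ptsOn_add_card_ptsOff (ptsOn Z L) M
    obtain ⟨a, ha, b, hb, c, hc, hab, hac, hbc⟩ :=
      Finset.two_lt_card.1 (by lia : 2 < (ptsOff (ptsOn Z L) M).card)
    rw [mem_ptsOff, mem_ptsOn] at ha hb hc
    exact hZ.false_of_three_four_one hM hL he ha.1.1 hb.1.1 hc.1.1 hab hac hbc ha.1.2 hb.1.2 hc.1.2
      ha.2 hb.2 hc.2 hMe hLe hM4 (fun p hp => (mem_ptsOff.1 (mem_ptsOn.1 hp).1).1)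
      (fun p hp => (mem_ptsOn.1 hp).2) fun p hp => (mem_ptsOff.1 (mem_ptsOn.1 hp).1).2

lemma countOn_toList (S : Finset Plane) (G : TernaryPoly) :
    countOn G S.toList = (ptsOn S G).card := by
  classical
  rw [countOn, List.countP_eq_length_filter,
    ← List.toFinset_card_of_nodup (S.nodup_toList.filter _)]
  congr 1
  ext p
  simp [mem_ptsOn]

lemma three_le_card_ptsOn {Z : Finset Plane} {N : TernaryPoly} {a b c : Plane} (ha : a ∈ Z)
    (hb : b ∈ Z) (hc : c ∈ Z) (hab : a ≠ b) (hac : a ≠ c) (hbc : b ≠ c) (hNa : On N a)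
    (hNb : On N b) (hNc : On N c) : 3 ≤ (ptsOn Z N).card :=
  Finset.two_lt_card.2 ⟨a, mem_ptsOn.2 ⟨ha, hNa⟩, b, mem_ptsOn.2 ⟨hb, hNb⟩, c,
    mem_ptsOn.2 ⟨hc, hNc⟩, hab, hac, hbc⟩

lemma eq_of_card_ptsOn_le {Z : Finset Plane} {N : TernaryPoly} (h3 : (ptsOn Z N).card ≤ 3)
    {a b c p : Plane} (ha : a ∈ Z) (hb : b ∈ Z) (hc : c ∈ Z) (hp : p ∈ Z) (hab : a ≠ b)
    (hac : a ≠ c) (hbc : b ≠ c) (hNa : On N a) (hNb : On N b) (hNc : On N c) (hNp : On N p) :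
    p = a ∨ p = b ∨ p = c := by
  classical
  by_contra! h
  have hsub : {p, a, b, c} ⊆ ptsOn Z N := fun x hx => by
    simp only [Finset.mem_insert, Finset.mem_singleton] at hx
    rcases hx with rfl | rfl | rfl | rfl <;> simp [mem_ptsOn, *]
  have := Finset.card_le_card hsub
  simp [*] at this
  lia

/-- Two lines, each containing three of the points, and a further line which passes through two
of the points but through none of those on the first two lines. -/
lemma IsSmall.false_of_two_lines {Z : Finset Plane} (hZ : IsSmall (Z : Set Plane))
    {M M' N : TernaryPoly} (hM : IsLine M) (hM' : IsLine M') (hN : IsLine N)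
    (hc : (ptsOn Z M).card = 3) (hc' : (ptsOn Z M').card = 3)
    (hMM' : (ptsOn (ptsOn Z M) M').card ≤ 1) (hM'M : (ptsOn (ptsOn Z M') M).card ≤ 1) {e f : Plane}
    (he : e ∈ Z) (hf : f ∈ Z) (hef : e ≠ f) (hNe : On N e) (hNf : On N f) (hMe : ¬ On M e)
    (hMf : ¬ On M f) (hM'e : ¬ On M' e) (hM'f : ¬ On M' f)
    (hNM : ∀ p ∈ Z, On M p ∨ On M' p → ¬ On N p) : False := by
  refine hZ.false_of_two_triples hM hM' hN (ptsOn Z M).nodup_toList (ptsOn Z M').nodup_toList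
    (by simpa) (by simpa) (fun p hp => (mem_ptsOn.1 (Finset.mem_toList.1 hp)).2)
    (fun p hp => (mem_ptsOn.1 (Finset.mem_toList.1 hp)).2)
    (fun p hp => (mem_ptsOn.1 (Finset.mem_toList.1 hp)).1)
    (fun p hp => (mem_ptsOn.1 (Finset.mem_toList.1 hp)).1) (by rwa [countOn_toList])
    (by rwa [countOn_toList]) he hf hef hNe hNf hMe hMf hM'e hM'f (fun p hp => ?_) fun p hp => ?_
  · have := mem_ptsOn.1 (Finset.mem_toList.1 hp)
    exact hNM p this.1 (Or.inl this.2)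
  · have := mem_ptsOn.1 (Finset.mem_toList.1 hp)
    exact hNM p this.1 (Or.inr this.2)

lemma card_ptsOn_ptsOn_le_one {Z : Finset Plane} {M M' : TernaryPoly} (hM : IsLine M)
    (hM' : IsLine M') {x : Plane} (hMx : On M x) (hM'x : ¬ On M' x) :
    (ptsOn (ptsOn Z M) M').card ≤ 1 ∧ (ptsOn (ptsOn Z M') M).card ≤ 1 := by
  refine ⟨Finset.card_le_one.2 fun a ha b hb => ?_, Finset.card_le_one.2 fun a ha b hb => ?_⟩ <;>
  · simp only [mem_ptsOn] at ha hb
    by_contra hab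
    exact hM'x (hM'.on_of_two hM hab (by tauto) (by tauto) (by tauto) (by tauto) hMx)

/-- Two lines, each containing three of the points, which meet in one of the points. -/
lemma IsSmall.false_of_two_lines_meeting {Z : Finset Plane} (hZ : IsSmall (Z : Set Plane))
    (hcard : Z.card = 9) (h3 : ∀ N, IsLine N → (ptsOn Z N).card ≤ 3) {M M' : TernaryPoly}
    (hM : IsLine M) (hM' : IsLine M') (hc : (ptsOn Z M).card = 3) (hc' : (ptsOn Z M').card = 3)
    {x w : Plane} (hMx : On M x) (hM'x : ¬ On M' x) (hw : w ∈ Z) (hMw : On M w) (hM'w : On M' w) :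
    False := by
  classical
  obtain ⟨hMM', hM'M⟩ := card_ptsOn_ptsOn_le_one (Z := Z) hM hM' hMx hM'x
  have hR : 4 ≤ (ptsOff (ptsOff Z M) M').card := by
    have k := card_ptsOn_add_card_ptsOff Z M
    have k' := card_ptsOn_add_card_ptsOff (ptsOff Z M) M'
    have hsub : ptsOn (ptsOff Z M) M' ⊆ (ptsOn Z M').erase w := fun p hp => by
      simp only [mem_ptsOn, mem_ptsOff] at hp
      rw [Finset.mem_erase, mem_ptsOn]
      exact ⟨fun h => hp.1.2 (h ▸ hMw), hp.1.1, hp.2⟩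
    have := Finset.card_le_card hsub
    have := Finset.card_erase_of_mem (mem_ptsOn.2 ⟨hw, hM'w⟩)
    lia
  have key : ∀ a b c, a ∈ ptsOff (ptsOff Z M) M' → b ∈ ptsOff (ptsOff Z M) M' →
      c ∈ ptsOff (ptsOff Z M) M' → a ≠ b → a ≠ c → b ≠ c → ¬ OnLine a b c := by
    rintro a b c ha hb hc₀ hab hac hbc ⟨N, hN, hNa, hNb, hNc⟩
    simp only [mem_ptsOff] at ha hb hc₀
    refine hZ.false_of_two_lines hM hM' hN hc hc' hMM' hM'M ha.1.1 hb.1.1 hab hNa hNb ha.1.2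
      hb.1.2 ha.2 hb.2 fun p hp hp' hNp => ?_
    rcases eq_of_card_ptsOn_le (h3 N hN) ha.1.1 hb.1.1 hc₀.1.1 hp hab hac hbc hNa hNb hNc hNp with
      rfl | rfl | rfl
    · exact hp'.elim ha.1.2 ha.2
    · exact hp'.elim hb.1.2 hb.2
    · exact hp'.elim hc₀.1.2 hc₀.2
  obtain ⟨e, f, g, h, he, hf, hg, hh, hef, heg, heh, hfg, hfh, hgh⟩ := exists_four_le hR
  obtain ⟨N₁, h₁, h₁e, h₁f⟩ := exists_isLine_on hef
  obtain ⟨N₂, h₂, h₂g, h₂h⟩ := exists_isLine_on hgh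
  have n₁ := fun k => key e f g he hf hg hef heg hfg ⟨N₁, h₁, h₁e, h₁f, k⟩
  have n₂ := fun k => key e f h he hf hh hef heh hfh ⟨N₁, h₁, h₁e, h₁f, k⟩
  have n₃ := fun k => key e g h he hg hh heg heh hgh ⟨N₂, h₂, k, h₂g, h₂h⟩
  have n₄ := fun k => key f g h hf hg hh hfg hfh hgh ⟨N₂, h₂, k, h₂g, h₂h⟩
  simp only [mem_ptsOff] at he hf hg hh
  exact hZ.false_of_two_triples_two_pairs hM hM' h₁ h₂ (ptsOn Z M).nodup_toList
    (ptsOn Z M').nodup_toList (by simpa) (by simpa)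
    (fun p hp => (mem_ptsOn.1 (Finset.mem_toList.1 hp)).2)
    (fun p hp => (mem_ptsOn.1 (Finset.mem_toList.1 hp)).2)
    (fun p hp => (mem_ptsOn.1 (Finset.mem_toList.1 hp)).1)
    (fun p hp => (mem_ptsOn.1 (Finset.mem_toList.1 hp)).1) (by rwa [countOn_toList])
    (by rwa [countOn_toList]) he.1.1 hf.1.1 hg.1.1 hh.1.1 hef hgh he.1.2 hf.1.2 hg.1.2 hh.1.2
    he.2 hf.2 hg.2 hh.2 h₁e h₁f n₁ n₂ n₃ n₄ h₂g h₂h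

/-- If every line contains at most three of the points, at most one line contains three. -/
lemma IsSmall.on_of_card_eq_three {Z : Finset Plane} (hZ : IsSmall (Z : Set Plane))
    (hcard : Z.card = 9) (h3 : ∀ N, IsLine N → (ptsOn Z N).card ≤ 3) {M M' : TernaryPoly}
    (hM : IsLine M) (hM' : IsLine M') (hc : (ptsOn Z M).card = 3) (hc' : (ptsOn Z M').card = 3)
    {x : Plane} (hMx : On M x) : On M' x := by
  classical
  by_contra hM'x
  obtain ⟨hMM', hM'M⟩ := card_ptsOn_ptsOn_le_one (Z := Z) hM hM' hMx hM'x
  obtain ⟨e, he, f, hf, hef⟩ : ∃ e ∈ ptsOff (ptsOff Z M) M', ∃ f ∈ ptsOff (ptsOff Z M) M',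
      e ≠ f := by
    refine Finset.one_lt_card.1 ?_
    have k := card_ptsOn_add_card_ptsOff Z M
    have k' := card_ptsOn_add_card_ptsOff (ptsOff Z M) M'
    have hsub : ptsOn (ptsOff Z M) M' ⊆ ptsOn Z M' := fun p hp => by
      simp only [mem_ptsOn, mem_ptsOff] at hp ⊢
      exact ⟨hp.1.1, hp.2⟩
    have := Finset.card_le_card hsub
    lia
  simp only [mem_ptsOff] at he hf
  obtain ⟨N, hN, hNe, hNf⟩ := exists_isLine_on hef
  refine hZ.false_of_two_lines hM hM' hN hc hc' hMM' hM'M he.1.1 hf.1.1 hef hNe hNf he.1.2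
    hf.1.2 he.2 hf.2 fun p hp hp' hNp => ?_
  have hep : e ≠ p := by
    rintro rfl
    exact hp'.elim he.1.2 he.2
  have hfp : f ≠ p := by
    rintro rfl
    exact hp'.elim hf.1.2 hf.2
  have hcN := (h3 N hN).antisymm
    (three_le_card_ptsOn he.1.1 hf.1.1 hp hef hep hfp hNe hNf hNp)
  rcases hp' with hMp | hM'p
  · exact hZ.false_of_two_lines_meeting hcard h3 hN hM hcN hc hNe he.1.2 hp hNp hMp
  · exact hZ.false_of_two_lines_meeting hcard h3 hN hM' hcN hc' hNe he.2 hp hNp hM'p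

/-- If every line contains at most three of the points, removing a suitable point leaves points
no three of which are collinear. -/
lemma IsSmall.exists_erase_card_ptsOn_le {Z : Finset Plane} [DecidableEq Plane]
    (hZ : IsSmall (Z : Set Plane))
    (hcard : Z.card = 9) (h3 : ∀ N, IsLine N → (ptsOn Z N).card ≤ 3) :
    ∃ t ∈ Z, ∀ N, IsLine N → (ptsOn (Z.erase t) N).card ≤ 2 := by
  have hsub : ∀ t N, ptsOn (Z.erase t) N ⊆ ptsOn Z N := fun t N p hp => by
    rw [mem_ptsOn] at hp ⊢
    exact ⟨Finset.mem_of_mem_erase hp.1, hp.2⟩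
  by_cases hM : ∃ M, IsLine M ∧ (ptsOn Z M).card = 3
  · obtain ⟨M, hM, hc⟩ := hM
    obtain ⟨t, ht⟩ := Finset.card_pos.1 (by lia : 0 < (ptsOn Z M).card)
    rw [mem_ptsOn] at ht
    refine ⟨t, ht.1, fun N hN => ?_⟩
    by_contra! hN3
    have h1 := h3 N hN
    have h2 := Finset.card_le_card (hsub t N)
    have hNt := hZ.on_of_card_eq_three hcard h3 hM hN hc (by lia) ht.2
    have h4 : ptsOn (Z.erase t) N ⊆ (ptsOn Z N).erase t := fun p hp =>
      Finset.mem_erase.2 ⟨Finset.ne_of_mem_erase (mem_ptsOn.1 hp).1, hsub t N hp⟩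
    have h5 := Finset.card_le_card h4
    have h6 := Finset.card_erase_of_mem (mem_ptsOn.2 ⟨ht.1, hNt⟩)
    lia
  · push Not at hM
    obtain ⟨t, ht⟩ := Finset.card_pos.1 (by lia : 0 < Z.card)
    refine ⟨t, ht, fun N hN => ?_⟩
    have h1 := h3 N hN
    have h2 := Finset.card_le_card (hsub t N)
    have h3 := hM N hN
    lia

lemma exists_isSmoothConic_of_card_eq {S A : Finset Plane}
    (hS : ∀ N, IsLine N → (ptsOn S N).card ≤ 2) (hA : A ⊆ S) (h5 : A.card = 5) :
    ∃ Q, IsSmoothConic Q ∧ ∀ p ∈ A, On Q p := by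
  obtain ⟨Q, hQ, h⟩ := exists_isSmoothConic A.nodup_toList (by simpa) fun N hN => by
    rw [countOn_toList]
    refine (Finset.card_le_card fun p hp => ?_).trans (hS N hN)
    rw [mem_ptsOn] at hp ⊢
    exact ⟨hA hp.1, hp.2⟩
  exact ⟨Q, hQ, fun p hp => h p (Finset.mem_toList.2 hp)⟩

lemma IsSmall.false_of_card_ptsOn_conic_eq_seven {Z S : Finset Plane}
    (hZ : IsSmall (Z : Set Plane)) (hSZ : S ⊆ Z) (hcard : S.card = 8)
    (hS : ∀ N, IsLine N → (ptsOn S N).card ≤ 2) {Q : TernaryPoly} (hQ : IsSmoothConic Q)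
    (h7 : (ptsOn S Q).card = 7) : False := by
  classical
  have hadd := card_ptsOn_add_card_ptsOff S Q
  obtain ⟨u, hu⟩ := Finset.card_pos.1 (by lia : 0 < (ptsOff S Q).card)
  obtain ⟨hu, hQu⟩ := mem_ptsOff.1 hu
  obtain ⟨x, hx, y, hy, z, hz, hxy, hxz, hyz⟩ :=
    Finset.two_lt_card.1 (by lia : 2 < (ptsOn S Q).card)
  have ne : ∀ {p}, p ∈ ptsOn S Q → u ≠ p := fun hp h => hQu (h ▸ (mem_ptsOn.1 hp).2)
  have hex : ∀ {p}, p ∈ ptsOn S Q → ∃ N, IsLine N ∧ On N u ∧ On N p ∧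
      countOn N (ptsOn S Q).toList ≤ 1 ∧ ∀ q ∈ ptsOn S Q, p ≠ q → ¬ On N q := by
    intro p hp
    obtain ⟨N, hN, hNu, hNp⟩ := exists_isLine_on (ne hp)
    have hle : (ptsOn (ptsOn S Q) N).card ≤ 1 := by
      have hsub : ptsOn (ptsOn S Q) N ⊆ (ptsOn S N).erase u := fun q hq => by
        have h1 := mem_ptsOn.1 hq
        exact Finset.mem_erase.2 ⟨(ne h1.1).symm, mem_ptsOn.2 ⟨(mem_ptsOn.1 h1.1).1, h1.2⟩⟩
      have h1 := Finset.card_le_card hsub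
      have h2 := Finset.card_erase_of_mem (mem_ptsOn.2 ⟨hu, hNu⟩)
      have h3 := hS N hN
      lia
    refine ⟨N, hN, hNu, hNp, by rwa [countOn_toList], fun q hq hpq hNq => hpq ?_⟩
    exact Finset.card_le_one.1 hle _ (mem_ptsOn.2 ⟨hp, hNp⟩) _ (mem_ptsOn.2 ⟨hq, hNq⟩)
  obtain ⟨N₁, h₁, h₁u, h₁x, c₁, n₁⟩ := hex hx
  obtain ⟨N₂, h₂, h₂u, h₂y, c₂, n₂⟩ := hex hy
  obtain ⟨N₃, h₃, h₃u, h₃z, c₃, n₃⟩ := hex hz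
  exact hZ.false_of_conic_seven hQ h₁ h₂ h₃ (ptsOn S Q).nodup_toList (by simpa)
    (fun p hp => (mem_ptsOn.1 (Finset.mem_toList.1 hp)).2)
    (fun p hp => hSZ (mem_ptsOn.1 (Finset.mem_toList.1 hp)).1) (hSZ hu) hQu h₁u h₂u h₃u
    (Finset.mem_toList.2 hx) (Finset.mem_toList.2 hy) (Finset.mem_toList.2 hz) c₁ c₂ c₃
    h₁x (n₁ y hy hxy) (n₁ z hz hxz) (n₂ x hx hxy.symm) h₂y (n₂ z hz hyz) (n₃ x hx hxz.symm)
    (n₃ y hy hyz.symm) h₃z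

lemma IsSmall.false_of_card_ptsOn_conic_eq_six {Z S : Finset Plane}
    (hZ : IsSmall (Z : Set Plane)) (hSZ : S ⊆ Z) (hcard : S.card = 8)
    (hS : ∀ N, IsLine N → (ptsOn S N).card ≤ 2) {Q : TernaryPoly} (hQ : IsSmoothConic Q)
    (h6 : (ptsOn S Q).card = 6) : False := by
  classical
  have hadd := card_ptsOn_add_card_ptsOff S Q
  obtain ⟨t, ht, u, hu, htu⟩ := Finset.one_lt_card.1 (by lia : 1 < (ptsOff S Q).card)
  rw [mem_ptsOff] at ht hu
  obtain ⟨A, hA, hA3⟩ := Finset.exists_subset_card_eq (by lia : 3 ≤ (ptsOn S Q).card)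
  have hB3 : (ptsOn S Q \ A).card = 3 := by
    have := Finset.card_sdiff_add_card_eq_card hA
    lia
  have hex : ∀ B ⊆ ptsOn S Q, B.card = 3 →
      ∃ Q', IsSmoothConic Q' ∧ On Q' t ∧ On Q' u ∧ ∀ p ∈ B.toList, On Q' p := by
    intro B hB hB3
    have htB : t ∉ B := fun h => ht.2 (mem_ptsOn.1 (hB h)).2
    have huB : u ∉ B := fun h => hu.2 (mem_ptsOn.1 (hB h)).2
    obtain ⟨Q', hQ', h⟩ := exists_isSmoothConic_of_card_eq (A := insert t (insert u B)) hS
      (fun p hp => by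
        simp only [Finset.mem_insert] at hp
        rcases hp with rfl | rfl | hp
        exacts [ht.1, hu.1, (mem_ptsOn.1 (hB hp)).1]) (by
        rw [Finset.card_insert_of_notMem, Finset.card_insert_of_notMem huB, hB3]
        simp [htu, htB])
    exact ⟨Q', hQ', h t (by simp), h u (by simp), fun p hp => h p (by simp_all)⟩
  obtain ⟨Q₁, h₁, h₁t, h₁u, ho₁⟩ := hex A hA hA3
  obtain ⟨Q₂, h₂, h₂t, h₂u, ho₂⟩ := hex _ Finset.sdiff_subset hB3
  have hmem : ∀ p ∈ A.toList ++ (ptsOn S Q \ A).toList, p ∈ ptsOn S Q := fun p hp => by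
    rcases List.mem_append.1 hp with hp | hp
    exacts [hA (Finset.mem_toList.1 hp), (Finset.mem_sdiff.1 (Finset.mem_toList.1 hp)).1]
  refine hZ.false_of_conic_six hQ h₁ h₂ (List.Nodup.append A.nodup_toList (Finset.nodup_toList _)
    fun p hp hp' => ?_) (by simpa) (by simpa) (fun p hp => (mem_ptsOn.1 (hmem p hp)).2)
    (fun p hp => hSZ (mem_ptsOn.1 (hmem p hp)).1) (hSZ ht.1) (hSZ hu.1) htu ht.2 hu.2 h₁t h₁u h₂t
    h₂u ho₁ ho₂
  exact (Finset.mem_sdiff.1 (Finset.mem_toList.1 hp')).2 (Finset.mem_toList.1 hp)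

/-- Nine points not on a smooth conic, eight of which have no three collinear. -/
lemma IsSmall.false_of_general_eight {Z S : Finset Plane}
    (hZ : IsSmall (Z : Set Plane)) (hSZ : S ⊆ Z) (hcard : S.card = 8)
    (hS : ∀ N, IsLine N → (ptsOn S N).card ≤ 2)
    (hconic : ∀ Q, IsSmoothConic Q → ∃ p ∈ Z, ¬ On Q p) : False := by
  classical
  have hle : ∀ Q, IsSmoothConic Q → (ptsOn S Q).card ≤ 5 := by
    intro Q hQ
    have hadd := card_ptsOn_add_card_ptsOff S Q
    by_contra! h5
    rcases (by lia : (ptsOn S Q).card = 6 ∨ (ptsOn S Q).card = 7 ∨ (ptsOn S Q).card = 8) with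
      h | h | h
    · exact hZ.false_of_card_ptsOn_conic_eq_six hSZ hcard hS hQ h
    · exact hZ.false_of_card_ptsOn_conic_eq_seven hSZ hcard hS hQ h
    · obtain ⟨t, ht, hQt⟩ := hconic Q hQ
      obtain ⟨s, hs⟩ := Finset.card_pos.1 (by lia : 0 < (ptsOn S Q).card)
      have hts : t ≠ s := fun h => hQt (h ▸ (mem_ptsOn.1 hs).2)
      obtain ⟨N, hN, hNt, -⟩ := exists_isLine_on hts
      exact hZ.false_of_conic_eight hQ hN (ptsOn S Q).nodup_toList (by simpa)
        (fun p hp => (mem_ptsOn.1 (Finset.mem_toList.1 hp)).2)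
        (fun p hp => hSZ (mem_ptsOn.1 (Finset.mem_toList.1 hp)).1) ht hQt hNt
  have heq : ∀ A ⊆ S, A.card = 5 → ∀ Q, IsSmoothConic Q → (∀ p ∈ A, On Q p) → ptsOn S Q = A := by
    intro A hA hA5 Q hQ h
    refine (Finset.eq_of_subset_of_card_le (fun p hp => mem_ptsOn.2 ⟨hA hp, h p hp⟩) ?_).symm
    rw [hA5]
    exact hle Q hQ
  obtain ⟨A, hA, hA5⟩ := Finset.exists_subset_card_eq (by lia : 5 ≤ S.card)
  obtain ⟨C, hC, hC2⟩ := Finset.exists_subset_card_eq (by lia : 2 ≤ A.card)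
  have hB : S \ A ∪ C ⊆ S := Finset.union_subset Finset.sdiff_subset (hC.trans hA)
  have hdisj : Disjoint (S \ A) C := Finset.sdiff_disjoint.mono_right hC
  have hB5 : (S \ A ∪ C).card = 5 := by
    have := Finset.card_sdiff_add_card_eq_card hA
    rw [Finset.card_union_of_disjoint hdisj]
    lia
  obtain ⟨Q₁, h₁, ho₁⟩ := exists_isSmoothConic_of_card_eq hS hA hA5
  obtain ⟨Q₂, h₂, ho₂⟩ := exists_isSmoothConic_of_card_eq hS hB hB5
  have e₁ := heq A hA hA5 Q₁ h₁ ho₁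
  have e₂ := heq _ hB hB5 Q₂ h₂ ho₂
  refine hZ.false_of_two_conics h₁ h₂ A.nodup_toList (S \ A ∪ C).nodup_toList (by simpa)
    (by simpa) (fun p hp => ho₁ p (Finset.mem_toList.1 hp))
    (fun p hp => ho₂ p (Finset.mem_toList.1 hp)) (fun p hp => hSZ (hA (Finset.mem_toList.1 hp)))
    (fun p hp => hSZ (hB (Finset.mem_toList.1 hp))) ?_ ?_ <;> rw [countOn_toList] <;>
    refine (Finset.card_le_card (t := C) fun p hp => ?_).trans (by lia)
  · rw [mem_ptsOn] at hp
    have : p ∈ A := e₁ ▸ mem_ptsOn.2 ⟨hB hp.1, hp.2⟩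
    simp_all
  · rw [mem_ptsOn] at hp
    have : p ∈ S \ A ∪ C := e₂ ▸ mem_ptsOn.2 ⟨hA hp.1, hp.2⟩
    simp_all

/-- A set of exactly `9` points of `ℙ²`, not contained in a conic and with Waldschmidt constant
less than `5/2`, forms the configuration with a line containing exactly six of the points. -/
theorem nine_points_small_waldschmidt (Z : Set (ℙ ℂ (Fin 3 → ℂ)))
    (hfin : Z.Finite) (hcard : Z.ncard = 9) (hconic : ¬ ContainedInConic Z)
    (h : waldschmidt Z < 5 / 2) :
    StandardConfig 6 Z := by
  classical
  have hsmall := isSmall_of_waldschmidt_lt hfin h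
  lift Z to Finset (ℙ ℂ (Fin 3 → ℂ)) using hfin
  rw [Set.ncard_coe_finset] at hcard
  have hquadric : ∀ F : TernaryPoly, F ≠ 0 → F.IsHomogeneous 2 → ∃ p ∈ Z, ¬ On F p := by
    intro F hF0 hF
    by_contra! hall
    exact hconic ⟨F, hF0, hF, fun p hp => (memLine_iff_on hF p).2 (hall p hp)⟩
  by_cases h4 : ∃ L, IsLine L ∧ 4 ≤ (ptsOn Z L).card
  · obtain ⟨L, hL, h4⟩ := h4
    refine hsmall.standardConfig_of_line_four hcard (fun L M hL hM => ?_) hL h4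
    obtain ⟨p, hp, hne⟩ := hquadric (L * M) (mul_ne_zero hL.1 hM.1) (hL.2.mul hM.2)
    simp only [On, map_mul, mul_eq_zero, not_or] at hne
    exact ⟨p, hp, hne⟩
  · push Not at h4
    obtain ⟨t, ht, hS⟩ := hsmall.exists_erase_card_ptsOn_le hcard fun N hN =>
      Nat.le_of_lt_succ (h4 N hN)
    exact (hsmall.false_of_general_eight (Finset.erase_subset t Z)
      (by rw [Finset.card_erase_of_mem ht, hcard]) hS
      fun Q hQ => hquadric Q hQ.ne_zero hQ.isHomogeneous).elim
end

section
/- Let Z be a set of 9 points in the complex projective plane ℙ² forming the following configuration: a line ℓ containing exactly six of the points, among them three points Q₁, Q₂, C; a point P not on ℓ; a point A on the line PQ₁ with A ∉ {P, Q₁} and A ∉ ℓ; a point B on the line PQ₂ with B ∉ {P, Q₂} and B ∉ ℓ; the points A, B, C are collinear; and the only triples of collinear points among the nine are those contained in ℓ, in the line through P, Q₁, A, in the line through P, Q₂, B, and in the line through A, B, C. Then the Waldschmidt constant of the radical ideal I of Z equals α̂(I) = 17/7. -/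
open scoped LinearAlgebra.Projectivization

namespace NinePoints

open MvPolynomial Polynomial

/-- The coordinate ring of the plane, `ℂ[x₀, x₁, x₂]`. -/
abbrev R : Type := MvPolynomial (Fin 3) ℂ

section Taylor

/-- The Taylor expansion `F(v + T x)` of `F` at `v` in a generic direction `x`, as a polynomial in
`T` with coefficients in `ℂ[x₀, x₁, x₂]`. -/
noncomputable def taylorAt (v : Fin 3 → ℂ) : R →ₐ[ℂ] R[X] :=
  MvPolynomial.aeval fun i =>
    Polynomial.C (MvPolynomial.C (v i)) + Polynomial.X * Polynomial.C (MvPolynomial.X i)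

@[simp]
lemma taylorAt_X (v : Fin 3 → ℂ) (i : Fin 3) : taylorAt v (MvPolynomial.X i) =
    Polynomial.C (MvPolynomial.C (v i)) + Polynomial.X * Polynomial.C (MvPolynomial.X i) := by
  simp [taylorAt]

@[simp]
lemma taylorAt_C (v : Fin 3 → ℂ) (a : ℂ) :
    taylorAt v (MvPolynomial.C a) = Polynomial.C (MvPolynomial.C a) := by
  simp [taylorAt]

lemma coeff_zero_taylorAt (v : Fin 3 → ℂ) (F : R) :
    (taylorAt v F).coeff 0 = MvPolynomial.C (MvPolynomial.eval v F) := by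
  induction F using MvPolynomial.induction_on with
  | C a => simp
  | add p q hp hq => simp [hp, hq]
  | mul_X p i hp => simp [hp, mul_coeff_zero]

lemma derivative_taylorAt (v : Fin 3 → ℂ) (F : R) :
    derivative (taylorAt v F) =
      ∑ i, Polynomial.C (MvPolynomial.X i) * taylorAt v (pderiv i F) := by
  induction F using MvPolynomial.induction_on with
  | C a => simp
  | add p q hp hq => simp [hp, hq, mul_add, Finset.sum_add_distrib]
  | mul_X p j hp =>
    simp only [map_mul, derivative_mul, hp, Derivation.leibniz, map_add, smul_eq_mul, mul_add,
      Finset.sum_add_distrib, pderiv_X]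
    rw [add_comm]
    congr 1
    · rw [Finset.sum_eq_single j] <;> simp +contextual [mul_comm (taylorAt v p)]
    · rw [Finset.sum_mul]
      exact Finset.sum_congr rfl fun i _ => by ring

lemma pderiv_coeff_taylorAt (v : Fin 3 → ℂ) (i : Fin 3) (F : R) (n : ℕ) :
    pderiv i ((taylorAt v F).coeff n) = (Polynomial.X * taylorAt v (pderiv i F)).coeff n := by
  induction F using MvPolynomial.induction_on generalizing n with
  | C a => cases n <;> simp [Polynomial.coeff_C]
  | add p q hp hq => simp [hp, hq, mul_add]
  | mul_X p j hp =>
    rcases n with _ | n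
    · simp [coeff_zero_taylorAt, mul_coeff_zero]
    · have h1 := hp (n + 1)
      have h0 := hp n
      simp only [Polynomial.coeff_X_mul] at h1
      have e : ∀ f : R[X], f * taylorAt v (MvPolynomial.X j) =
          f * Polynomial.C (MvPolynomial.C (v j)) +
            Polynomial.X * (f * Polynomial.C (MvPolynomial.X j)) := fun f => by
        rw [taylorAt_X]; ring
      have e' : taylorAt v (pderiv i (p * MvPolynomial.X j)) =
          taylorAt v (pderiv i p) * taylorAt v (MvPolynomial.X j) +
            taylorAt v p * Polynomial.C (pderiv i (MvPolynomial.X j)) := by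
        rw [Derivation.leibniz, smul_eq_mul, smul_eq_mul, map_add, map_mul, map_mul, add_comm,
          mul_comm (taylorAt v (MvPolynomial.X j))]
        congr 2
        by_cases h : i = j
        · subst h; simp
        · simp [pderiv_X, Ne.symm h]
      rw [Polynomial.coeff_X_mul, e', map_mul, e, e]
      simp only [Polynomial.coeff_add, Polynomial.coeff_mul_C, Polynomial.coeff_X_mul, map_add,
        Derivation.leibniz, smul_eq_mul, h1, h0, pderiv_C, mul_zero, zero_add]
      rcases n with _ | n <;> simp [mul_coeff_zero] <;> ring

lemma vanishesToOrder_succ_iff (m : ℕ) (F : R) (v : Fin 3 → ℂ) :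
    VanishesToOrder (m + 1) F v ↔
      MvPolynomial.eval v F = 0 ∧ ∀ i, VanishesToOrder m (pderiv i F) v := by
  constructor
  · refine fun h => ⟨by simpa using h 0 (by lia) Fin.elim0, fun i k hk d => ?_⟩
    simpa [List.ofFn_succ] using h (k + 1) (by lia) (Fin.cons i d)
  · rintro ⟨h0, h⟩ (_ | k) hk d
    · simpa using h0
    · simpa [List.ofFn_succ] using h (d 0) k (by lia) fun i => d i.succ

lemma vanishesToOrder_iff (m : ℕ) (F : R) (v : Fin 3 → ℂ) :
    VanishesToOrder m F v ↔ Polynomial.X ^ m ∣ taylorAt v F := by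
  induction m generalizing F with
  | zero => simp [VanishesToOrder]
  | succ m ih =>
    simp only [vanishesToOrder_succ_iff, ih, Polynomial.X_pow_dvd_iff]
    constructor
    · rintro ⟨h0, h⟩ (_ | n) hn
      · simp [coeff_zero_taylorAt, h0]
      · have := congrArg (Polynomial.coeff · n) (derivative_taylorAt v F)
        simp only [Polynomial.coeff_derivative, Polynomial.finsetSum_coeff,
          Polynomial.coeff_C_mul] at this
        rw [Finset.sum_eq_zero fun i _ => by rw [h i n (by lia), mul_zero]] at this
        exact (mul_eq_zero.1 this).resolve_right (by exact_mod_cast n.succ_ne_zero)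
    · refine fun h => ⟨?_, fun i n hn => ?_⟩
      · simpa [coeff_zero_taylorAt] using h 0 (by lia)
      · simpa [h (n + 1) (by lia)] using (pderiv_coeff_taylorAt v i F (n + 1)).symm

end Taylor

section Multiplicity

/-- `F` vanishes to order at least `m` at every nonzero multiple of `w`. -/
def VanishesAlong (m : ℕ) (F : R) (w : Fin 3 → ℂ) : Prop :=
  ∀ c : ℂ, c ≠ 0 → (Polynomial.X : R[X]) ^ m ∣ taylorAt (c • w) F

lemma eval_smul_of_isHomogeneous {q : R} {e : ℕ} (hq : q.IsHomogeneous e) (c : ℂ)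
    (v : Fin 3 → ℂ) : MvPolynomial.eval (c • v) q = c ^ e * MvPolynomial.eval v q := by
  rw [MvPolynomial.eval_eq, MvPolynomial.eval_eq, Finset.mul_sum]
  refine Finset.sum_congr rfl fun d hd => ?_
  have h : ∑ i ∈ d.support, d i = e := by
    have := hq (mem_support_iff.1 hd)
    simpa [Finsupp.weight_apply, Finsupp.sum] using this
  simp only [Pi.smul_apply, smul_eq_mul, mul_pow, Finset.prod_mul_distrib,
    Finset.prod_pow_eq_pow_sum, h]
  ring

lemma X_dvd_taylorAt_iff (v : Fin 3 → ℂ) (F : R) :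
    Polynomial.X ∣ taylorAt v F ↔ MvPolynomial.eval v F = 0 := by
  simp [Polynomial.X_dvd_iff, coeff_zero_taylorAt]

lemma not_X_sq_dvd_taylorAt {v : Fin 3 → ℂ} {F : R} {i : Fin 3}
    (h : MvPolynomial.eval v (pderiv i F) ≠ 0) : ¬ Polynomial.X ^ 2 ∣ taylorAt v F := by
  rw [← vanishesToOrder_iff, vanishesToOrder_succ_iff]
  refine fun H => h ?_
  simpa using (vanishesToOrder_succ_iff 0 _ _).1 (H.2 i) |>.1

lemma VanishesAlong.of_mul_of_eval_ne_zero {m e : ℕ} {q G : R} {w : Fin 3 → ℂ}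
    (hq : q.IsHomogeneous e) (hw : MvPolynomial.eval w q ≠ 0)
    (h : VanishesAlong m (q * G) w) : VanishesAlong m G w := fun c hc => by
  refine Polynomial.prime_X.pow_dvd_of_dvd_mul_left m ?_ (map_mul (taylorAt (c • w)) q G ▸ h c hc)
  rw [X_dvd_taylorAt_iff, eval_smul_of_isHomogeneous hq]
  exact mul_ne_zero (pow_ne_zero _ hc) hw

lemma VanishesAlong.of_mul_of_pderiv_ne_zero {m e : ℕ} {q G : R} {w : Fin 3 → ℂ} {i : Fin 3}
    (hq : q.IsHomogeneous e) (hw : MvPolynomial.eval w (pderiv i q) ≠ 0)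
    (h : VanishesAlong m (q * G) w) : VanishesAlong (m - 1) G w := fun c hc => by
  rcases m with _ | m
  · simp
  have h := map_mul (taylorAt (c • w)) q G ▸ h c hc
  have hsq : ¬ Polynomial.X ^ 2 ∣ taylorAt (c • w) q := not_X_sq_dvd_taylorAt (i := i) <| by
    rw [eval_smul_of_isHomogeneous hq.pderiv]
    exact mul_ne_zero (pow_ne_zero _ hc) hw
  by_cases hd : Polynomial.X ∣ taylorAt (c • w) q
  · obtain ⟨f, hf⟩ := hd
    rw [hf, pow_succ', mul_assoc, mul_dvd_mul_iff_left Polynomial.X_ne_zero] at h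
    refine Polynomial.prime_X.pow_dvd_of_dvd_mul_left m (fun hX => hsq ?_) h
    rw [hf, sq]
    exact mul_dvd_mul_left _ hX
  · exact (pow_dvd_pow _ (Nat.le_succ m)).trans
      (Polynomial.prime_X.pow_dvd_of_dvd_mul_left _ hd h)

end Multiplicity

section Bezout

/-- Pulling back along a parametrized curve preserves the order of vanishing. -/
lemma pow_dvd_aeval_of_dvd_taylorAt {m : ℕ} {F : R} {v : Fin 3 → ℂ} {φ : Fin 3 → ℂ[X]} {t : ℂ}
    (hv : ∀ i, (φ i).eval t = v i) (h : Polynomial.X ^ m ∣ taylorAt v F) :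
    (Polynomial.X - Polynomial.C t) ^ m ∣ MvPolynomial.aeval φ F := by
  choose ψ hψ using fun i => Polynomial.X_sub_C_dvd_sub_C_eval (a := t) (p := φ i)
  let Θ : R[X] →+* ℂ[X] := Polynomial.eval₂RingHom
    (MvPolynomial.aeval ψ : R →ₐ[ℂ] ℂ[X]).toRingHom (Polynomial.X - Polynomial.C t)
  have hΘ : (Θ.comp (taylorAt v).toRingHom) = (MvPolynomial.aeval φ).toRingHom := by
    refine MvPolynomial.ringHom_ext (fun a => by simp [Θ]) fun i => ?_
    have := hψ i
    rw [hv, sub_eq_iff_eq_add'] at this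
    simp [Θ, this, mul_comm (ψ i)]
  have h' := map_dvd Θ h
  rw [map_pow] at h'
  convert h' using 1
  · simp [Θ]
  · exact (congrArg (fun f => f F) hΘ).symm

/-- A curve `q = 0` parametrized by `φ` away from `H = 0` divides every `F` whose orders of
vanishing along it exceed the product of the degrees. -/
lemma dvd_of_mul_totalDegree_lt {ι : Type*} {q H : R} (hq : Prime q) {x : Fin 3 → ℂ}
    (hxq : MvPolynomial.eval x q = 0) (hxH : MvPolynomial.eval x H ≠ 0)
    {φ : Fin 3 → ℂ[X]} {e : ℕ} (hφ : ∀ i, (φ i).natDegree ≤ e)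
    (hcov : ∀ v, MvPolynomial.eval v q = 0 → MvPolynomial.eval v H ≠ 0 →
      ∃ c : ℂ, c ≠ 0 ∧ ∃ t, ∀ i, v i = c * (φ i).eval t)
    {J : Finset ι} {pt : ι → Fin 3 → ℂ} {t : ι → ℂ} (ht : Set.InjOn t J)
    (hpt : ∀ j ∈ J, ∃ c : ℂ, c ≠ 0 ∧ ∀ i, (φ i).eval (t j) = c * pt j i)
    {F : R} {n : ι → ℕ} (hF : ∀ j ∈ J, VanishesAlong (n j) F (pt j))
    (hlt : e * F.totalDegree < ∑ j ∈ J, n j) : q ∣ F := by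
  have hzero : ∀ c : ℂ, c ≠ 0 →
      MvPolynomial.aeval (fun i => Polynomial.C c * φ i) F = 0 := fun c hc => by
    have hdvd : ∏ j ∈ J, (Polynomial.X - Polynomial.C (t j)) ^ n j ∣
        MvPolynomial.aeval (fun i => Polynomial.C c * φ i) F := by
      refine Finset.prod_dvd_of_coprime (fun a ha b hb hab => ?_) fun j hj => ?_
      · exact (Polynomial.isCoprime_X_sub_C_of_isUnit_sub
          (sub_ne_zero.2 fun h => hab (ht ha hb h)).isUnit).pow
      · obtain ⟨c', hc', hj'⟩ := hpt j hj
        refine pow_dvd_aeval_of_dvd_taylorAt (v := (c * c') • pt j) (fun i => ?_)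
          (hF j hj _ (mul_ne_zero hc hc'))
        simp [hj', mul_assoc]
    refine Polynomial.eq_zero_of_dvd_of_natDegree_lt hdvd ?_
    rw [Polynomial.natDegree_prod_of_monic _ _
      fun j _ => (Polynomial.monic_X_sub_C _).pow _]
    simp only [(Polynomial.monic_X_sub_C _).natDegree_pow, Polynomial.natDegree_X_sub_C, mul_one]
    refine lt_of_le_of_lt ?_ hlt
    rw [mul_comm]
    exact MvPolynomial.aeval_natDegree_le F le_rfl _
      fun i => (Polynomial.natDegree_C_mul_le _ _).trans (hφ i)
  have hvan : ∀ v, MvPolynomial.eval v q = 0 → MvPolynomial.eval v (F * H) = 0 := fun v hv => by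
    by_cases hH : MvPolynomial.eval v H = 0
    · simp [hH]
    obtain ⟨c, hc, s, hs⟩ := hcov v hv hH
    have h := congrArg (Polynomial.eval s) (hzero c hc)
    have e : Polynomial.eval s (MvPolynomial.aeval (fun i => Polynomial.C c * φ i) F) =
        MvPolynomial.eval v F := by
      rw [← MvPolynomial.aeval_eq_eval, ← Polynomial.coe_aeval_eq_eval]
      change ((Polynomial.aeval s).comp (MvPolynomial.aeval fun i => Polynomial.C c * φ i)) F = _
      congr 1
      ext i
      simp [hs]
    rw [e, Polynomial.eval_zero] at h
    simp [h]
  have hmem : F * H ∈ Ideal.span {q} := by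
    have := (Ideal.span_singleton_prime hq.ne_zero).2 hq
    rw [← MvPolynomial.IsPrime.vanishingIdeal_zeroLocus (K := ℂ) (Ideal.span {q})]
    intro v hv
    simpa [MvPolynomial.aeval_eq_eval] using hvan v (by
      simpa [MvPolynomial.aeval_eq_eval] using hv q (Ideal.mem_span_singleton_self q))
  refine (hq.dvd_or_dvd (Ideal.mem_span_singleton.1 hmem)).resolve_right ?_
  rintro ⟨G, rfl⟩
  simp [hxq] at hxH

end Bezout

section Curves

/-- A curve `q = 0` of degree `e` passing, with smooth points, through exactly the points `pt j`
with `j ∈ J`, and satisfying Bézout's theorem with respect to these points. -/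
structure Curve {ι : Type*} (pt : ι → Fin 3 → ℂ) where
  q : R
  e : ℕ
  J : Finset ι
  ne_zero : q ≠ 0
  e_pos : 0 < e
  isHomogeneous : q.IsHomogeneous e
  eval_eq_zero : ∀ j ∈ J, MvPolynomial.eval (pt j) q = 0
  smooth : ∀ j ∈ J, ∃ i, MvPolynomial.eval (pt j) (pderiv i q) ≠ 0
  eval_ne_zero : ∀ j ∉ J, MvPolynomial.eval (pt j) q ≠ 0
  bezout : ∀ (F : R) (n : ι → ℕ), (∀ j, VanishesAlong (n j) F (pt j)) →
    e * F.totalDegree < ∑ j ∈ J, n j → q ∣ F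

variable {ι κ : Type*} {pt : ι → Fin 3 → ℂ}

/-- If the class with degree `N` and multiplicities `wt` is nonnegative on all curves `Γ k` and on
all classes which are nonnegative on the `Γ k`, then it is nonnegative on all plane curves. -/
theorem sum_mul_le_mul_totalDegree [Fintype ι] [DecidableEq ι] (Γ : κ → Curve pt) (wt : ι → ℕ)
    (N : ℕ)
    (hwt : ∀ k, ∑ j ∈ (Γ k).J, wt j ≤ N * (Γ k).e)
    (hnef : ∀ (n : ι → ℕ) (d : ℕ), (∀ k, ∑ j ∈ (Γ k).J, n j ≤ (Γ k).e * d) →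
      ∑ j, wt j * n j ≤ N * d)
    (F : R) (hF : F ≠ 0) (n : ι → ℕ) (hn : ∀ j, VanishesAlong (n j) F (pt j)) :
    ∑ j, wt j * n j ≤ N * F.totalDegree := by
  induction hd : F.totalDegree using Nat.strong_induction_on generalizing F n with
  | _ d ih =>
  subst hd
  by_cases hk : ∀ k, ∑ j ∈ (Γ k).J, n j ≤ (Γ k).e * F.totalDegree
  · exact hnef n _ hk
  push Not at hk
  obtain ⟨k, hk⟩ := hk
  obtain ⟨G, rfl⟩ := (Γ k).bezout F n hn hk
  have hG : G ≠ 0 := right_ne_zero_of_mul hF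
  have hdeg : ((Γ k).q * G).totalDegree = (Γ k).e + G.totalDegree := by
    rw [MvPolynomial.totalDegree_mul_of_isDomain (Γ k).ne_zero hG,
      (Γ k).isHomogeneous.totalDegree (Γ k).ne_zero]
  have hpos := (Γ k).e_pos
  have key := ih G.totalDegree (by lia) G hG (fun j => if j ∈ (Γ k).J then n j - 1 else n j)
    (fun j => by
      split_ifs with hj
      · obtain ⟨i, hi⟩ := (Γ k).smooth j hj
        exact (hn j).of_mul_of_pderiv_ne_zero (Γ k).isHomogeneous hi
      · exact (hn j).of_mul_of_eval_ne_zero (Γ k).isHomogeneous ((Γ k).eval_ne_zero j hj)) rfl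
  rw [hdeg, mul_add]
  calc ∑ j, wt j * n j
      ≤ ∑ j, ((if j ∈ (Γ k).J then wt j else 0) +
          wt j * if j ∈ (Γ k).J then n j - 1 else n j) := by
        refine Finset.sum_le_sum fun j _ => ?_
        split_ifs
        · calc wt j * n j ≤ wt j * (1 + (n j - 1)) := Nat.mul_le_mul_left _ (by lia)
            _ = _ := by ring
        · lia
    _ ≤ N * (Γ k).e + N * G.totalDegree := by
        rw [Finset.sum_add_distrib, Finset.sum_ite_mem, Finset.univ_inter]
        exact add_le_add (hwt k) key

/-- A product of powers of curves vanishes at each point to order at least the sum of the exponents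
of the curves through it. -/
theorem vanishesAlong_prod [Fintype κ] [DecidableEq ι] (Γ : κ → Curve pt) (a : κ → ℕ) {m : ℕ}
    {j : ι} (hm : m ≤ ∑ k, if j ∈ (Γ k).J then a k else 0) :
    VanishesAlong m (∏ k, (Γ k).q ^ a k) (pt j) := fun c _ => by
  rw [map_prod]
  refine (pow_dvd_pow _ hm).trans ?_
  rw [← Finset.prod_pow_eq_pow_sum]
  refine Finset.prod_dvd_prod_of_dvd _ _ fun k _ => ?_
  split_ifs with hj
  · rw [map_pow]
    refine pow_dvd_pow_of_dvd ((X_dvd_taylorAt_iff _ _).2 ?_) _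
    rw [eval_smul_of_isHomogeneous (Γ k).isHomogeneous, (Γ k).eval_eq_zero j hj, mul_zero]
  · simp

end Curves

section Configuration

lemma prime_of_isHomogeneous_one {q : R} (hq : q.IsHomogeneous 1) (h0 : q ≠ 0) : Prime q := by
  refine (irreducible_of_totalDegree_eq_one (hq.totalDegree h0) fun x hx => ?_).prime
  obtain ⟨d, hd⟩ := MvPolynomial.ne_zero_iff.1 h0
  exact isUnit_of_dvd_unit (hx d) (Ne.isUnit hd)

/-- The four-line star configuration of `x₀x₁x₂(x₀ + x₁ + x₂) = 0`, together with the three further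
points `(1 : s i : -1 - s i)` of the line `x₀ + x₁ + x₂ = 0`. -/
def pt (s : Fin 3 → ℂ) : Fin 9 → Fin 3 → ℂ :=
  ![![1, 0, 0], ![0, 1, 0], ![0, 0, 1], ![1, -1, 0], ![1, 0, -1], ![0, 1, -1],
    ![1, s 0, -1 - s 0], ![1, s 1, -1 - s 1], ![1, s 2, -1 - s 2]]

set_option maxHeartbeats 1000000 in
/-- The side `x_k = 0` of the coordinate triangle. -/
noncomputable def side {s : Fin 3 → ℂ} (hs0 : ∀ i, s i ≠ 0) (hs1 : ∀ i, s i ≠ -1)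
    (k : Fin 3) : Curve (pt s) where
  q := MvPolynomial.X k
  e := 1
  J := ![{1, 2, 5}, {0, 2, 4}, {0, 1, 3}] k
  ne_zero := MvPolynomial.X_ne_zero k
  e_pos := one_pos
  isHomogeneous := MvPolynomial.isHomogeneous_X _ k
  eval_eq_zero j hj := by
    fin_cases k <;> fin_cases j <;> simp_all [pt]
  smooth j hj := ⟨k, by simp⟩
  eval_ne_zero j hj := by
    have h := fun i => sub_ne_zero.2 (hs1 i).symm
    fin_cases k <;> fin_cases j <;> simp_all [pt]
  bezout F n hF hlt := by
    refine dvd_of_mul_totalDegree_lt (H := MvPolynomial.X (k + 1) - MvPolynomial.X (k + 2))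
      (x := Pi.single (k + 1) 1) MvPolynomial.X_prime ?_ ?_
      (φ := ![![0, Polynomial.X, Polynomial.X - Polynomial.C 1],
        ![Polynomial.X - Polynomial.C 1, 0, Polynomial.X],
        ![Polynomial.X, Polynomial.X - Polynomial.C 1, 0]] k) ?_ ?_
      (t := ![![0, 1, 0, 0, 0, 2⁻¹, 0, 0, 0], ![0, 0, 1, 0, 2⁻¹, 0, 0, 0, 0],
        ![1, 0, 0, 2⁻¹, 0, 0, 0, 0, 0]] k) ?_ ?_ (fun j _ => hF j) hlt
    · fin_cases k <;> simp
    · fin_cases k <;> simp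
    · intro i
      fin_cases k <;> fin_cases i <;>
        first
        | exact natDegree_X_le
        | exact natDegree_X_sub_C_le 1
        | exact natDegree_zero.trans_le zero_le_one
    · intro v hv hH
      have h : v (k + 1) - v (k + 2) ≠ 0 := by simpa using hH
      refine ⟨v (k + 1) - v (k + 2), h, v (k + 1) / (v (k + 1) - v (k + 2)), fun i => ?_⟩
      fin_cases k <;> fin_cases i <;> simp_all <;> field_simp <;> ring
    · intro a ha b hb
      fin_cases k <;> simp at ha hb <;> rcases ha with rfl | rfl | rfl <;>
        rcases hb with rfl | rfl | rfl <;> simp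
    · intro j hj
      fin_cases k <;> simp at hj <;> rcases hj with rfl | rfl | rfl
      exacts [⟨1, by simp, fun i => by fin_cases i <;> simp [pt]⟩,
        ⟨-1, by simp, fun i => by fin_cases i <;> simp [pt]⟩,
        ⟨2⁻¹, by simp, fun i => by fin_cases i <;> (simp [pt]; try norm_num)⟩,
        ⟨-1, by simp, fun i => by fin_cases i <;> simp [pt]⟩,
        ⟨1, by simp, fun i => by fin_cases i <;> simp [pt]⟩,
        ⟨-2⁻¹, by simp, fun i => by fin_cases i <;> (simp [pt]; try norm_num)⟩,
        ⟨1, by simp, fun i => by fin_cases i <;> simp [pt]⟩,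
        ⟨-1, by simp, fun i => by fin_cases i <;> simp [pt]⟩,
        ⟨2⁻¹, by simp, fun i => by fin_cases i <;> (simp [pt]; try norm_num)⟩]

lemma exists_ne (s : Fin 3 → ℂ) : ∃ θ : ℂ, θ ≠ 0 ∧ θ ≠ -1 ∧ ∀ i, θ ≠ s i := by
  obtain ⟨θ, h⟩ := Infinite.exists_notMem_finset ({0, -1, s 0, s 1, s 2} : Finset ℂ)
  simp only [Finset.mem_insert, Finset.mem_singleton, not_or] at h
  refine ⟨θ, h.1, h.2.1, fun i => ?_⟩
  fin_cases i <;> simp_all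

set_option maxHeartbeats 1000000 in
/-- The line `x₀ + x₁ + x₂ = 0` containing six of the points. -/
noncomputable def mainLine {s : Fin 3 → ℂ} (hs0 : ∀ i, s i ≠ 0) (hs1 : ∀ i, s i ≠ -1)
    (hs : Function.Injective s) : Curve (pt s) where
  q := ∑ i, MvPolynomial.X i
  e := 1
  J := {3, 4, 5, 6, 7, 8}
  ne_zero h := by simpa [Fin.sum_univ_three] using congrArg (MvPolynomial.eval ![1, 0, 0]) h
  e_pos := one_pos
  isHomogeneous := MvPolynomial.IsHomogeneous.sum _ _ _ fun i _ => MvPolynomial.isHomogeneous_X _ i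
  eval_eq_zero j hj := by
    fin_cases j <;> simp_all [pt, Fin.sum_univ_three]
  smooth j hj := ⟨0, by simp [Fin.sum_univ_three, pderiv_X]⟩
  eval_ne_zero j hj := by
    fin_cases j <;> simp_all [pt, Fin.sum_univ_three]
  bezout F n hF hlt := by
    obtain ⟨θ, hθ0, hθ1, hθ⟩ := exists_ne s
    refine dvd_of_mul_totalDegree_lt
      (H := MvPolynomial.C θ * MvPolynomial.X 0 - MvPolynomial.X 1) (x := ![0, 1, -1])
      (prime_of_isHomogeneous_one
        (MvPolynomial.IsHomogeneous.sum _ _ _ fun i _ => MvPolynomial.isHomogeneous_X _ i)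
        fun h => by simpa [Fin.sum_univ_three] using congrArg (MvPolynomial.eval ![1, 0, 0]) h)
      ?_ ?_
      (φ := ![Polynomial.X, Polynomial.C θ * Polynomial.X - Polynomial.C 1,
        Polynomial.C 1 - Polynomial.C (1 + θ) * Polynomial.X]) ?_ ?_
      (t := fun j => (θ - ![0, 0, 0, -1, 0, θ, s 0, s 1, s 2] j)⁻¹) ?_ ?_ (fun j _ => hF j) hlt
    · simp [Fin.sum_univ_three]
    · simp
    · intro i
      fin_cases i
      · exact natDegree_X_le
      · change natDegree (Polynomial.C θ * Polynomial.X - Polynomial.C 1) ≤ 1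
        compute_degree
      · change natDegree (Polynomial.C 1 - Polynomial.C (1 + θ) * Polynomial.X) ≤ 1
        compute_degree
    · intro v hv hH
      obtain ⟨D, hD⟩ : ∃ D, D = θ * v 0 - v 1 := ⟨_, rfl⟩
      have h1 : v 1 = θ * v 0 - D := by rw [hD]; ring
      have h2 : v 2 = - v 0 - v 1 := by
        simp only [Fin.sum_univ_three, map_add, MvPolynomial.eval_X] at hv
        linear_combination hv
      have h : D ≠ 0 := by simpa [hD] using hH
      refine ⟨D, h, v 0 / D, fun i => ?_⟩
      fin_cases i <;> simp [h2, h1] <;> field_simp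
      ring
    · refine fun a ha b hb hab => ?_
      have hab := sub_right_injective (inv_injective hab)
      have h01 : s 0 ≠ s 1 := hs.ne (by decide)
      have h02 : s 0 ≠ s 2 := hs.ne (by decide)
      have h12 : s 1 ≠ s 2 := hs.ne (by decide)
      simp only [Finset.coe_insert, Finset.coe_singleton, Set.mem_insert_iff,
        Set.mem_singleton_iff] at ha hb
      rcases ha with rfl | rfl | rfl | rfl | rfl | rfl <;>
        rcases hb with rfl | rfl | rfl | rfl | rfl | rfl <;>
        simp [hs0, hs1, hθ, hθ0, hθ1, (hs0 _).symm, (hs1 _).symm, (hθ _).symm, hθ0.symm, hθ1.symm,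
          h01, h02, h12, h01.symm, h02.symm, h12.symm] at hab ⊢
    · intro j hj
      have hθ1' : θ + 1 ≠ 0 := fun h => hθ1 (by linear_combination h)
      have hθ' := fun i => sub_ne_zero.2 (hθ i)
      simp only [Finset.mem_insert, Finset.mem_singleton] at hj
      rcases hj with rfl | rfl | rfl | rfl | rfl | rfl
      · exact ⟨(θ + 1)⁻¹, by simpa, fun i => by
          fin_cases i <;> simp [pt] <;> field_simp <;> ring⟩
      · exact ⟨θ⁻¹, by simpa, fun i => by
          fin_cases i <;> simp [pt] <;> field_simp <;> ring⟩
      · exact ⟨-1, by simp, fun i => by fin_cases i <;> simp [pt]⟩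
      · exact ⟨(θ - s 0)⁻¹, by simpa using hθ' 0, fun i => by
          have := hθ' 0
          fin_cases i <;> simp [pt] <;> field_simp <;> ring⟩
      · exact ⟨(θ - s 1)⁻¹, by simpa using hθ' 1, fun i => by
          have := hθ' 1
          fin_cases i <;> simp [pt] <;> field_simp <;> ring⟩
      · exact ⟨(θ - s 2)⁻¹, by simpa using hθ' 2, fun i => by
          have := hθ' 2
          fin_cases i <;> simp [pt] <;> field_simp <;> ring⟩

end Configuration

section Conic

/-- The conic through the three coordinate points and the points `(1 : a : -1 - a)` and
`(1 : b : -1 - b)`. -/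
noncomputable def conicPoly (a b : ℂ) : R :=
  (MvPolynomial.C (a * b) * MvPolynomial.X 2 + MvPolynomial.C ((1 + a) * (1 + b)) *
    MvPolynomial.X 1) * MvPolynomial.X 0 + MvPolynomial.X 1 * MvPolynomial.X 2

lemma conicPoly_isHomogeneous (a b : ℂ) : (conicPoly a b).IsHomogeneous 2 := by
  have hX := MvPolynomial.isHomogeneous_X (σ := Fin 3) ℂ
  exact ((((hX 2).C_mul _).add ((hX 1).C_mul _)).mul (hX 0)).add ((hX 1).mul (hX 2))

@[simp]
lemma eval_conicPoly (a b : ℂ) (v : Fin 3 → ℂ) : MvPolynomial.eval v (conicPoly a b) =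
    (a * b * v 2 + (1 + a) * (1 + b) * v 1) * v 0 + v 1 * v 2 := by
  simp [conicPoly]

lemma eval_pderiv_one_conicPoly (a b : ℂ) (v : Fin 3 → ℂ) :
    MvPolynomial.eval v (pderiv 1 (conicPoly a b)) = (1 + a) * (1 + b) * v 0 + v 2 := by
  simp [conicPoly, Derivation.leibniz, pderiv_X]
  ring

lemma eval_pderiv_two_conicPoly (a b : ℂ) (v : Fin 3 → ℂ) :
    MvPolynomial.eval v (pderiv 2 (conicPoly a b)) = a * b * v 0 + v 1 := by
  simp [conicPoly, Derivation.leibniz, pderiv_X]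
  ring

variable {a b : ℂ}

lemma prime_conicPoly (ha0 : a ≠ 0) (ha1 : 1 + a ≠ 0) (hb0 : b ≠ 0) (hb1 : 1 + b ≠ 0) :
    Prime (conicPoly a b) := by
  have hX := MvPolynomial.isHomogeneous_X (σ := Fin 3) ℂ
  set f : R := MvPolynomial.C (a * b) * MvPolynomial.X 2 +
    MvPolynomial.C ((1 + a) * (1 + b)) * MvPolynomial.X 1 with hf
  have hf0 : f ≠ 0 := fun h => by
    have := congrArg (MvPolynomial.eval ![0, 0, 1]) h
    simp [hf, ha0, hb0] at this
  have hfp : Prime f := prime_of_isHomogeneous_one (((hX 2).C_mul _).add ((hX 1).C_mul _)) hf0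
  have hsup : ∀ i : Fin 3, i ≠ 0 → (0 : Fin 3) ∉ (MvPolynomial.X i : R).vars := fun i hi => by
    simpa [MvPolynomial.vars_X] using hi.symm
  refine (MvPolynomial.irreducible_mul_X_add f _ 0 hf0 (fun h => ?_) (fun h => ?_) ?_).prime
  · rcases Finset.mem_union.1 (MvPolynomial.vars_add_subset _ _ h) with h | h
    · rw [MvPolynomial.vars_C_mul _ (mul_ne_zero ha0 hb0)] at h
      exact hsup 2 (by decide) h
    · rw [MvPolynomial.vars_C_mul _ (mul_ne_zero ha1 hb1)] at h
      exact hsup 1 (by decide) h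
  · rcases Finset.mem_union.1 (MvPolynomial.vars_mul _ _ h) with h | h <;>
      exact hsup _ (by decide) h
  · refine (hfp.irreducible.isRelPrime_iff_not_dvd).2 ?_
    rintro ⟨G, hG⟩
    have := congrArg (MvPolynomial.eval ![0, a * b, -((1 + a) * (1 + b))]) hG
    simp only [hf, map_add, map_mul, MvPolynomial.eval_X, MvPolynomial.eval_C,
      Matrix.cons_val] at this
    exact mul_ne_zero (mul_ne_zero ha0 hb0) (mul_ne_zero ha1 hb1) (by linear_combination -this)

/-- The five points on `conicPoly a b`. -/
def conicPt (a b : ℂ) : Fin 5 → Fin 3 → ℂ :=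
  ![![1, 0, 0], ![0, 1, 0], ![0, 0, 1], ![1, a, -1 - a], ![1, b, -1 - b]]

lemma conicPoly_dvd (ha0 : a ≠ 0) (ha1 : 1 + a ≠ 0) (hb0 : b ≠ 0) (hb1 : 1 + b ≠ 0)
    (hab : a ≠ b) {F : R} {n : Fin 5 → ℕ} (hF : ∀ j, VanishesAlong (n j) F (conicPt a b j))
    (hlt : 2 * F.totalDegree < ∑ j, n j) : conicPoly a b ∣ F := by
  obtain ⟨θ, hθ0, hθ1, hθ⟩ := exists_ne ![a, b, b]
  have hθa : θ - a ≠ 0 := sub_ne_zero.2 (hθ 0)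
  have hθb : θ - b ≠ 0 := sub_ne_zero.2 (hθ 1)
  have hθ1' : θ + 1 ≠ 0 := fun h => hθ1 (by linear_combination h)
  have ha1' : a ≠ -1 := fun h => ha1 (by linear_combination h)
  have hb1' : b ≠ -1 := fun h => hb1 (by linear_combination h)
  refine dvd_of_mul_totalDegree_lt (x := ![1, a, -1 - a])
    (H := MvPolynomial.X 0 * MvPolynomial.X 1 * MvPolynomial.X 2 *
      (MvPolynomial.C θ * MvPolynomial.X 1 - MvPolynomial.C (a * b) * MvPolynomial.X 0))
    (prime_conicPoly ha0 ha1 hb0 hb1) ?_ ?_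
    (φ := ![- ((Polynomial.C θ * Polynomial.X - Polynomial.C 1) *
        (Polynomial.C (1 + θ) * Polynomial.X - Polynomial.C 1)),
      Polynomial.C (-(a * b)) * Polynomial.X *
        (Polynomial.C (1 + θ) * Polynomial.X - Polynomial.C 1),
      Polynomial.C ((1 + a) * (1 + b)) * Polynomial.X *
        (Polynomial.C θ * Polynomial.X - Polynomial.C 1)]) ?_ ?_
    (t := fun j => (θ - ![θ, 0, -1, b, a] j)⁻¹) (J := Finset.univ) (pt := conicPt a b) ?_ ?_
    (fun j _ => hF j) hlt
  · simp; ring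
  · have h1 : -1 - a ≠ 0 := fun h => ha1 (by linear_combination -h)
    have h2 : θ * a - a * b ≠ 0 := by
      rw [mul_comm, ← mul_sub]
      exact mul_ne_zero ha0 hθb
    simpa using ⟨⟨ha0, h1⟩, h2⟩
  · intro i
    fin_cases i
    · change natDegree (- ((Polynomial.C θ * Polynomial.X - Polynomial.C 1) *
        (Polynomial.C (1 + θ) * Polynomial.X - Polynomial.C 1))) ≤ 2
      compute_degree
    · change natDegree (Polynomial.C (-(a * b)) * Polynomial.X *
        (Polynomial.C (1 + θ) * Polynomial.X - Polynomial.C 1)) ≤ 2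
      compute_degree
    · change natDegree (Polynomial.C ((1 + a) * (1 + b)) * Polynomial.X *
        (Polynomial.C θ * Polynomial.X - Polynomial.C 1)) ≤ 2
      compute_degree
  · intro v hv hH
    rw [eval_conicPoly] at hv
    simp only [map_mul, map_sub, MvPolynomial.eval_X, MvPolynomial.eval_C, mul_ne_zero_iff] at hH
    obtain ⟨⟨⟨h0, h1⟩, h2⟩, hD⟩ := hH
    refine ⟨v 2 * (θ * v 1 - a * b * v 0) ^ 2 / (a * b * ((1 + a) * (1 + b)) * v 0 * v 1),
      by simp_all, v 1 / (θ * v 1 - a * b * v 0), fun i => ?_⟩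
    set D := θ * v 1 - a * b * v 0 with hDdef
    fin_cases i
    · simp
      field_simp
      rw [hDdef]
      linear_combination a * b * v 0 * hv
    · simp
      field_simp
      rw [hDdef]
      linear_combination hv
    · simp
      field_simp
      rw [hDdef]
      ring
  · refine fun i _ j _ hij => ?_
    have hij := sub_right_injective (inv_injective hij)
    have ha : θ ≠ a := hθ 0
    have hb : θ ≠ b := hθ 1
    fin_cases i <;> fin_cases j <;>
      simp [ha, hb, hθ0, hθ1, ha0, hb0, ha1', hb1', hab, ha.symm, hb.symm, hθ0.symm, hθ1.symm,
        ha0.symm, hb0.symm, ha1'.symm, hb1'.symm, hab.symm] at hij ⊢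
  · intro j _
    fin_cases j
    · exact ⟨-1, by simp, fun i => by fin_cases i <;> simp [conicPt]⟩
    · exact ⟨-(a * b) / θ ^ 2, by simp_all, fun i => by
        fin_cases i <;> simp [conicPt] <;> field_simp <;> first | ring1 | (ring_nf; simp)⟩
    · exact ⟨-((1 + a) * (1 + b)) / (θ + 1) ^ 2, by simp_all, fun i => by
        fin_cases i <;> simp [conicPt] <;> field_simp <;> first | ring1 | (ring_nf; simp)⟩
    · exact ⟨-(b * (1 + b)) / (θ - b) ^ 2, by simp_all, fun i => by
        fin_cases i <;> simp [conicPt] <;> field_simp <;> ring⟩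
    · exact ⟨-(a * (1 + a)) / (θ - a) ^ 2, by simp_all, fun i => by
        fin_cases i <;> simp [conicPt] <;> field_simp <;> ring⟩

lemma one_add_ne_zero {s : Fin 3 → ℂ} (hs1 : ∀ i, s i ≠ -1) (i : Fin 3) : 1 + s i ≠ 0 :=
  fun h => hs1 i (by linear_combination h)

set_option maxHeartbeats 1000000 in
/-- The conic through the coordinate points and two of the points `(1 : s i : -1 - s i)`. -/
noncomputable def conic {s : Fin 3 → ℂ} (hs0 : ∀ i, s i ≠ 0) (hs1 : ∀ i, s i ≠ -1)
    (hs : Function.Injective s) (k : Fin 3) : Curve (pt s) where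
  q := conicPoly (s (k + 1)) (s (k + 2))
  e := 2
  J := ![{0, 1, 2, 7, 8}, {0, 1, 2, 8, 6}, {0, 1, 2, 6, 7}] k
  ne_zero := (prime_conicPoly (hs0 _) (one_add_ne_zero hs1 _) (hs0 _)
    (one_add_ne_zero hs1 _)).ne_zero
  e_pos := two_pos
  isHomogeneous := conicPoly_isHomogeneous _ _
  eval_eq_zero j hj := by
    fin_cases k <;> simp at hj <;> rcases hj with rfl | rfl | rfl | rfl | rfl <;>
      simp [pt] <;> ring
  smooth j hj := by
    have h1 := one_add_ne_zero hs1
    have h (c d : Fin 3) : s c * s d + s c ≠ 0 := fun h =>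
      mul_ne_zero (hs0 c) (h1 d) (by linear_combination h)
    have h' (c d : Fin 3) : s c * s d + s d ≠ 0 := by simpa only [mul_comm] using h d c
    fin_cases k <;> simp at hj <;> rcases hj with rfl | rfl | rfl | rfl | rfl <;>
      first
      | (refine ⟨1, ?_⟩; simp [eval_pderiv_one_conicPoly, pt, h1]; done)
      | (refine ⟨2, ?_⟩; simp [eval_pderiv_two_conicPoly, pt, h, h'])
  eval_ne_zero j hj := by
    have h1 := one_add_ne_zero hs1
    have h (c d e : Fin 3) (hd : c ≠ d) (he : c ≠ e) :
        (s d * s e * (-1 - s c) + (1 + s d) * (1 + s e) * s c) + s c * (-1 - s c) ≠ 0 := fun h =>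
      mul_ne_zero (sub_ne_zero.2 (hs.ne hd)) (sub_ne_zero.2 (hs.ne he)) (by linear_combination -h)
    fin_cases k <;> fin_cases j <;> simp at hj <;> simp [pt, h1, hs0, h]
  bezout F n hF hlt := by
    refine conicPoly_dvd (hs0 _) (one_add_ne_zero hs1 _) (hs0 _) (one_add_ne_zero hs1 _)
      (hs.ne (by fin_cases k <;> decide))
      (n := fun j => n (![![0, 1, 2, 7, 8], ![0, 1, 2, 8, 6], ![0, 1, 2, 6, 7]] k j))
      (fun j => ?_) (hlt.trans_eq ?_)
    · convert hF _
      fin_cases k <;> fin_cases j <;> rfl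
    · fin_cases k <;> simp [Fin.sum_univ_five, Finset.sum_insert] <;> ring

end Conic

section Bounds

variable {s : Fin 3 → ℂ} (hs0 : ∀ i, s i ≠ 0) (hs1 : ∀ i, s i ≠ -1) (hs : Function.Injective s)

/-- The negative curves of the configuration. -/
noncomputable def curves : Fin 7 → Curve (pt s) :=
  ![mainLine hs0 hs1 hs, side hs0 hs1 0, side hs0 hs1 1, side hs0 hs1 2,
    conic hs0 hs1 hs 0, conic hs0 hs1 hs 1, conic hs0 hs1 hs 2]

lemma curves_e : (fun k => (curves hs0 hs1 hs k).e) = ![1, 1, 1, 1, 2, 2, 2] := by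
  funext k
  fin_cases k <;> rfl

lemma curves_J : (fun k => (curves hs0 hs1 hs k).J) =
    ![{3, 4, 5, 6, 7, 8}, {1, 2, 5}, {0, 2, 4}, {0, 1, 3},
      {0, 1, 2, 7, 8}, {0, 1, 2, 8, 6}, {0, 1, 2, 6, 7}] := by
  funext k
  fin_cases k <;> rfl

theorem seventeen_mul_le (hs0 : ∀ i, s i ≠ 0) (hs1 : ∀ i, s i ≠ -1)
    (hs : Function.Injective s) {m : ℕ} {F : R} (hF : F ≠ 0) (h : ∀ j, VanishesAlong m F (pt s j)) :
    17 * m ≤ 7 * F.totalDegree := by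
  have he := fun k => congrFun (curves_e hs0 hs1 hs) k
  have hJ := fun k => congrFun (curves_J hs0 hs1 hs) k
  have := sum_mul_le_mul_totalDegree (curves hs0 hs1 hs) ![10, 10, 10, 1, 1, 1, 6, 6, 6] 21
    (fun k => by
      simp only [he, hJ]
      fin_cases k <;> decide)
    (fun n d hk => by
      simp only [he, hJ] at hk
      have h0 := hk 0
      have h1 := hk 1
      have h2 := hk 2
      have h3 := hk 3
      have h4 := hk 4
      have h5 := hk 5
      have h6 := hk 6
      clear hk
      simp [Finset.sum_insert] at h0 h1 h2 h3 h4 h5 h6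
      simp [Fin.sum_univ_succ]
      lia)
    F hF (fun _ => m) h
  rw [← Finset.sum_mul] at this
  simp [Fin.sum_univ_succ] at this
  lia

theorem exists_isHomogeneous_seventeen (hs0 : ∀ i, s i ≠ 0) (hs1 : ∀ i, s i ≠ -1)
    (hs : Function.Injective s) : ∃ F : R, F ≠ 0 ∧ F.IsHomogeneous 17 ∧
    ∀ j, VanishesAlong 7 F (pt s j) := by
  have he := fun k => congrFun (curves_e hs0 hs1 hs) k
  have hJ := fun k => congrFun (curves_J hs0 hs1 hs) k
  refine ⟨∏ k, (curves hs0 hs1 hs k).q ^ (![5, 2, 2, 2, 1, 1, 1] k : ℕ),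
    Finset.prod_ne_zero_iff.2 fun k _ => pow_ne_zero _ (curves hs0 hs1 hs k).ne_zero, ?_,
    fun j => vanishesAlong_prod _ _ ?_⟩
  · have := MvPolynomial.IsHomogeneous.prod Finset.univ _ _
      fun k _ => (curves hs0 hs1 hs k).isHomogeneous.pow (![5, 2, 2, 2, 1, 1, 1] k)
    simp only [he] at this
    exact this
  · simp only [hJ]
    fin_cases j <;> decide

end Bounds

section Substitution

/-- The linear substitution `F ↦ F ∘ M` on polynomials. -/
noncomputable def substitute (M : (Fin 3 → ℂ) →ₗ[ℂ] (Fin 3 → ℂ)) : R →ₐ[ℂ] R :=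
  MvPolynomial.aeval fun i => ∑ j, MvPolynomial.C (M (Pi.single j 1) i) * MvPolynomial.X j

variable (M : (Fin 3 → ℂ) →ₗ[ℂ] (Fin 3 → ℂ))

lemma apply_eq_sum_single (w : Fin 3 → ℂ) (i : Fin 3) : M w i = ∑ j, M (Pi.single j 1) i * w j := by
  conv_lhs => rw [← Finset.univ_sum_single w, map_sum, Finset.sum_apply]
  refine Finset.sum_congr rfl fun j _ => ?_
  rw [← mul_one (w j), ← smul_eq_mul, Pi.single_smul, map_smul]
  simp [mul_comm]

@[simp]
lemma substitute_X (i : Fin 3) : substitute M (MvPolynomial.X i) =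
    ∑ j, MvPolynomial.C (M (Pi.single j 1) i) * MvPolynomial.X j := by
  simp [substitute]

@[simp]
lemma substitute_C (a : ℂ) : substitute M (MvPolynomial.C a) = MvPolynomial.C a := by
  simp [substitute]

lemma map_substitute_taylorAt (w : Fin 3 → ℂ) (F : R) :
    (taylorAt (M w) F).map (substitute M : R →+* R) = taylorAt w (substitute M F) := by
  induction F using MvPolynomial.induction_on with
  | C a => simp
  | add p q hp hq => simp [hp, hq]
  | mul_X p i hp =>
    rw [map_mul, Polynomial.map_mul, hp, map_mul, map_mul]
    congr 1
    rw [taylorAt_X, Polynomial.map_add, Polynomial.map_mul, Polynomial.map_C, Polynomial.map_C,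
      Polynomial.map_X, RingHom.coe_coe, substitute_C, substitute_X, apply_eq_sum_single M w i]
    simp only [map_sum, map_mul, taylorAt_C, taylorAt_X, Finset.mul_sum, mul_add,
      Finset.sum_add_distrib, mul_left_comm Polynomial.X]

lemma X_pow_dvd_taylorAt_substitute {m : ℕ} {w : Fin 3 → ℂ} {F : R}
    (h : Polynomial.X ^ m ∣ taylorAt (M w) F) :
    Polynomial.X ^ m ∣ taylorAt w (substitute M F) := by
  rw [← map_substitute_taylorAt]
  simpa using map_dvd (Polynomial.mapRingHom (substitute M : R →+* R)) h

lemma substitute_isHomogeneous {F : R} {n : ℕ} (hF : F.IsHomogeneous n) :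
    (substitute M F).IsHomogeneous n := by
  simpa [substitute] using hF.aeval _ (n := 1) fun i => MvPolynomial.IsHomogeneous.sum _ _ _ fun j _ =>
    (MvPolynomial.isHomogeneous_X _ j).C_mul (M (Pi.single j 1) i)

lemma eval_substitute (w : Fin 3 → ℂ) (F : R) :
    MvPolynomial.eval w (substitute M F) = MvPolynomial.eval (M w) F := by
  induction F using MvPolynomial.induction_on with
  | C a => simp
  | add p q hp hq => simp [hp, hq]
  | mul_X p i hp => simp [hp, apply_eq_sum_single M w i]

lemma substitute_ne_zero {M : (Fin 3 → ℂ) →ₗ[ℂ] (Fin 3 → ℂ)} (hM : Function.Surjective M) {F : R}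
    (hF : F ≠ 0) : substitute M F ≠ 0 := fun h => hF <| MvPolynomial.funext fun v => by
  obtain ⟨w, rfl⟩ := hM v
  rw [← eval_substitute, h, map_zero, map_zero]

end Substitution

section NormalForm

lemma exists_dual_eq_eval {L : R} (hL : IsLine L) :
    ∃ l : Module.Dual ℂ (Fin 3 → ℂ), l ≠ 0 ∧ ∀ v, MvPolynomial.eval v L = l v := by
  have hc (i) : pderiv i L = MvPolynomial.C (MvPolynomial.coeff 0 (pderiv i L)) :=
    MvPolynomial.totalDegree_eq_zero_iff_eq_C.1
      (Nat.le_zero.1 (MvPolynomial.IsHomogeneous.totalDegree_le hL.2.pderiv))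
  have hE := hL.2.sum_X_mul_pderiv
  have key : ∀ v, MvPolynomial.eval v L =
      (∑ i, MvPolynomial.coeff 0 (pderiv i L) • LinearMap.proj i : Module.Dual ℂ (Fin 3 → ℂ)) v :=
    fun v => by
      conv_lhs => rw [← one_smul ℕ L, ← hE, map_sum]
      simp only [LinearMap.sum_apply, LinearMap.smul_apply, LinearMap.proj_apply, smul_eq_mul]
      refine Finset.sum_congr rfl fun i _ => ?_
      rw [hc i]
      simp [mul_comm]
  exact ⟨_, fun h => hL.1 (MvPolynomial.funext fun v => by rw [key, h]; simp), key⟩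

lemma memLine_mk_iff {L : R} {l : Module.Dual ℂ (Fin 3 → ℂ)}
    (hl : ∀ v, MvPolynomial.eval v L = l v) {v : Fin 3 → ℂ} (hv : v ≠ 0) :
    MemLine L (Projectivization.mk ℂ v hv) ↔ l v = 0 := by
  refine ⟨fun h => hl v ▸ h v hv rfl, fun h w hw hwv => ?_⟩
  obtain ⟨c, rfl⟩ := (Projectivization.mk_eq_mk_iff' ℂ _ _ hw hv).1 hwv
  rw [hl, map_smul, h, smul_zero]

lemma exists_eq_add_of_apply_eq_zero {l : Module.Dual ℂ (Fin 3 → ℂ)} (hl : l ≠ 0)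
    {u v w : Fin 3 → ℂ} (huv : LinearIndependent ℂ ![u, v]) (hu : l u = 0) (hv : l v = 0)
    (hw : l w = 0) : ∃ a b : ℂ, a • u + b • v = w := by
  have hle : Submodule.span ℂ {u, v} ≤ LinearMap.ker l := by
    rw [Submodule.span_le]
    rintro _ (rfl | rfl) <;> assumption
  have h2 : Module.finrank ℂ (Submodule.span ℂ {u, v}) = 2 := by
    have := finrank_span_eq_card huv
    rwa [Matrix.range_cons, Matrix.range_cons, Matrix.range_empty, Set.union_empty,
      Fintype.card_fin] at this
  have hker : Module.finrank ℂ (LinearMap.ker l) = 2 := by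
    have := Module.Dual.finrank_ker_add_one_of_ne_zero hl
    simpa using this
  have := Submodule.eq_of_le_of_finrank_eq hle (h2.trans hker.symm)
  exact Submodule.mem_span_pair.1 (this ▸ (LinearMap.mem_ker.2 hw))

/-- Points off the line `l = 0` have a representative with `l = 1`. -/
lemma exists_mk_eq_of_not_memLine {L : R} {l : Module.Dual ℂ (Fin 3 → ℂ)}
    (hl : ∀ v, MvPolynomial.eval v L = l v) {x : ℙ ℂ (Fin 3 → ℂ)} (hx : ¬ MemLine L x) :
    ∃ v, ∃ hv : v ≠ 0, Projectivization.mk ℂ v hv = x ∧ l v = 1 := by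
  induction x using Projectivization.ind with
  | h v hv =>
  rw [memLine_mk_iff hl] at hx
  refine ⟨(l v)⁻¹ • v, smul_ne_zero (inv_ne_zero hx) hv, ?_, by simp [hx]⟩
  exact (Projectivization.mk_eq_mk_iff' ℂ _ _ _ _).2 ⟨(l v)⁻¹, rfl⟩

/-- If the normalized points `u`, `v` are distinct, then the line through them meets `l = 0` in the
point represented by `u - v`. -/
lemma exists_mk_sub_eq {L L' : R} {l : Module.Dual ℂ (Fin 3 → ℂ)}
    (hl : ∀ v, MvPolynomial.eval v L = l v) (hL' : IsLine L') {u v : Fin 3 → ℂ} (hu : u ≠ 0)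
    (hv : v ≠ 0) (hlu : l u = 1) (hlv : l v = 1) (huv : u ≠ v)
    (hu' : MemLine L' (Projectivization.mk ℂ u hu)) (hv' : MemLine L' (Projectivization.mk ℂ v hv))
    {x : ℙ ℂ (Fin 3 → ℂ)} (hx : MemLine L x) (hx' : MemLine L' x) :
    Projectivization.mk ℂ (u - v) (sub_ne_zero.2 huv) = x := by
  obtain ⟨l', hl'0, hl'⟩ := exists_dual_eq_eval hL'
  induction x using Projectivization.ind with
  | h w hw =>
  rw [memLine_mk_iff hl] at hx
  rw [memLine_mk_iff hl'] at hu' hv' hx'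
  have hind : LinearIndependent ℂ ![u, v] := by
    refine LinearIndependent.pair_iff.2 fun a b hab => ?_
    have h := congrArg l hab
    simp only [map_add, map_smul, hlu, hlv, smul_eq_mul, mul_one, map_zero] at h
    obtain rfl : b = -a := by linear_combination h
    have : a • (u - v) = 0 := by rw [← hab]; module
    have := (smul_eq_zero.1 this).resolve_right (sub_ne_zero.2 huv)
    simp [this]
  obtain ⟨a, b, rfl⟩ := exists_eq_add_of_apply_eq_zero hl'0 hind hu' hv' hx'
  simp only [map_add, map_smul, hlu, hlv, smul_eq_mul, mul_one] at hx
  obtain rfl : b = -a := by linear_combination hx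
  refine ((Projectivization.mk_eq_mk_iff' ℂ _ _ _ _).2 ⟨a, ?_⟩).symm
  module

lemma exists_remaining_points {α : Type*} {Z S : Set α} (hfin : Z.Finite) (hcard : Z.ncard = 9)
    (hS : (Z ∩ S).ncard = 6) {Q₁ Q₂ C P A B : α} (hQ₁ : Q₁ ∈ Z ∩ S) (hQ₂ : Q₂ ∈ Z ∩ S)
    (hC : C ∈ Z ∩ S) (hQ : Q₁ ≠ Q₂) (hQ₁C : Q₁ ≠ C) (hQ₂C : Q₂ ≠ C) (hP : P ∈ Z \ S)
    (hA : A ∈ Z \ S) (hB : B ∈ Z \ S) (hPA : P ≠ A) (hPB : P ≠ B) (hAB : A ≠ B) :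
    ∃ D : Fin 3 → α, Function.Injective D ∧
      (∀ i, D i ∈ S ∧ D i ≠ Q₁ ∧ D i ≠ Q₂ ∧ D i ≠ C) ∧
      Z = {P, A, B, Q₁, Q₂, C, D 0, D 1, D 2} := by
  have h3 : ∀ {x y z : α}, x ≠ y → x ≠ z → y ≠ z → ({x, y, z} : Set α).ncard = 3 :=
    fun h1 h2 h3 => Set.ncard_eq_three.2 ⟨_, _, _, h1, h2, h3, rfl⟩
  have hsub : ({Q₁, Q₂, C} : Set α) ⊆ Z ∩ S := by
    rintro _ (rfl | rfl | rfl) <;> assumption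
  have hsub' : ({P, A, B} : Set α) ⊆ Z \ S := by
    rintro _ (rfl | rfl | rfl) <;> assumption
  have hd := Set.ncard_sdiff_add_ncard_of_subset hsub (hfin.subset Set.inter_subset_left)
  have hd' := Set.ncard_inter_add_ncard_sdiff_eq_ncard Z S hfin
  rw [h3 hQ hQ₁C hQ₂C, hS] at hd
  obtain ⟨x, y, z, hxy, hxz, hyz, hD⟩ := Set.ncard_eq_three.1
    (show ((Z ∩ S) \ {Q₁, Q₂, C}).ncard = 3 by lia)
  have hPAB : {P, A, B} = Z \ S := Set.eq_of_subset_of_ncard_le hsub'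
    (by rw [h3 hPA hPB hAB]; lia) hfin.sdiff
  refine ⟨![x, y, z], ?_, ?_, ?_⟩
  · intro i j hij
    fin_cases i <;> fin_cases j <;> simp_all
  · intro i
    have : ![x, y, z] i ∈ (Z ∩ S) \ {Q₁, Q₂, C} := by
      rw [hD]
      fin_cases i <;> simp
    simp at this
    tauto
  · rw [← Set.inter_union_sdiff Z S, ← hPAB, ← Set.sdiff_union_of_subset hsub, hD]
    ext
    simp

end NormalForm

section Reduction

lemma pt_ne_zero (s : Fin 3 → ℂ) (j : Fin 9) : pt s j ≠ 0 := fun h => by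
  have h0 := congrFun h 0
  have h1 := congrFun h 1
  have h2 := congrFun h 2
  fin_cases j <;> simp_all [pt]

/-- Up to a linear change of coordinates, `Z` is the set of points `pt s`. -/
theorem exists_normalForm {Z : Set (ℙ ℂ (Fin 3 → ℂ))} (hfin : Z.Finite) (hcard : Z.ncard = 9)
    (hconf : StandardConfig 6 Z) : ∃ s : Fin 3 → ℂ, (∀ i, s i ≠ 0) ∧ (∀ i, s i ≠ -1) ∧
      Function.Injective s ∧ ∃ M : (Fin 3 → ℂ) ≃ₗ[ℂ] (Fin 3 → ℂ),
        Z = Set.range fun j =>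
          Projectivization.mk ℂ (M (pt s j)) (by simpa using pt_ne_zero s j) := by
  obtain ⟨L, L₁, L₂, L₃, Q₁, Q₂, C, P, A, B, hL, hL₁, hL₂, hL₃, hQ₁Z, hQ₂Z, hCZ, hPZ, hAZ, hBZ, hQ,
    hQ₁C, hQ₂C, hQ₁, hQ₂, hC, hncard, hP, hP₁, hQ₁₁, hA₁, hAP, -, hA, hP₂, hQ₂₂, hB₂, hBP, -, hB,
    hA₃, hB₃, hC₃, -⟩ := hconf
  obtain ⟨l, hl0, hl⟩ := exists_dual_eq_eval hL
  obtain ⟨p, hp0, rfl, hlp⟩ := exists_mk_eq_of_not_memLine hl hP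
  obtain ⟨a, ha0, rfl, hla⟩ := exists_mk_eq_of_not_memLine hl hA
  obtain ⟨b, hb0, rfl, hlb⟩ := exists_mk_eq_of_not_memLine hl hB
  have hpa : p ≠ a := by rintro rfl; exact hAP rfl
  have hpb : p ≠ b := by rintro rfl; exact hBP rfl
  obtain rfl := exists_mk_sub_eq hl hL₁ hp0 ha0 hlp hla hpa hP₁ hA₁ hQ₁ hQ₁₁
  obtain rfl := exists_mk_sub_eq hl hL₂ hp0 hb0 hlp hlb hpb hP₂ hB₂ hQ₂ hQ₂₂
  have hab : a ≠ b := by rintro rfl; exact hQ rfl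
  obtain rfl := exists_mk_sub_eq hl hL₃ ha0 hb0 hla hlb hab hA₃ hB₃ hC hC₃
  have hsub : ∀ x y : ℂ, x • (p - a) + y • (p - b) = 0 → x = 0 ∧ y = 0 := by
    intro x y hxy
    have hx : x = 0 := by
      by_contra hx
      refine hQ ((Projectivization.mk_eq_mk_iff' ℂ _ _ _ _).2 ⟨-y / x, ?_⟩)
      refine smul_right_injective _ hx ?_
      simp only [smul_smul, mul_div_cancel₀ _ hx]
      rw [neg_smul]
      exact (eq_neg_of_add_eq_zero_left hxy).symm
    rw [hx, zero_smul, zero_add, smul_eq_zero] at hxy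
    exact ⟨hx, hxy.resolve_right (sub_ne_zero.2 hpb)⟩
  have hind : LinearIndependent ℂ ![p, a, b] := by
    refine Fintype.linearIndependent_iff.2 fun g hg => ?_
    simp only [Fin.sum_univ_three, Matrix.cons_val] at hg
    have h := congrArg l hg
    simp only [map_add, map_smul, hlp, hla, hlb, smul_eq_mul, mul_one, map_zero] at h
    obtain ⟨h1, h2⟩ := hsub (g 1) (g 2) (by
      rw [← neg_eq_zero, ← hg, show g 0 = - g 1 - g 2 by linear_combination h]
      module)
    intro i
    fin_cases i
    · simpa [h1, h2] using h
    · exact h1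
    · exact h2
  let bas : Module.Basis (Fin 3) ℂ (Fin 3 → ℂ) :=
    basisOfLinearIndependentOfCardEqFinrank hind (by simp)
  have hbas : ⇑bas = ![p, a, b] := coe_basisOfLinearIndependentOfCardEqFinrank hind _
  let M := bas.equivFun.symm
  have hM (v) : M v = v 0 • p + v 1 • a + v 2 • b := by
    simp [M, Module.Basis.equivFun_symm_apply, Fin.sum_univ_three, hbas]
  obtain ⟨D, hDinj, hD, hZ⟩ := exists_remaining_points hfin hcard (S := {x | MemLine L x}) hncard
    ⟨hQ₁Z, hQ₁⟩ ⟨hQ₂Z, hQ₂⟩ ⟨hCZ, hC⟩ hQ hQ₁C hQ₂C ⟨hPZ, hP⟩ ⟨hAZ, hA⟩ ⟨hBZ, hB⟩ hAP.symm hBP.symm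
    (fun h => by
      obtain ⟨c, hc⟩ := (Projectivization.mk_eq_mk_iff' ℂ _ _ _ _).1 h
      have hc1 : c = 1 := by simpa [hla, hlb] using congrArg l hc
      exact hab (by rw [← hc, hc1, one_smul]))
  have hDs (i) : ∃ c : ℂ, ∃ h, D i = Projectivization.mk ℂ (M ![1, c, -1 - c]) h ∧
      c ≠ 0 ∧ c ≠ -1 := by
    obtain ⟨hDL, hD₁, hD₂, hD₃⟩ := hD i
    generalize D i = x at *
    induction x using Projectivization.ind with
    | h w hw =>
    obtain ⟨v, rfl⟩ := M.surjective w
    have hx : l (M v) = 0 := (memLine_mk_iff hl hw).1 hDL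
    simp only [hM, map_add, map_smul, hlp, hla, hlb, smul_eq_mul, mul_one] at hx
    have hv2 : v 2 = - v 0 - v 1 := by linear_combination hx
    have hv0 : v 0 ≠ 0 := fun h0 => hD₃ <| (Projectivization.mk_eq_mk_iff' ℂ _ _ _ _).2 ⟨v 1, by
      rw [hM, hv2, h0]; module⟩
    refine ⟨v 1 / v 0, ?_, (Projectivization.mk_eq_mk_iff' ℂ _ _ _ _).2 ⟨v 0, ?_⟩, ?_, ?_⟩
    · rw [ne_eq, LinearEquiv.map_eq_zero_iff]
      exact fun h => by simpa using congrFun h 0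
    · rw [← map_smul]
      congr 1
      ext j
      fin_cases j <;> simp [hv2] <;> field_simp
    · intro h
      have h : v 1 = 0 := by simpa [hv0] using h
      exact hD₂ <| (Projectivization.mk_eq_mk_iff' ℂ _ _ _ _).2 ⟨v 0, by
        rw [hM, hv2, h]; module⟩
    · intro h
      have h : v 1 = - v 0 := by field_simp at h; exact h
      exact hD₁ <| (Projectivization.mk_eq_mk_iff' ℂ _ _ _ _).2 ⟨v 0, by
        rw [hM, hv2, h]; module⟩
  choose s hs hDs hs0 hs1 using hDs
  refine ⟨s, hs0, hs1, fun i j hij => hDinj ?_, M, ?_⟩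
  · simp only [hDs, hij]
  · have hrange : (fun j => Projectivization.mk ℂ (M (pt s j)) (by simpa using pt_ne_zero s j)) =
        ![Projectivization.mk ℂ p hp0, Projectivization.mk ℂ a ha0, Projectivization.mk ℂ b hb0,
          Projectivization.mk ℂ (p - a) (sub_ne_zero.2 hpa),
          Projectivization.mk ℂ (p - b) (sub_ne_zero.2 hpb),
          Projectivization.mk ℂ (a - b) (sub_ne_zero.2 hab), D 0, D 1, D 2] := by
      funext j
      fin_cases j
      iterate 6
        exact (Projectivization.mk_eq_mk_iff' ℂ _ _ _ _).2
          ⟨1, by rw [one_smul, hM]; simp [pt, sub_eq_add_neg]⟩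
      exacts [(hDs 0).symm, (hDs 1).symm, (hDs 2).symm]
    rw [hZ, hrange]
    simp only [Matrix.range_cons, Matrix.range_empty, Set.union_empty, Set.singleton_union]

/-- Membership in the symbolic power in terms of the normal form. -/
lemma mem_symbolicPower_range_iff {s : Fin 3 → ℂ} {M : (Fin 3 → ℂ) ≃ₗ[ℂ] (Fin 3 → ℂ)} {m : ℕ}
    {F : R} : F ∈ symbolicPower (Set.range fun j =>
      Projectivization.mk ℂ (M (pt s j)) (by simpa using pt_ne_zero s j)) m ↔
        ∀ j, VanishesAlong m F (M (pt s j)) := by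
  simp only [symbolicPower, Set.mem_ofPred_eq, Set.forall_mem_range, vanishesToOrder_iff]
  refine forall_congr' fun j => ⟨fun h c hc => ?_, fun h v hv hj => ?_⟩
  · exact h (c • M (pt s j)) (smul_ne_zero hc (by simpa using pt_ne_zero s j))
      ((Projectivization.mk_eq_mk_iff' ℂ _ _ _ _).2 ⟨c, rfl⟩)
  · obtain ⟨c, rfl⟩ := (Projectivization.mk_eq_mk_iff' ℂ _ _ _ _).1 hj
    exact h c (left_ne_zero_of_smul hv)

lemma VanishesAlong.substitute {M : (Fin 3 → ℂ) →ₗ[ℂ] (Fin 3 → ℂ)} {m : ℕ} {F : R}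
    {w : Fin 3 → ℂ} (h : VanishesAlong m F (M w)) : VanishesAlong m (substitute M F) w :=
  fun c hc => X_pow_dvd_taylorAt_substitute M (by rw [map_smul]; exact h c hc)

lemma VanishesAlong.pow {m : ℕ} {F : R} {w : Fin 3 → ℂ} (h : VanishesAlong m F w) (k : ℕ) :
    VanishesAlong (m * k) (F ^ k) w := fun c hc => by
  rw [map_pow, pow_mul]
  exact pow_dvd_pow_of_dvd (h c hc) k

end Reduction

end NinePoints

open NinePoints in
/-- A set of `9` points of `ℙ²` forming the configuration with a line containing exactly six of
the points (as in `StandardConfig 6`) has Waldschmidt constant `17/7`. -/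
theorem waldschmidt_nine_point_config (Z : Set (ℙ ℂ (Fin 3 → ℂ)))
    (hfin : Z.Finite) (hcard : Z.ncard = 9) (hconf : StandardConfig 6 Z) :
    waldschmidt Z = 17 / 7 := by
  obtain ⟨s, hs0, hs1, hs, M, rfl⟩ := exists_normalForm hfin hcard hconf
  obtain ⟨G, hG0, hG, hGv⟩ := exists_isHomogeneous_seventeen hs0 hs1 hs
  obtain ⟨F, hF0, hF, hFv⟩ : ∃ F : R, F ≠ 0 ∧ F.IsHomogeneous 17 ∧
      ∀ j, VanishesAlong 7 F (M (pt s j)) :=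
    ⟨substitute M.symm.toLinearMap G, substitute_ne_zero M.symm.surjective hG0,
      substitute_isHomogeneous _ hG, fun j => VanishesAlong.substitute (by simpa using hGv j)⟩
  have hbdd : BddBelow (Set.range fun m : ℕ+ => (initialDegree (symbolicPower (Set.range fun j =>
      Projectivization.mk ℂ (M (pt s j)) (by simpa using pt_ne_zero s j)) (m : ℕ)) : ℝ) /
        ((m : ℕ) : ℝ)) := ⟨0, by rintro _ ⟨m, rfl⟩; positivity⟩
  refine le_antisymm ((ciInf_le hbdd 7).trans ?_) (le_ciInf fun m => ?_)
  · have h : initialDegree (symbolicPower (Set.range fun j =>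
        Projectivization.mk ℂ (M (pt s j)) (by simpa using pt_ne_zero s j)) 7) ≤ 17 :=
      Nat.sInf_le ⟨F, mem_symbolicPower_range_iff.2 hFv, hF0, hF⟩
    have h' : (((7 : ℕ+) : ℕ) : ℝ) = 7 := by norm_num
    rw [h']
    gcongr
    exact_mod_cast h
  · obtain ⟨H, hHm, hH0, hH⟩ := Nat.sInf_mem
      (s := {t | ∃ F ∈ symbolicPower (Set.range fun j => Projectivization.mk ℂ (M (pt s j))
        (by simpa using pt_ne_zero s j)) (m : ℕ), F ≠ 0 ∧ F.IsHomogeneous t})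
      ⟨17 * m, F ^ (m : ℕ), mem_symbolicPower_range_iff.2 fun j c hc =>
        (pow_dvd_pow _ (by lia)).trans ((hFv j).pow m c hc), pow_ne_zero _ hF0, hF.pow m⟩
    have hle := seventeen_mul_le hs0 hs1 hs
      (substitute_ne_zero (M := M.toLinearMap) M.surjective hH0)
      fun j => (mem_symbolicPower_range_iff.1 hHm j).substitute
    rw [(substitute_isHomogeneous _ hH).totalDegree
      (substitute_ne_zero (M := M.toLinearMap) M.surjective hH0)] at hle
    rw [div_le_div_iff₀ (by norm_num) (by exact_mod_cast m.pos), mul_comm (_ : ℝ) 7]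
    exact_mod_cast hle
end
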